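/- arXiv:2506.02446 — 2 statements merged into one kernel-verified Lean document; each statement's English description precedes it below -/
import Mathlib

section
/- Let q > 23 be an odd prime power, let (a,b) be a valid pair in F_q^2 with a ≠ b, and let i ∈ {1,2,3}. If Atp_i(Q_{a,b}) is not 2-transitive, then every element of Atp_i(Q_{a,b}) is an affine permutation of F_q (i.e., Atp_i(Q_{a,b}) ≤ AGL_d(p)). -/
open scoped Classical
open Finset

noncomputable section

variable {F : Type*} [Field F] [Fintype F]

/-- `x ∈ R_q`: `x` is a nonzero square in `F`. -/
def inR (x : F) : Prop := x ≠ 0 ∧ IsSquare x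

/-- `x ∈ N_q`: `x` is a nonzero non-square in `F`. -/
def inN (x : F) : Prop := x ≠ 0 ∧ ¬ IsSquare x

/-- `(a, b)` is a valid pair: `ab ∈ R_q` and `(a-1)(b-1) ∈ R_q`. -/
def ValidPair (a b : F) : Prop := inR (a * b) ∧ inR ((a - 1) * (b - 1))

/-- The operation of the quadratic quasigroup `Q_{a,b}`:
`x*y = x + a(y-x)` if `y - x ∈ R_q`, `x*y = x + b(y-x)` if `y - x ∈ N_q`, and `x*x = x`. -/
def qmul (a b x y : F) : F :=
  if inR (y - x) then x + a * (y - x) else x + b * (y - x)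

/-- `(α, β, γ)` is an autotopism of the quadratic quasigroup `Q_{a,b}`. -/
def IsAutotopism (a b : F) (α β γ : Equiv.Perm F) : Prop :=
  ∀ x y : F, qmul a b (α x) (β y) = γ (qmul a b x y)

/-- `Atp_i(Q_{a,b})`: the projection of the autotopism group of `Q_{a,b}` onto its
`i`-th coordinate (for `i : Fin 3`). -/
def AtpProj (a b : F) (i : Fin 3) : Set (Equiv.Perm F) :=
  {δ | ∃ α β γ : Equiv.Perm F, IsAutotopism a b α β γ ∧ δ = ![α, β, γ] i}

/-- A permutation of `F_q` is affine (an element of `AGL_d(p)`) if it has the form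
`x ↦ ψ(x) + c` for an additive bijection `ψ` and a constant `c`. -/
def IsAffinePerm (f : Equiv.Perm F) : Prop :=
  ∃ (ψ : F ≃+ F) (c : F), ∀ x : F, f x = ψ x + c

/-- A set of permutations of `F_q` is 2-transitive. -/
def TwoTransitive (G : Set (Equiv.Perm F)) : Prop :=
  ∀ x₁ y₁ x₂ y₂ : F, x₁ ≠ y₁ → x₂ ≠ y₂ → ∃ g ∈ G, g x₁ = x₂ ∧ g y₁ = y₂

/-- Power sums over a finite field. -/
lemma aux_sum_pow (i : ℕ) (hi : i < 2 * (Fintype.card F - 1)) :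
    ∑ x : F, x ^ i = if i = Fintype.card F - 1 then -1 else 0 := by
  rcases lt_trichotomy i (Fintype.card F - 1) with h | h | h
  · rw [if_neg h.ne, FiniteField.sum_pow_lt_card_sub_one F i h]
  · rw [if_pos h, h]
    have h1 : ∀ x : F, x ^ (Fintype.card F - 1) = 1 - if x = 0 then 1 else 0 := by
      intro x
      by_cases hx : x = 0
      · subst hx
        rw [zero_pow (by omega)]; simp
      · simp [hx, FiniteField.pow_card_sub_one_eq_one x hx]
    simp_rw [h1]
    simp
  · rw [if_neg h.ne']
    have h1 : ∀ x : F, x ^ i = x ^ (i - (Fintype.card F - 1)) := by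
      intro x
      by_cases hx : x = 0
      · subst hx
        rw [zero_pow (by omega), zero_pow (by omega)]
      · conv_lhs => rw [← Nat.sub_add_cancel h.le, pow_add,
          FiniteField.pow_card_sub_one_eq_one x hx, mul_one]
    simp_rw [h1]
    exact FiniteField.sum_pow_lt_card_sub_one F _ (by omega)

lemma aux_pow_congr (a b : ℕ) (ha : 0 < a) (hb : 0 < b)
    (hab : a ≡ b [MOD (Fintype.card F - 1)]) (x : F) : x ^ a = x ^ b := by
  by_cases hx : x = 0
  · subst hx
    rw [zero_pow (by omega), zero_pow (by omega)]
  · have h1 := FiniteField.pow_card_sub_one_eq_one x hx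
    rw [← Nat.mod_add_div a (Fintype.card F - 1), ← Nat.mod_add_div b (Fintype.card F - 1),
      pow_add, pow_add, pow_mul, pow_mul, h1, one_pow, one_pow, hab]

lemma aux_coeff (P : Polynomial F) (s : ℕ) (hs : s ≤ Fintype.card F - 1)
    (hP : P.natDegree + s < 2 * (Fintype.card F - 1)) :
    ∑ x : F, P.eval x * x ^ s = - P.coeff (Fintype.card F - 1 - s) := by
  simp_rw [Polynomial.eval_eq_sum_range, Finset.sum_mul, mul_assoc, ← pow_add]
  rw [Finset.sum_comm]
  simp_rw [← Finset.mul_sum]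
  have h1 : ∀ i ∈ Finset.range (P.natDegree + 1), P.coeff i * ∑ x : F, x ^ (i + s)
      = if i = Fintype.card F - 1 - s then - P.coeff i else 0 := by
    intro i hi
    rw [Finset.mem_range] at hi
    rw [aux_sum_pow _ (by omega)]
    by_cases h : i = Fintype.card F - 1 - s
    · rw [if_pos h, if_pos (by omega)]; ring
    · rw [if_neg h, if_neg (by omega)]; ring
  rw [Finset.sum_congr rfl h1, Finset.sum_ite_eq']
  split_ifs with h
  · rfl
  · rw [Polynomial.coeff_eq_zero_of_natDegree_lt, neg_zero]
    rw [Finset.mem_range] at h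
    omega

lemma aux_repr (f : F → F) (hf : Function.Bijective f) (m : ℕ) (hm : Fintype.card F = 2 * m + 1)
    (H : ∀ x y, (f x - f y) ^ m = (x - y) ^ m) (k : ℕ) (hk : ((m.choose k : ℕ) : F) ≠ 0) :
    ∃ P : Polynomial F, P.natDegree ≤ m ∧ ∀ x, P.eval x = f x ^ k := by
  have hq : 1 < Fintype.card F := Fintype.one_lt_card
  have hkm : k ≤ m := by
    by_contra h
    exact hk (by rw [Nat.choose_eq_zero_of_lt (by omega)]; simp)
  set c : F := -(((m.choose k : ℕ) : F) * (-1) ^ (m - k)) with hc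
  have hc0 : c ≠ 0 := by
    rw [hc]
    exact neg_ne_zero.2 (mul_ne_zero hk (pow_ne_zero _ (by simp)))
  have key : ∀ x, ∑ y : F, f y ^ (m + k) * (x - y) ^ m = c * f x ^ k := by
    intro x
    have h1 : ∀ y, f y ^ (m + k) * (x - y) ^ m = ∑ i ∈ Finset.range (m + 1),
        (f x ^ i * (((m.choose i : ℕ) : F) * (-1) ^ (m - i))) * f y ^ (m + k + (m - i)) := by
      intro y
      rw [← H, sub_eq_add_neg, add_pow, Finset.mul_sum]
      refine Finset.sum_congr rfl fun i hi => ?_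
      rw [neg_pow, pow_add (f y) (m + k)]
      ring
    simp_rw [h1]
    rw [Finset.sum_comm]
    simp_rw [← Finset.mul_sum]
    have h2 : ∀ i ∈ Finset.range (m + 1), (f x ^ i * (((m.choose i : ℕ) : F) * (-1) ^ (m - i)))
        * ∑ y : F, f y ^ (m + k + (m - i)) = if i = k then c * f x ^ k else 0 := by
      intro i hi
      rw [Finset.mem_range] at hi
      have h3 : ∑ y : F, f y ^ (m + k + (m - i)) = ∑ z : F, z ^ (m + k + (m - i)) :=
        hf.sum_comp (fun z => z ^ (m + k + (m - i)))
      rw [h3, aux_sum_pow _ (by omega)]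
      by_cases h : i = k
      · rw [if_pos h, if_pos (by omega), h, hc]; ring
      · rw [if_neg h, if_neg (by omega)]; ring
    rw [Finset.sum_congr rfl h2, Finset.sum_ite_eq', if_pos (by simp; omega)]
  refine ⟨Polynomial.C c⁻¹ * ∑ y : F, Polynomial.C (f y ^ (m + k)) *
    (Polynomial.X - Polynomial.C y) ^ m, ?_, ?_⟩
  · refine (Polynomial.natDegree_C_mul_le _ _).trans ?_
    refine Polynomial.natDegree_sum_le_of_forall_le _ _ fun y _ => ?_
    refine (Polynomial.natDegree_C_mul_le _ _).trans ?_
    refine Polynomial.natDegree_pow_le.trans ?_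
    simp
  · intro x
    rw [Polynomial.eval_mul, Polynomial.eval_finsetSum]
    simp only [Polynomial.eval_C, Polynomial.eval_mul, Polynomial.eval_pow, Polynomial.eval_sub,
      Polynomial.eval_X]
    rw [key, inv_mul_cancel_left₀ hc0]

lemma aux_lucas (p h : ℕ) (hp : p.Prime) (hh : h < p) (n k a : ℕ) (ha : a ≤ h)
    (hnk : ¬ p ∣ n.choose k) : ¬ p ∣ (h + p * n).choose (a + p * k) := by
  have : Fact p.Prime := ⟨hp⟩
  have h1 := @Choose.choose_modEq_choose_mod_mul_choose_div_nat (h + p * n) (a + p * k) p _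
  rw [Nat.add_mul_mod_self_left, Nat.add_mul_mod_self_left, Nat.mod_eq_of_lt hh,
    Nat.mod_eq_of_lt (ha.trans_lt hh), Nat.add_mul_div_left _ _ hp.pos,
    Nat.add_mul_div_left _ _ hp.pos, Nat.div_eq_of_lt hh, Nat.div_eq_of_lt (ha.trans_lt hh),
    zero_add, zero_add] at h1
  rw [h1.dvd_iff dvd_rfl, hp.dvd_mul, not_or]
  refine ⟨fun hd => ?_, hnk⟩
  have h2 : p ∣ h.factorial := by
    rw [← Nat.choose_mul_factorial_mul_factorial ha, mul_assoc]
    exact hd.mul_right _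
  exact absurd (hp.dvd_factorial.1 h2) (by omega)

/-- `auxM h p j = h (1 + p + ... + p^(j-1))`. -/
def auxM (h p j : ℕ) : ℕ := h * ∑ i ∈ Finset.range j, p ^ i

lemma auxM_succ (h p j : ℕ) : auxM h p (j + 1) = auxM h p j + h * p ^ j := by
  simp [auxM, Finset.sum_range_succ, mul_add]

lemma auxM_succ' (h p j : ℕ) : auxM h p (j + 1) = h + p * auxM h p j := by
  rw [auxM, geom_sum_succ, auxM]; ring

lemma aux_good (p h : ℕ) (hp : p.Prime) (hh : h < p) (d j e : ℕ) (hj : j < d) (he : e ≤ h) :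
    ¬ p ∣ (auxM h p d).choose (auxM h p j + e * p ^ j) := by
  induction j generalizing d with
  | zero =>
    obtain ⟨d, rfl⟩ : ∃ d', d = d' + 1 := ⟨d - 1, by omega⟩
    rw [auxM_succ']
    have := aux_lucas p h hp hh (auxM h p d) 0 e he (by simpa using hp.one_lt.ne')
    simpa [auxM] using this
  | succ j ih =>
    obtain ⟨d, rfl⟩ : ∃ d', d = d' + 1 := ⟨d - 1, by omega⟩
    have := aux_lucas p h hp hh (auxM h p d) (auxM h p j + e * p ^ j) h le_rfl
      (ih d (by omega))
    rw [auxM_succ', auxM_succ']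
    convert this using 3
    ring

lemma aux_good' (p h : ℕ) (hp : p.Prime) (hh : h < p) (h1 : 1 ≤ h) (d j : ℕ) (hj : j < d) :
    ¬ p ∣ (auxM h p d).choose (p ^ j) := by
  induction j generalizing d with
  | zero => simpa [auxM] using aux_good p h hp hh d 0 1 hj h1
  | succ j ih =>
    obtain ⟨d, rfl⟩ : ∃ d', d = d' + 1 := ⟨d - 1, by omega⟩
    have := aux_lucas p h hp hh (auxM h p d) (p ^ j) 0 (by omega) (ih d (by omega))
    rw [auxM_succ']
    convert this using 3
    ring

lemma aux_arith (p d k : ℕ) (hp : 2 ≤ p) (hk : 1 ≤ k) (hkq : k < p ^ d - 1)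
    (hS : ∑ j ∈ Finset.range d, (k * p ^ j % (p ^ d - 1)) ≤ ∑ j ∈ Finset.range d, p ^ j) :
    ∃ i, k = p ^ i := by
  obtain ⟨Q, hQ⟩ : ∃ Q, p ^ d = Q + 1 := ⟨p ^ d - 1, by omega⟩
  have hQ' : p ^ d - 1 = Q := by omega
  rw [hQ'] at hS hkq
  set r : ℕ → ℕ := fun j => k * p ^ j % Q with hr
  set t : ℕ → ℕ := fun j => p * r j / Q with ht
  have hstep : ∀ j, p * r j = Q * t j + r (j + 1) := by
    intro j
    have h1 : r (j + 1) = p * r j % Q := by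
      simp only [hr, pow_succ]
      rw [Nat.mul_mod_mod]
      congr 1; ring
    rw [h1, ht]
    exact (Nat.div_add_mod _ _).symm
  have hr0 : r 0 = k := by simp [hr, Nat.mod_eq_of_lt hkq]
  have hrd : r d = k := by
    simp only [hr]
    rw [hQ, mul_add, mul_one, Nat.mul_add_mod_self_right, Nat.mod_eq_of_lt hkq]
  have hhorner : ∀ n, p ^ n * k = Q * (∑ j ∈ Finset.range n, t j * p ^ (n - 1 - j)) + r n := by
    intro n
    induction n with
    | zero => simp [hr0]
    | succ n ih =>
      have h2 : ∑ j ∈ Finset.range (n + 1), t j * p ^ (n + 1 - 1 - j)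
          = p * (∑ j ∈ Finset.range n, t j * p ^ (n - 1 - j)) + t n := by
        rw [Finset.sum_range_succ, Finset.mul_sum]
        congr 1
        · refine Finset.sum_congr rfl fun j hj => ?_
          rw [Finset.mem_range] at hj
          have : n + 1 - 1 - j = (n - 1 - j) + 1 := by omega
          rw [this, pow_succ]; ring
        · simp
      rw [h2, pow_succ, mul_assoc, mul_comm p k, ← mul_assoc, ih]
      have := hstep n
      linear_combination this
  have hkk : k = ∑ j ∈ Finset.range d, t j * p ^ (d - 1 - j) := by
    have h1 := hhorner d
    rw [hQ, hrd] at h1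
    have h2 : Q * k = Q * (∑ j ∈ Finset.range d, t j * p ^ (d - 1 - j)) := by linarith
    exact Nat.eq_of_mul_eq_mul_left (by omega) h2
  have hT : ∑ j ∈ Finset.range d, t j ≤ 1 := by
    have h1 : p * ∑ j ∈ Finset.range d, r j
        = Q * ∑ j ∈ Finset.range d, t j + ∑ j ∈ Finset.range d, r j := by
      have h2 : ∑ j ∈ Finset.range d, r (j + 1) = ∑ j ∈ Finset.range d, r j := by
        have h3 := Finset.sum_range_succ r d
        have h4 := Finset.sum_range_succ' r d
        omega
      rw [Finset.mul_sum, Finset.mul_sum, ← h2, ← Finset.sum_add_distrib]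
      exact Finset.sum_congr rfl fun j _ => hstep j
    obtain ⟨u, rfl⟩ : ∃ u, p = u + 1 := ⟨p - 1, by omega⟩
    have h5 := geom_sum_mul_add u d
    have h6 : u * ∑ j ∈ Finset.range d, r j ≤ u * ∑ j ∈ Finset.range d, (u + 1) ^ j :=
      Nat.mul_le_mul_left _ hS
    have h7 : Q * ∑ j ∈ Finset.range d, t j ≤ Q * 1 := by linarith
    exact Nat.le_of_mul_le_mul_left h7 (by omega)
  have hex : ∃ j ∈ Finset.range d, t j ≠ 0 := by
    by_contra hcon
    push Not at hcon
    rw [Finset.sum_eq_zero (fun j hj => by rw [hcon j hj, zero_mul])] at hkk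
    omega
  obtain ⟨j, hj, hj0⟩ := hex
  rw [← Finset.add_sum_erase _ _ hj] at hT
  have hz : ∀ i ∈ (Finset.range d).erase j, t i = 0 := by
    apply Finset.sum_eq_zero_iff.1
    omega
  refine ⟨d - 1 - j, ?_⟩
  rw [← Finset.add_sum_erase _ _ hj, Finset.sum_eq_zero (s := (Finset.range d).erase j)
    (fun i hi => by rw [hz i hi, zero_mul])] at hkk
  have : t j = 1 := by omega
  rw [this] at hkk
  omega

/-- Carlitz's theorem (additivity part). -/
lemma aux_carlitz (hodd : Odd (Fintype.card F)) (f : F → F) (hf : Function.Bijective f)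
    (hf0 : f 0 = 0) (m : ℕ) (hm : Fintype.card F = 2 * m + 1)
    (H : ∀ x y, (f x - f y) ^ m = (x - y) ^ m) (x y : F) : f (x + y) = f x + f y := by
  have hq : 1 < Fintype.card F := Fintype.one_lt_card
  obtain ⟨p, hchar, ⟨d, hd⟩, hp, hcard⟩ := FiniteField.card' F
  simp only [PNat.mk_coe] at hcard
  have : Fact p.Prime := ⟨hp⟩
  have hpodd : Odd p := by
    rw [hcard] at hodd
    exact (Nat.odd_pow_iff hd.ne').1 hodd
  obtain ⟨h, hph⟩ := hpodd
  have hp2 := hp.two_le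
  have h1 : 1 ≤ h := by omega
  have hhp : h < p := by omega
  have hmM : m = auxM h p d := by
    have h5 := geom_sum_mul_add (2 * h) d
    rw [← hph, ← hcard, hm] at h5
    rw [auxM]
    linarith
  have hP : ∀ k, ∃ P : Polynomial F, (¬ p ∣ m.choose k) →
      (P.natDegree ≤ m ∧ ∀ x, P.eval x = f x ^ k) := by
    intro k
    by_cases hk : p ∣ m.choose k
    · exact ⟨0, fun h => absurd hk h⟩
    · obtain ⟨P, hP⟩ := aux_repr f hf m hm H k (by rwa [Ne, CharP.cast_eq_zero_iff F p])
      exact ⟨P, fun _ => hP⟩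
  choose P hP using hP
  have hP0 : ∀ k, ¬ p ∣ m.choose k → P k ≠ 0 := by
    intro k hk h0
    obtain ⟨z, hz⟩ := hf.2 1
    have := (hP k hk).2 z
    rw [h0, hz] at this
    simp at this
  have hadd : ∀ k l, ¬ p ∣ m.choose k → ¬ p ∣ m.choose l → ¬ p ∣ m.choose (k + l) →
      (P (k + l)).natDegree = (P k).natDegree + (P l).natDegree := by
    intro k l hk hl hkl
    rw [← Polynomial.natDegree_mul (hP0 k hk) (hP0 l hl)]
    congr 1
    apply Polynomial.eq_of_natDegree_lt_card_of_eval_eq _ _ (Function.injective_id (α := F))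
    · intro z
      rw [Polynomial.eval_mul]
      simp only [id]
      rw [(hP k hk).2, (hP l hl).2, (hP _ hkl).2, pow_add]
    · have a1 := (hP k hk).1
      have a2 := (hP l hl).1
      have a3 := (hP _ hkl).1
      have a4 := Polynomial.natDegree_mul_le (p := P k) (q := P l)
      rw [max_lt_iff]
      constructor <;> omega
  have hgood : ∀ j e, j < d → e ≤ h → ¬ p ∣ m.choose (auxM h p j + e * p ^ j) := by
    intro j e hj he
    rw [hmM]
    exact aux_good p h hp hhp d j e hj he
  have hgood' : ∀ j, j < d → ¬ p ∣ m.choose (p ^ j) := by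
    intro j hj
    rw [hmM]
    exact aux_good' p h hp hhp h1 d j hj
  have hinner : ∀ j, j < d → ∀ e, e ≤ h → (P (auxM h p j + e * p ^ j)).natDegree
      = (P (auxM h p j)).natDegree + e * (P (p ^ j)).natDegree := by
    intro j hj e
    induction e with
    | zero => intro _; simp
    | succ e ih =>
      intro he
      have e1 : auxM h p j + (e + 1) * p ^ j = (auxM h p j + e * p ^ j) + p ^ j := by ring
      have g := hgood j (e + 1) hj he
      rw [e1] at g ⊢
      rw [hadd _ _ (hgood j e hj (by omega)) (hgood' j hj) g, ih (by omega)]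
      ring
  have hM0 : (P (auxM h p 0)).natDegree = 0 := by
    have g : ¬ p ∣ m.choose 0 := by simpa using hp.one_lt.ne'
    have := hadd 0 0 g g g
    simp only [auxM, Finset.range_zero, Finset.sum_empty, mul_zero]
    simp only [add_zero] at this
    omega
  have houter : ∀ j, j ≤ d → (P (auxM h p j)).natDegree
      = h * ∑ i ∈ Finset.range j, (P (p ^ i)).natDegree := by
    intro j
    induction j with
    | zero => intro _; simp [hM0]
    | succ j ih =>
      intro hj
      rw [auxM_succ, hinner j (by omega) h le_rfl, ih (by omega), Finset.sum_range_succ]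
      ring
  have hsum : ∑ i ∈ Finset.range d, (P (p ^ i)).natDegree ≤ ∑ i ∈ Finset.range d, p ^ i := by
    have g : ¬ p ∣ m.choose (auxM h p d) := by
      rw [← hmM]; simpa using hp.one_lt.ne'
    have a1 := (hP _ g).1
    rw [houter d le_rfl] at a1
    have a2 : m = h * ∑ i ∈ Finset.range d, p ^ i := hmM
    rw [a2] at a1
    exact Nat.le_of_mul_le_mul_left a1 h1
  have hg1 : ¬ p ∣ m.choose 1 := by simpa using hgood' 0 hd
  have hPd := (hP 1 hg1).1
  have hPe : ∀ x, (P 1).eval x = f x := by simpa using (hP 1 hg1).2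
  have hcoef : ∀ k, 1 ≤ k → (P 1).coeff k ≠ 0 → ∃ i, k = p ^ i := by
    intro k hk hck
    have hkm : k ≤ m := (Polynomial.le_natDegree_of_ne_zero hck).trans hPd
    apply aux_arith p d k hp2 hk (by omega)
    refine (Finset.sum_le_sum fun j hj => ?_).trans hsum
    rw [Finset.mem_range] at hj
    rw [← hcard]
    by_contra hlt
    push Not at hlt
    set r := k * p ^ j % (Fintype.card F - 1) with hr
    have hrq : r < Fintype.card F - 1 := Nat.mod_lt _ (by omega)
    have a1 : ∑ x : F, (P (p ^ j)).eval x * x ^ (Fintype.card F - 1 - r) = 0 := by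
      rw [aux_coeff _ _ (by omega) (by omega), Polynomial.coeff_eq_zero_of_natDegree_lt, neg_zero]
      omega
    have a2 : ∑ x : F, (P 1).eval x * x ^ (Fintype.card F - 1 - k) = - (P 1).coeff k := by
      rw [aux_coeff _ _ (by omega) (by omega)]
      congr 2
      omega
    have hsp : 0 < (Fintype.card F - 1 - k) * p ^ j :=
      Nat.mul_pos (by omega) (pow_pos hp.pos _)
    have a3 : (Fintype.card F - 1 - k) * p ^ j ≡ Fintype.card F - 1 - r
        [MOD (Fintype.card F - 1)] := by
      have b1 : (Fintype.card F - 1 - k) * p ^ j + k * p ^ j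
          ≡ (Fintype.card F - 1 - r) + r [MOD (Fintype.card F - 1)] := by
        rw [← add_mul, Nat.sub_add_cancel (by omega), Nat.sub_add_cancel hrq.le]
        simp [Nat.ModEq]
      refine Nat.ModEq.add_right_cancel ?_ b1
      exact (Nat.mod_modEq _ _).symm
    have a4 : (∑ x : F, (P 1).eval x * x ^ (Fintype.card F - 1 - k)) ^ p ^ j
        = ∑ x : F, (P (p ^ j)).eval x * x ^ (Fintype.card F - 1 - r) := by
      rw [sum_pow_char_pow]
      refine Finset.sum_congr rfl fun x _ => ?_
      rw [mul_pow, hPe, (hP _ (hgood' j hj)).2, ← pow_mul,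
        aux_pow_congr _ _ hsp (by omega) a3]
    rw [a1, a2] at a4
    exact pow_ne_zero _ (neg_ne_zero.2 hck) a4
  have hc0 : (P 1).coeff 0 = 0 := by
    rw [Polynomial.coeff_zero_eq_eval_zero, hPe, hf0]
  rw [← hPe, ← hPe, ← hPe]
  simp only [Polynomial.eval_eq_sum_range]
  rw [← Finset.sum_add_distrib]
  refine Finset.sum_congr rfl fun k _ => ?_
  by_cases hck : (P 1).coeff k = 0
  · simp [hck]
  · have hk : 1 ≤ k := by
      rcases Nat.eq_zero_or_pos k with h | h
      · subst h; exact absurd hc0 hck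
      · exact h
    obtain ⟨i, rfl⟩ := hcoef k hk hck
    rw [add_pow_char_pow]
    ring

/-- The square-multiplier affine maps. -/
def auxAff (c t : F) (hc : c ≠ 0) : Equiv.Perm F :=
  (Equiv.mulLeft₀ c hc).trans (Equiv.addRight t)

lemma auxAff_apply (c t : F) (hc : c ≠ 0) (x : F) : auxAff c t hc x = c * x + t := rfl

lemma aux_isSquare_mul (c x : F) (hc : inR c) : inR (c * x) ↔ inR x := by
  obtain ⟨hc0, e, rfl⟩ := hc
  have he : e ≠ 0 := by rintro rfl; simp at hc0
  constructor
  · rintro ⟨h1, g, hg⟩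
    refine ⟨right_ne_zero_of_mul h1, g / e, ?_⟩
    field_simp
    rw [pow_two, pow_two, ← hg]; ring
  · rintro ⟨h1, g, rfl⟩
    exact ⟨mul_ne_zero hc0 h1, e * g, by ring⟩

lemma auxAff_mem (a b c t : F) (hc : inR c) (i : Fin 3) :
    auxAff c t hc.1 ∈ AtpProj a b i := by
  refine ⟨auxAff c t hc.1, auxAff c t hc.1, auxAff c t hc.1, ?_, ?_⟩
  · intro x y
    have e : auxAff c t hc.1 y - auxAff c t hc.1 x = c * (y - x) := by
      rw [auxAff_apply, auxAff_apply]; ring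
    have e2 := aux_isSquare_mul c (y - x) hc
    unfold qmul
    by_cases h : inR (y - x)
    · rw [if_pos h, if_pos (by rw [e]; exact e2.2 h), e, auxAff_apply, auxAff_apply]; ring
    · rw [if_neg h, if_neg (by rw [e]; exact fun h' => h (e2.1 h')), e, auxAff_apply,
        auxAff_apply]; ring
  · fin_cases i <;> rfl

lemma aux_mul_mem (a b : F) (i : Fin 3) (g g' : Equiv.Perm F) (hg : g ∈ AtpProj a b i)
    (hg' : g' ∈ AtpProj a b i) : g * g' ∈ AtpProj a b i := by
  obtain ⟨α, β, γ, h, rfl⟩ := hg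
  obtain ⟨α', β', γ', h', rfl⟩ := hg'
  refine ⟨α * α', β * β', γ * γ', ?_, ?_⟩
  · intro x y
    simp only [Equiv.Perm.mul_apply]
    rw [h, h']
  · fin_cases i <;> rfl

lemma aux_inv_mem (a b : F) (i : Fin 3) (g : Equiv.Perm F) (hg : g ∈ AtpProj a b i) :
    g⁻¹ ∈ AtpProj a b i := by
  obtain ⟨α, β, γ, h, rfl⟩ := hg
  refine ⟨α⁻¹, β⁻¹, γ⁻¹, ?_, ?_⟩
  · intro x y
    apply γ.injective
    rw [← h]
    simp
  · fin_cases i <;> rfl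

lemma aux_ratio (hF : ringChar F ≠ 2) (u v : F) (hu : u ≠ 0) (hv : v ≠ 0)
    (h : inR u ↔ inR v) : inR (v / u) := by
  refine ⟨div_ne_zero hv hu, ?_⟩
  simp only [inR, hu, hv, ne_eq, not_false_eq_true, true_and] at h
  rw [FiniteField.isSquare_iff hF (div_ne_zero hv hu), div_pow]
  rw [FiniteField.isSquare_iff hF hu, FiniteField.isSquare_iff hF hv] at h
  rcases FiniteField.pow_dichotomy hF hu with h1 | h1
  · rw [h1, h.1 h1]; simp
  · rcases FiniteField.pow_dichotomy hF hv with h2 | h2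
    · rw [h2, h.2 h2]; simp
    · rw [h1, h2]; simp

lemma aux_same (hF : ringChar F ≠ 2) (a b : F) (i : Fin 3) (x y x' y' : F) (h : x ≠ y)
    (h' : x' ≠ y') (hc : inR (y - x) ↔ inR (y' - x')) :
    ∃ g ∈ AtpProj a b i, g x = x' ∧ g y = y' := by
  have h0 : y - x ≠ 0 := sub_ne_zero.2 h.symm
  have h0' : y' - x' ≠ 0 := sub_ne_zero.2 h'.symm
  have hr := aux_ratio hF _ _ h0 h0' hc
  refine ⟨_, auxAff_mem a b _ (x' - (y' - x') / (y - x) * x) hr i, ?_, ?_⟩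
  · rw [auxAff_apply]; ring
  · rw [auxAff_apply]; field_simp; ring

lemma aux_two_trans (hF : ringChar F ≠ 2) (a b : F) (i : Fin 3) (g : Equiv.Perm F)
    (hg : g ∈ AtpProj a b i) (x y : F) (hxy : x ≠ y) (h1 : inR (y - x))
    (h2 : ¬ inR (g y - g x)) : TwoTransitive (AtpProj a b i) := by
  have hgxy : g x ≠ g y := fun h => hxy (g.injective h)
  intro x₁ y₁ x₂ y₂ n1 n2
  by_cases c1 : inR (y₁ - x₁) <;> by_cases c2 : inR (y₂ - x₂)
  · exact aux_same hF a b i _ _ _ _ n1 n2 (by tauto)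
  · obtain ⟨u, hu, u1, u2⟩ := aux_same hF a b i x₁ y₁ x y n1 hxy (by tauto)
    obtain ⟨v, hv, v1, v2⟩ := aux_same hF a b i (g x) (g y) x₂ y₂ hgxy n2 (by tauto)
    refine ⟨v * (g * u), aux_mul_mem _ _ _ _ _ hv (aux_mul_mem _ _ _ _ _ hg hu), ?_, ?_⟩
    · simp [u1, v1]
    · simp [u2, v2]
  · obtain ⟨u, hu, u1, u2⟩ := aux_same hF a b i x₁ y₁ (g x) (g y) n1 hgxy (by tauto)
    obtain ⟨v, hv, v1, v2⟩ := aux_same hF a b i x y x₂ y₂ hxy n2 (by tauto)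
    refine ⟨v * (g⁻¹ * u), aux_mul_mem _ _ _ _ _ hv
      (aux_mul_mem _ _ _ _ _ (aux_inv_mem _ _ _ _ hg) hu), ?_, ?_⟩
    · simp [u1, v1]
    · simp [u2, v2]
  · exact aux_same hF a b i _ _ _ _ n1 n2 (by tauto)

/-- Lemma 4.1: if `q > 23`, `(a,b)` is valid with `a ≠ b`, and `Atp_i(Q_{a,b})` is not
2-transitive, then every element of `Atp_i(Q_{a,b})` is an affine permutation. -/
theorem atp_proj_affine_of_not_two_transitive
    (hodd : Odd (Fintype.card F)) (hq : 23 < Fintype.card F)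
    (a b : F) (hv : ValidPair a b) (hab : a ≠ b) (i : Fin 3)
    (h : ¬ TwoTransitive (AtpProj a b i)) :
    ∀ g ∈ AtpProj a b i, IsAffinePerm g := by
  intro g hg
  have hF : ringChar F ≠ 2 := by
    intro h2
    have := FiniteField.even_card_of_char_two h2
    rw [Nat.odd_iff] at hodd
    omega
  have hpres : ∀ x y, x ≠ y → (inR (y - x) ↔ inR (g y - g x)) := by
    intro x y hxy
    constructor
    · intro h1
      by_contra h2
      exact h (aux_two_trans hF a b i g hg x y hxy h1 h2)
    · intro h1
      by_contra h2
      refine h (aux_two_trans hF a b i g⁻¹ (aux_inv_mem _ _ _ _ hg) (g x) (g y)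
        (fun e => hxy (g.injective e)) h1 ?_)
      simpa using h2
  obtain ⟨m, hm⟩ := hodd
  have hm2 : Fintype.card F / 2 = m := by omega
  have hpow : ∀ x y, (g x - g y) ^ m = (x - y) ^ m := by
    intro x y
    by_cases hxy : x = y
    · simp [hxy]
    · have h0 : x - y ≠ 0 := sub_ne_zero.2 hxy
      have h0' : g x - g y ≠ 0 := sub_ne_zero.2 fun e => hxy (g.injective e)
      have := aux_ratio hF _ _ h0 h0' (hpres y x (Ne.symm hxy))
      have h3 := (FiniteField.isSquare_iff hF this.1).1 this.2
      rw [hm2, div_pow, div_eq_one_iff_eq (pow_ne_zero _ h0)] at h3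
      exact h3
  have hbij : Function.Bijective (fun x => g x - g 0) :=
    (g.trans (Equiv.subRight (g 0))).bijective
  have hadd := aux_carlitz ⟨m, hm⟩ (fun x => g x - g 0) hbij (by simp) m hm
    (by intro x y; simp only [sub_sub_sub_cancel_right]; exact hpow x y)
  refine ⟨{ g.trans (Equiv.subRight (g 0)) with map_add' := hadd }, g 0, fun x => ?_⟩
  change g x = (g x - g 0) + g 0
  ring
end
end

section
/- Let q > 23 be an odd prime power, let (a,b) be a valid pair in F_q^2 with a ≠ b, and let i ∈ {1,2,3}. If Atp_i(Q_{a,b}) is 2-transitive, then every element of Atp_i(Q_{a,b}) is an affine permutation of F_q (i.e., Atp_i(Q_{a,b}) ≤ AGL_d(p)). -/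
open scoped Classical
open Finset

noncomputable section

variable {F : Type*} [Field F] [Fintype F]

set_option linter.unusedSectionVars false
set_option linter.unusedVariables false

/-- The map `u ↦ 0 * u` of the quadratic quasigroup. -/
def phi (a b u : F) : F := if inR u then a * u else b * u

/-- The quadratic character. -/
def eta (x : F) : ℤ := quadraticChar F x

theorem eta_zero : eta (0 : F) = 0 := by simp [eta]
theorem eta_one : eta (1 : F) = 1 := by simp [eta]
theorem eta_mul (x y : F) : eta (x * y) = eta x * eta y := map_mul (quadraticChar F) x y

theorem inR_iff (x : F) : inR x ↔ eta x = 1 := by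
  unfold inR eta
  constructor
  · rintro ⟨h0, h⟩
    exact (quadraticChar_one_iff_isSquare h0).2 h
  · intro h
    have h0 : x ≠ 0 := by rintro rfl; simp at h
    exact ⟨h0, (quadraticChar_one_iff_isSquare h0).1 h⟩

theorem eta_cases (x : F) (hx : x ≠ 0) : eta x = 1 ∨ eta x = -1 := by
  unfold eta
  exact quadraticChar_dichotomy hx

theorem eta_eq_zero_iff (x : F) : eta x = 0 ↔ x = 0 := by
  unfold eta; exact quadraticChar_eq_zero_iff

theorem eta_sq (x : F) (hx : x ≠ 0) : eta x * eta x = 1 := by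
  rcases eta_cases x hx with h | h <;> rw [h] <;> norm_num

theorem char_ne_two (hodd : Odd (Fintype.card F)) : ringChar F ≠ 2 := by
  intro h
  have := FiniteField.even_card_of_char_two h
  rw [Nat.odd_iff] at hodd
  omega

theorem two_ne_zeroF (hodd : Odd (Fintype.card F)) : (2 : F) ≠ 0 :=
  Ring.two_ne_zero (char_ne_two hodd)

theorem eta_sum (hodd : Odd (Fintype.card F)) : ∑ x : F, eta x = 0 :=
  quadraticChar_sum_zero (char_ne_two hodd)

theorem eta_exists_neg (hodd : Odd (Fintype.card F)) : ∃ x : F, eta x = -1 :=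
  quadraticChar_exists_neg_one (char_ne_two hodd)

theorem eta_inv (x : F) : eta x⁻¹ = eta x := by
  by_cases hx : x = 0
  · simp [hx]
  · have h1 : eta x⁻¹ * eta x = 1 := by rw [← eta_mul, inv_mul_cancel₀ hx, eta_one]
    rcases eta_cases x hx with h | h <;> rw [h] at h1 ⊢ <;> linarith

theorem eta_div (x y : F) : eta (x / y) = eta x * eta y := by
  rw [div_eq_mul_inv, eta_mul, eta_inv]

theorem eta_neg (x : F) : eta (-x) = eta (-1 : F) * eta x := by
  rw [← eta_mul, neg_one_mul]

theorem eta_corr (hodd : Odd (Fintype.card F)) (c : F) (hc : c ≠ 0) :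
    ∑ w : F, eta w * eta (w + c) = -1 := by
  have h1 : ∀ w : F, eta w * eta (w + c) = eta (1 + c * w⁻¹) - if w = 0 then 1 else 0 := by
    intro w
    by_cases hw : w = 0
    · subst hw; simp [eta_zero, eta_one]
    · have : w + c = w * (1 + c * w⁻¹) := by field_simp
      rw [this, eta_mul, ← mul_assoc, eta_sq w hw]; simp [hw]
  rw [Finset.sum_congr rfl (fun w _ => h1 w), Finset.sum_sub_distrib]
  have hb : Function.Bijective (fun w : F => 1 + c * w⁻¹) := by
    apply Finite.injective_iff_bijective.1
    intro x y h
    simpa [hc] using h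
  have h2 : ∑ w : F, eta (1 + c * w⁻¹) = ∑ u : F, eta u := hb.sum_comp eta
  rw [h2, eta_sum hodd]; simp

theorem eta_corr2 (hodd : Odd (Fintype.card F)) (c d : F) (hc : c ≠ d) :
    ∑ w : F, eta (w + c) * eta (w + d) = -1 := by
  rw [← eta_corr hodd (d - c) (sub_ne_zero.2 hc.symm)]
  rw [← Equiv.sum_comp (Equiv.addRight c) (fun w => eta w * eta (w + (d - c)))]
  apply Finset.sum_congr rfl
  intro w _
  simp

theorem eta_sq_sum (c : F) : ∑ w : F, eta (w + c) * eta (w + c) = (Fintype.card F : ℤ) - 1 := by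
  have := Equiv.sum_comp (Equiv.addRight c) (fun w => eta w * eta w)
  simp only [Equiv.coe_addRight] at this
  rw [this]
  have h1 : ∀ w : F, eta w * eta w = 1 - if w = 0 then 1 else 0 := by
    intro w
    by_cases hw : w = 0
    · subst hw; simp [eta_zero]
    · simp [eta_sq w hw, hw]
  rw [Finset.sum_congr rfl (fun w _ => h1 w), Finset.sum_sub_distrib]
  simp

/-- zero together with the elements of quadratic character `χ` -/
def inX (χ : ℤ) (y : F) : Prop := y = 0 ∨ eta y = χ

theorem chi_cases {χ : ℤ} (hχ : χ * χ = 1) : χ = 1 ∨ χ = -1 := by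
  have : (χ - 1) * (χ + 1) = 0 := by ring_nf; linarith [hχ, sq χ]
  rcases mul_eq_zero.1 this with h | h
  · left; linarith
  · right; linarith

theorem count_prod (hodd : Odd (Fintype.card F)) {χ : ℤ} (hχ : χ * χ = 1) (e : F) (he : e ≠ 0) :
    ∑ y : F, (1 + χ * eta y) * (1 + χ * eta (y + e)) = (Fintype.card F : ℤ) - 1 := by
  have h1 : ∀ y : F, (1 + χ * eta y) * (1 + χ * eta (y + e)) =
      1 + χ * eta y + χ * eta (y + e) + eta y * eta (y + e) := by
    intro y
    linear_combination (eta y * eta (y + e)) * hχ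
  rw [Finset.sum_congr rfl (fun w _ => h1 w), Finset.sum_add_distrib, Finset.sum_add_distrib,
    Finset.sum_add_distrib, eta_corr hodd e he, ← Finset.mul_sum, ← Finset.mul_sum, eta_sum hodd]
  have : ∑ y : F, eta (y + e) = 0 := by
    rw [← eta_sum hodd]; exact Equiv.sum_comp (Equiv.addRight e) eta
  rw [this]; simp; ring

theorem count_X (hodd : Odd (Fintype.card F)) {χ : ℤ} (hχ : χ * χ = 1) (e : F) (he : e ≠ 0) :
    4 * ((univ.filter (fun y : F => inX χ y ∧ inX χ (y + e))).card : ℤ) =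
      (Fintype.card F : ℤ) + 1 + χ * eta e + χ * eta (-e) := by
  have h1 : ∀ y : F, 4 * (if inX χ y ∧ inX χ (y + e) then (1 : ℤ) else 0) =
      (1 + χ * eta y) * (1 + χ * eta (y + e)) + (if y = 0 then 1 + χ * eta e else 0)
      + (if y = -e then 1 + χ * eta (-e) else 0) := by
    intro y
    unfold inX
    by_cases hy : y = 0
    · subst hy
      have : ¬ ((0 : F) = -e) := by
        intro h; exact he (by rw [← neg_neg e, ← h, neg_zero])
      rcases chi_cases hχ with rfl | rfl <;> rcases eta_cases e he with h | h <;>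
        simp [this, h, eta_zero, he]
    · by_cases hy2 : y = -e
      · subst hy2
        rcases chi_cases hχ with rfl | rfl <;> rcases eta_cases (-e) hy with h | h <;>
        simp [h, eta_zero, he]
      · have h3 : y + e ≠ 0 := fun h => hy2 (eq_neg_of_add_eq_zero_left h)
        rcases chi_cases hχ with rfl | rfl <;> rcases eta_cases y hy with h | h <;>
        rcases eta_cases _ h3 with h' | h' <;>
        simp [h, h', hy, hy2, h3]
  rw [Finset.card_filter]
  push_cast
  rw [Finset.mul_sum, Finset.sum_congr rfl (fun w _ => h1 w), Finset.sum_add_distrib,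
    Finset.sum_add_distrib, count_prod hodd hχ e he]
  simp; ring

theorem count_S (hodd : Odd (Fintype.card F)) {χ : ℤ} (hχ : χ * χ = 1) (e : F) (he : e ≠ 0) :
    4 * ((univ.filter (fun y : F => eta y = χ ∧ eta (y + e) = χ)).card : ℤ) =
      (Fintype.card F : ℤ) - 3 - χ * eta e - χ * eta (-e) := by
  have h1 : ∀ y : F, 4 * (if eta y = χ ∧ eta (y + e) = χ then (1 : ℤ) else 0) =
      (1 + χ * eta y) * (1 + χ * eta (y + e)) - (if y = 0 then 1 + χ * eta e else 0)
      - (if y = -e then 1 + χ * eta (-e) else 0) := by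
    intro y
    by_cases hy : y = 0
    · subst hy
      have : ¬ ((0 : F) = -e) := by
        intro h; exact he (by rw [← neg_neg e, ← h, neg_zero])
      rcases chi_cases hχ with rfl | rfl <;> rcases eta_cases e he with h | h <;>
        simp [this, eta_zero]
    · by_cases hy2 : y = -e
      · subst hy2
        rcases chi_cases hχ with rfl | rfl <;> rcases eta_cases (-e) hy with h | h <;>
        simp [h, eta_zero, he]
      · have h3 : y + e ≠ 0 := fun h => hy2 (eq_neg_of_add_eq_zero_left h)
        rcases chi_cases hχ with rfl | rfl <;> rcases eta_cases y hy with h | h <;>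
        rcases eta_cases _ h3 with h' | h' <;>
        simp [h, h', hy, hy2]
  rw [Finset.card_filter]
  push_cast
  rw [Finset.mul_sum, Finset.sum_congr rfl (fun w _ => h1 w), Finset.sum_sub_distrib,
    Finset.sum_sub_distrib, count_prod hodd hχ e he]
  simp; ring

theorem exists_S (hodd : Odd (Fintype.card F)) (hq : 23 < Fintype.card F)
    {χ : ℤ} (hχ : χ * χ = 1) (e : F) (he : e ≠ 0) :
    ∃ y : F, eta y = χ ∧ eta (y + e) = χ := by
  by_contra hcon
  push Not at hcon
  have h := count_S hodd hχ e he
  rw [Finset.filter_false_of_mem (fun y _ => by have := hcon y; tauto)] at h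
  have he' : -e ≠ 0 := neg_ne_zero.2 he
  rcases chi_cases hχ with rfl | rfl <;> rcases eta_cases e he with h1 | h1 <;>
    rcases eta_cases _ he' with h2 | h2 <;> rw [h1, h2] at h <;> simp at h <;> omega

section basics
variable {a b : F}

theorem inR_eta {x : F} (h : inR x) : eta x = 1 := (inR_iff x).1 h

theorem phi_eta_one (a b : F) {u : F} (h : eta u = 1) : phi a b u = a * u := by
  unfold phi; rw [if_pos ((inR_iff u).2 h)]
theorem phi_eta_neg (a b : F) {u : F} (h : eta u = -1) : phi a b u = b * u := by
  unfold phi; rw [if_neg]; rw [inR_iff, h]; norm_num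
theorem phi_zero (a b : F) : phi a b 0 = 0 := by unfold phi; simp
theorem qmul_eq (a b x y : F) : qmul a b x y = x + phi a b (y - x) := by
  unfold qmul phi; split_ifs <;> rfl
theorem phi_cases (a b u : F) : phi a b u = a * u ∨ phi a b u = b * u := by
  unfold phi; split_ifs <;> simp

theorem valid_facts (hv : ValidPair a b) :
    a ≠ 0 ∧ b ≠ 0 ∧ a ≠ 1 ∧ b ≠ 1 ∧ eta a = eta b ∧ eta (1 - a) = eta (1 - b) := by
  obtain ⟨h1, h2⟩ := hv
  have h3 := h1.1
  have h4 := h2.1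
  have e1 := inR_eta h1
  have e2 := inR_eta h2
  have e3 : eta ((1 - a) * (1 - b)) = 1 := by rw [← e2]; congr 1; ring
  rw [eta_mul] at e1 e3
  have ha := left_ne_zero_of_mul h3
  have hb := right_ne_zero_of_mul h3
  have ha1 := left_ne_zero_of_mul h4
  have hb1 := right_ne_zero_of_mul h4
  have ha' : 1 - a ≠ 0 := fun h => ha1 (by linear_combination -h)
  have hb' : 1 - b ≠ 0 := fun h => hb1 (by linear_combination -h)
  refine ⟨ha, hb, fun h => ha1 (by rw [h, sub_self]), fun h => hb1 (by rw [h, sub_self]), ?_, ?_⟩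
  · rcases eta_cases a ha with h | h <;> rcases eta_cases b hb with h' | h' <;>
      rw [h, h'] at e1 ⊢ <;> norm_num at e1
  · rcases eta_cases _ ha' with h | h <;> rcases eta_cases _ hb' with h' | h' <;>
      rw [h, h'] at e3 ⊢ <;> norm_num at e3

theorem eta_phi (hv : ValidPair a b) (u : F) : eta (phi a b u) = eta a * eta u := by
  obtain ⟨_, _, _, _, h, _⟩ := valid_facts hv
  rcases phi_cases a b u with h1 | h1 <;> rw [h1, eta_mul]
  rw [h]

theorem phi_inj (hv : ValidPair a b) : Function.Injective (phi a b) := by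
  obtain ⟨ha, hb, _, _, h, _⟩ := valid_facts hv
  have e0 : eta a ≠ 0 := fun h => ha ((eta_eq_zero_iff a).1 h)
  intro u v huv
  have h1 : eta u = eta v := by
    have := congrArg eta huv
    rw [eta_phi hv, eta_phi hv] at this
    exact mul_left_cancel₀ e0 this
  by_cases hu : u = 0
  · subst hu; rw [eta_zero] at h1; exact ((eta_eq_zero_iff v).1 h1.symm).symm
  · rcases eta_cases u hu with h2 | h2
    · rw [phi_eta_one a b h2, phi_eta_one a b (h1 ▸ h2)] at huv
      exact mul_left_cancel₀ ha huv
    · rw [phi_eta_neg a b h2, phi_eta_neg a b (h1 ▸ h2)] at huv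
      exact mul_left_cancel₀ hb huv

theorem phi_smul (a b : F) {r : F} (hr : eta r = 1) (u : F) :
    phi a b (r * u) = r * phi a b u := by
  by_cases hu : u = 0
  · subst hu; simp [phi_zero]
  · rcases eta_cases u hu with h2 | h2
    · rw [phi_eta_one a b h2, phi_eta_one a b (by rw [eta_mul, hr, h2, one_mul])]; ring
    · rw [phi_eta_neg a b h2, phi_eta_neg a b (by rw [eta_mul, hr, h2, one_mul])]; ring

theorem qmul_affine (a b : F) {r : F} (hr : eta r = 1) (c x y : F) :
    qmul a b (r * x + c) (r * y + c) = r * qmul a b x y + c := by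
  rw [qmul_eq, qmul_eq]
  have : r * y + c - (r * x + c) = r * (y - x) := by ring
  rw [this, phi_smul a b hr]; ring

theorem qmul_self (a b x : F) : qmul a b x x = x := by rw [qmul_eq]; simp [phi_zero]

theorem qmul_ne (hv : ValidPair a b) {x y : F} (h : x ≠ y) :
    qmul a b x y ≠ x ∧ qmul a b x y ≠ y := by
  obtain ⟨ha, hb, ha1, hb1, _, _⟩ := valid_facts hv
  have hd : y - x ≠ 0 := sub_ne_zero.2 h.symm
  rw [qmul_eq]
  constructor
  · intro h1
    rcases phi_cases a b (y - x) with h2 | h2 <;> rw [h2] at h1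
    · exact (mul_ne_zero ha hd) (by linear_combination h1)
    · exact (mul_ne_zero hb hd) (by linear_combination h1)
  · intro h1
    rcases phi_cases a b (y - x) with h2 | h2 <;> rw [h2] at h1
    · exact (mul_ne_zero (sub_ne_zero.2 ha1) hd) (by linear_combination h1)
    · exact (mul_ne_zero (sub_ne_zero.2 hb1) hd) (by linear_combination h1)

theorem card_R (hodd : Odd (Fintype.card F)) {χ : ℤ} (hχ : χ * χ = 1) :
    2 * ((univ.filter (fun y : F => eta y = χ)).card : ℤ) = (Fintype.card F : ℤ) - 1 := by
  have h1 : ∀ y : F, 2 * (if eta y = χ then (1 : ℤ) else 0) =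
      1 + χ * eta y - (if y = 0 then 1 else 0) := by
    intro y
    by_cases hy : y = 0
    · subst hy
      rcases chi_cases hχ with rfl | rfl <;> simp [eta_zero]
    · rcases chi_cases hχ with rfl | rfl <;> rcases eta_cases y hy with h | h <;> simp [h, hy]
  rw [Finset.card_filter]
  push_cast
  rw [Finset.mul_sum, Finset.sum_congr rfl (fun w _ => h1 w), Finset.sum_sub_distrib,
    Finset.sum_add_distrib, ← Finset.mul_sum, eta_sum hodd]
  simp

end basics

set_option linter.unusedSectionVars false
set_option linter.unusedVariables false

/-! ### A version of the fundamental theorem of affine geometry -/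

/-- `f` maps `K`-lines into `K`-lines -/
def PresLines (K : Subfield F) (f : F → F) : Prop :=
  ∀ x y : F, ∀ t ∈ K, ∃ s ∈ K, f (x + t * (y - x)) = f x + s * (f y - f x)

/-- not on a common `K`-line through zero -/
def Ind (K : Subfield F) (x y : F) : Prop := (∀ t ∈ K, x ≠ t * y) ∧ (∀ t ∈ K, y ≠ t * x)

section ftag
variable (K : Subfield F)

theorem Ind.of_left {x y : F} (h : ∀ t ∈ K, x ≠ t * y) (hy : y ≠ 0) : Ind K x y := by
  refine ⟨h, fun t ht e => ?_⟩
  have ht0 : t ≠ 0 := by rintro rfl; simp at e; exact hy e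
  exact h t⁻¹ (K.inv_mem ht) (by rw [e]; field_simp)

theorem ftag_scale {f : F → F} (h0 : f 0 = 0) (hf : PresLines K f) (x t : F) (ht : t ∈ K) :
    ∃ s ∈ K, f (t * x) = s * f x := by
  obtain ⟨s, hs, h⟩ := hf 0 x t ht
  refine ⟨s, hs, ?_⟩
  simpa [h0] using h

theorem ftag_key {f f' : F → F} (hff : ∀ x, f' (f x) = x) (h0 : f 0 = 0) (h0' : f' 0 = 0)
    (hf' : PresLines K f') {x y s1 s2 : F} (hxy : ∀ t ∈ K, x ≠ t * y)
    (hs1 : s1 ∈ K) (hs2 : s2 ∈ K) (h : f (x + y) = s1 * f x + s2 * f y) : s1 = 1 := by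
  by_contra hne
  have hs : s1 - 1 ≠ 0 := sub_ne_zero.2 hne
  obtain ⟨s, hs', e1⟩ := hf' (f x) (f (x + y)) (-(s1 - 1)⁻¹)
    (K.neg_mem (K.inv_mem (K.sub_mem hs1 K.one_mem)))
  have e2 : f x + -(s1 - 1)⁻¹ * (f (x + y) - f x) = (-(s1 - 1)⁻¹ * s2) * f y := by
    rw [h]; field_simp; ring
  rw [e2, hff, hff] at e1
  obtain ⟨k, hk, e3⟩ := ftag_scale K h0' hf' (f y) (-(s1 - 1)⁻¹ * s2)
    (K.mul_mem (K.neg_mem (K.inv_mem (K.sub_mem hs1 K.one_mem))) hs2)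
  rw [e3, hff] at e1
  exact hxy (k - s) (K.sub_mem hk hs') (by linear_combination -e1)

theorem ftag_ind (hμ : ∃ μ ∈ K, μ ≠ 0 ∧ μ ≠ 1) {f f' : F → F} (hff : ∀ x, f' (f x) = x)
    (h0 : f 0 = 0) (hf : PresLines K f)
    (hf' : PresLines K f') {x y : F} (hxy : Ind K x y) : f (x + y) = f x + f y := by
  have h0' : f' 0 = 0 := by rw [← h0, hff, h0]
  obtain ⟨μ, hμK, hμ0, hμ1⟩ := hμ
  have hμ' : 1 - μ ≠ 0 := sub_ne_zero.2 hμ1.symm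
  obtain ⟨s, hs, e⟩ := hf ((1 - μ)⁻¹ * x) (μ⁻¹ * y) μ hμK
  have e1 : (1 - μ)⁻¹ * x + μ * (μ⁻¹ * y - (1 - μ)⁻¹ * x) = x + y := by field_simp; ring
  rw [e1] at e
  obtain ⟨k1, hk1, e2⟩ := ftag_scale K h0 hf x (1 - μ)⁻¹ (K.inv_mem (K.sub_mem K.one_mem hμK))
  obtain ⟨k2, hk2, e3⟩ := ftag_scale K h0 hf y μ⁻¹ (K.inv_mem hμK)
  rw [e2, e3] at e
  have hs1 : (1 - s) * k1 ∈ K := K.mul_mem (K.sub_mem K.one_mem hs) hk1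
  have hs2 : s * k2 ∈ K := K.mul_mem hs hk2
  have e4 : f (x + y) = ((1 - s) * k1) * f x + (s * k2) * f y := by rw [e]; ring
  have r1 := ftag_key K hff h0 h0' hf' hxy.1 hs1 hs2 e4
  have r2 := ftag_key K hff h0 h0' hf' hxy.2 hs2 hs1 (by rw [add_comm y x, e4]; ring)
  rw [e4, r1, r2]; ring

theorem ftag_exists (hK : K ≠ ⊤) (z : F) (hz : z ≠ 0) : ∃ x, Ind K x z := by
  have : ∃ w : F, w ∉ K := by
    by_contra h
    push Not at h
    exact hK (by ext w; simp [h w])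
  obtain ⟨w, hw⟩ := this
  refine ⟨w * z, Ind.of_left K (fun t ht e => hw ?_) hz⟩
  rw [mul_right_cancel₀ hz e]; exact ht

theorem ftag_add (hK : K ≠ ⊤) (hμ : ∃ μ ∈ K, μ ≠ 0 ∧ μ ≠ 1) {f f' : F → F}
    (hff : ∀ x, f' (f x) = x)
    (h0 : f 0 = 0) (hf : PresLines K f)
    (hf' : PresLines K f') (x y : F) : f (x + y) = f x + f y := by
  have ind := fun {x y : F} => @ftag_ind F _ _ K hμ f f' hff h0 hf hf' x y
  have hneg : ∀ z, f (-z) = - f z := by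
    intro z
    by_cases hz : z = 0
    · subst hz; simp [h0]
    obtain ⟨w, hw⟩ := ftag_exists K hK z hz
    have h1 : Ind K (w + z) (-z) := by
      refine Ind.of_left K (fun t ht e => hw.1 (-t - 1)
        (K.sub_mem (K.neg_mem ht) K.one_mem) (by linear_combination e)) (neg_ne_zero.2 hz)
    have h2 := ind h1
    rw [ind hw] at h2
    simp only [add_neg_cancel_right] at h2
    linear_combination -h2
  by_cases hx : x = 0
  · subst hx; simp [h0]
  by_cases hy : y = 0
  · subst hy; simp [h0]
  by_cases hxy : Ind K x y
  · exact ind hxy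
  by_cases hs : x + y = 0
  · have : y = -x := by linear_combination hs
    rw [hs, this, hneg, h0]; ring
  have hdep : ∃ t ∈ K, y = t * x := by
    by_contra hcon
    push Not at hcon
    have := Ind.of_left K hcon hx
    exact hxy ⟨this.2, this.1⟩
  obtain ⟨t, ht, rfl⟩ := hdep
  obtain ⟨z, hz⟩ := ftag_exists K hK x hx
  have ht1 : t + 1 ≠ 0 := by
    intro h; exact hs (by linear_combination x * h)
  have i1 : Ind K x z := ⟨hz.2, hz.1⟩
  have hz0 : z ≠ 0 := fun h => hz.1 0 K.zero_mem (by rw [h]; ring)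
  have i2 : Ind K (t * x) (-z) := by
    refine Ind.of_left K (fun k hk e => hz.1 (-(k⁻¹ * t)) (K.neg_mem (K.mul_mem (K.inv_mem hk) ht)) ?_)
      (neg_ne_zero.2 hz0)
    have hk0 : k ≠ 0 := by
      rintro rfl
      exact hy (by rw [e]; ring)
    field_simp
    linear_combination e
  have i3 : Ind K (x + z) (t * x + -z) := by
    refine Ind.of_left K (fun k hk e => ?_) ?_
    · by_cases hk1 : k + 1 = 0
      · have : k = -1 := by linear_combination hk1
        subst this
        have : x * (t + 1) = 0 := by linear_combination e
        rcases mul_eq_zero.1 this with h | h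
        · exact hx h
        · exact ht1 h
      · refine hz.1 ((k + 1)⁻¹ * (k * t - 1)) (K.mul_mem (K.inv_mem (K.add_mem hk K.one_mem))
          (K.sub_mem (K.mul_mem hk ht) K.one_mem)) ?_
        field_simp
        linear_combination e
    · intro h
      exact hz.1 t ht (by linear_combination -h)
  have := ind i3
  rw [ind i1, ind i2, hneg] at this
  have e : x + z + (t * x + -z) = x + t * x := by ring
  rw [e] at this
  rw [this]; ring

theorem ftag (hK : K ≠ ⊤) (hμ : ∃ μ ∈ K, μ ≠ 0 ∧ μ ≠ 1) (g : Equiv.Perm F)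
    (hg : PresLines K g) (hg' : PresLines K g.symm) : IsAffinePerm g := by
  have key := ftag_add K hK hμ (f := fun x => g x - g 0) (f' := fun x => g.symm (x + g 0))
    (by intro x; simp) (by simp)
    (by
      intro x y t ht
      obtain ⟨s, hs, e⟩ := hg x y t ht
      refine ⟨s, hs, ?_⟩
      simp only
      rw [e]; ring)
    (by
      intro x y t ht
      obtain ⟨s, hs, e⟩ := hg' (x + g 0) (y + g 0) t ht
      refine ⟨s, hs, ?_⟩
      simp only
      rw [← e]; congr 1; ring)
  refine ⟨{ toFun := fun x => g x - g 0, invFun := fun x => g.symm (x + g 0),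
            left_inv := fun x => by simp, right_inv := fun x => by simp, map_add' := key },
    g 0, fun x => by simp⟩

end ftag

set_option linter.unusedSectionVars false
set_option linter.unusedVariables false

/-! ### Blocks with at least four points are lines over a subfield -/

/-- a set of which every coincidence under the group `x ↦ r x + c` is an invariance -/
def Rigid (B : Finset F) : Prop :=
  ∀ r c : F, eta r = 1 → ∀ u ∈ B, ∀ v ∈ B, u ≠ v → r * u + c ∈ B → r * v + c ∈ B →
    ∀ z ∈ B, r * z + c ∈ B

section rigid
variable {B : Finset F}

/-- dilations about `x` that preserve `B` -/
def dil (hB : Rigid B) (h3 : 3 ≤ B.card) (x : F) (hx : x ∈ B) : Subgroup Fˣ where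
  carrier := {u | eta (u : F) = 1 ∧ ∀ z ∈ B, x + u * (z - x) ∈ B}
  one_mem' := by simp [eta_one]
  mul_mem' := by
    rintro u v ⟨hu, hu'⟩ ⟨hv, hv'⟩
    refine ⟨by rw [Units.val_mul, eta_mul, hu, hv, one_mul], fun z hz => ?_⟩
    have := hu' _ (hv' z hz)
    convert this using 1
    rw [Units.val_mul]; ring
  inv_mem' := by
    rintro u ⟨hu, hu'⟩
    refine ⟨by rw [Units.val_inv_eq_inv_val, eta_inv, hu], fun z hz => ?_⟩
    obtain ⟨y, hy, hyx⟩ := Finset.exists_mem_ne (by omega : 1 < B.card) x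
    have hu0 : (u : F) ≠ 0 := u.ne_zero
    have := hB (u⁻¹ : F) (x - (u⁻¹ : F) * x) (by rw [eta_inv, hu]) x hx _ (hu' y hy)
      (by
        intro h
        have h1 : (u : F) * (y - x) = 0 := by linear_combination -h
        rcases mul_eq_zero.1 h1 with h2 | h2
        · exact hu0 h2
        · exact hyx (sub_eq_zero.1 h2)) (by simpa using hx)
      (by convert hy using 1; field_simp; ring) z hz
    convert this using 1
    rw [Units.val_inv_eq_inv_val]; ring

theorem mem_dil (hB : Rigid B) (h3 : 3 ≤ B.card) (x : F) (hx : x ∈ B) (u : Fˣ) :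
    u ∈ dil hB h3 x hx ↔ eta (u : F) = 1 ∧ ∀ z ∈ B, x + u * (z - x) ∈ B := Iff.rfl

theorem mem_dil' (hB : Rigid B) (h3 : 3 ≤ B.card) (x : F) (hx : x ∈ B) (u : Fˣ)
    (hu : eta (u : F) = 1) (y : F) (hy : y ∈ B) (hyx : y ≠ x) (h : x + u * (y - x) ∈ B) :
    u ∈ dil hB h3 x hx := by
  rw [mem_dil]
  refine ⟨hu, fun z hz => ?_⟩
  have := hB u (x - u * x) hu x hx y hy hyx.symm (by simpa using hx)
    (by convert h using 1; ring) z hz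
  convert this using 1; ring

theorem card_dil (hB : Rigid B) (h3 : 3 ≤ B.card) (x : F) (hx : x ∈ B) (y : F) (hy : y ∈ B)
    (hyx : y ≠ x) : Nat.card (dil hB h3 x hx) =
      (B.filter (fun z => eta (z - x) = eta (y - x))).card := by
  have hd : y - x ≠ 0 := sub_ne_zero.2 hyx
  have hbij : Function.Bijective (fun u : dil hB h3 x hx =>
      (⟨x + (u : Fˣ) * (y - x), by
        rw [Finset.mem_filter]
        refine ⟨((mem_dil hB h3 x hx u).1 u.2).2 y hy, ?_⟩
        rw [add_sub_cancel_left, eta_mul, ((mem_dil hB h3 x hx u).1 u.2).1, one_mul]⟩ :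
      {z // z ∈ B.filter (fun z => eta (z - x) = eta (y - x))})) := by
    constructor
    · intro u v huv
      simp only [Subtype.mk.injEq, add_right_inj] at huv
      exact Subtype.ext (Units.ext (mul_right_cancel₀ hd huv))
    · rintro ⟨z, hz⟩
      rw [Finset.mem_filter] at hz
      have he : eta (y - x) ≠ 0 := fun h => hd ((eta_eq_zero_iff _).1 h)
      have hzd : z - x ≠ 0 := fun h => he (by rw [← hz.2, h, eta_zero])
      refine ⟨⟨Units.mk0 ((z - x) / (y - x)) (div_ne_zero hzd hd), ?_⟩, ?_⟩
      · refine mem_dil' hB h3 x hx _ ?_ y hy hyx ?_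
        · rw [Units.val_mk0, eta_div, hz.2, eta_sq _ hd]
        · rw [Units.val_mk0, div_mul_cancel₀ _ hd]; simpa using hz.1
      · simp only [Units.val_mk0, Subtype.mk.injEq]
        rw [div_mul_cancel₀ _ hd]; ring
  rw [Nat.card_eq_of_bijective _ hbij, Nat.card_eq_fintype_card, Fintype.card_coe]

theorem card_dil_cases (hB : Rigid B) (h3 : 3 ≤ B.card) (x : F) (hx : x ∈ B) :
    B.card = Nat.card (dil hB h3 x hx) + 1 ∨ B.card = 2 * Nat.card (dil hB h3 x hx) + 1 := by
  set n := Nat.card (dil hB h3 x hx)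
  have key : ∀ χ : ℤ, χ = 1 ∨ χ = -1 → (B.filter (fun z => eta (z - x) = χ)).card = n ∨
      (B.filter (fun z => eta (z - x) = χ)).card = 0 := by
    intro χ hχ
    by_cases h : (B.filter (fun z => eta (z - x) = χ)).card = 0
    · exact Or.inr h
    · left
      obtain ⟨y, hy⟩ := Finset.card_pos.1 (Nat.pos_of_ne_zero h)
      rw [Finset.mem_filter] at hy
      have hyx : y ≠ x := by
        rintro rfl
        rw [sub_self, eta_zero] at hy
        rcases hχ with h | h <;> omega
      have := card_dil hB h3 x hx y hy.1 hyx
      rw [hy.2] at this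
      exact this.symm
  have hsplit : B.card = 1 + (B.filter (fun z => eta (z - x) = 1)).card
      + (B.filter (fun z => eta (z - x) = -1)).card := by
    have e1 : B = ({x} ∪ B.filter (fun z => eta (z - x) = 1)) ∪
        B.filter (fun z => eta (z - x) = -1) := by
      ext z
      simp only [Finset.mem_union, Finset.mem_singleton, Finset.mem_filter]
      constructor
      · intro hz
        by_cases hzx : z = x
        · exact Or.inl (Or.inl hzx)
        · rcases eta_cases _ (sub_ne_zero.2 hzx) with h | h
          · exact Or.inl (Or.inr ⟨hz, h⟩)
          · exact Or.inr ⟨hz, h⟩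
      · rintro ((rfl | h) | h)
        · exact hx
        · exact h.1
        · exact h.1
    conv_lhs => rw [e1]
    rw [Finset.card_union_of_disjoint, Finset.card_union_of_disjoint, Finset.card_singleton]
    · rw [Finset.disjoint_singleton_left, Finset.mem_filter]
      rintro ⟨_, h⟩; rw [sub_self, eta_zero] at h; omega
    · rw [Finset.disjoint_left]
      intro z hz hz'
      simp only [Finset.mem_union, Finset.mem_singleton, Finset.mem_filter] at hz hz'
      rcases hz with rfl | h
      · rw [sub_self, eta_zero] at hz'; omega
      · omega
  have k1 := key 1 (Or.inl rfl)
  have k2 := key (-1) (Or.inr rfl)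
  rcases k1 with h | h <;> rcases k2 with h' | h' <;> rw [h, h'] at hsplit <;> omega

theorem subgroup_mem_iff (S : Subgroup Fˣ) (u : Fˣ) : u ∈ S ↔ u ^ Nat.card S = 1 := by
  have hpos : 0 < Nat.card S := Nat.card_pos
  constructor
  · intro h
    have : (⟨u, h⟩ : S) ^ Nat.card S = 1 := pow_card_eq_one'
    exact congrArg Subtype.val this
  · intro h
    -- the image of `S` fills the set of roots of unity
    set T : Finset F := (univ.filter (fun v : Fˣ => v ∈ S)).image (fun v : Fˣ => (v : F)) with hT
    set U : Finset F := (Polynomial.nthRoots (Nat.card S) (1 : F)).toFinset with hU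
    have hTU : T ⊆ U := by
      intro z hz
      rw [hT, Finset.mem_image] at hz
      obtain ⟨v, hv, rfl⟩ := hz
      rw [hU, Multiset.mem_toFinset, Polynomial.mem_nthRoots hpos]
      have hv' : v ∈ S := (Finset.mem_filter.1 hv).2
      have : (⟨v, hv'⟩ : S) ^ Nat.card S = 1 := pow_card_eq_one'
      have h2 : v ^ Nat.card S = 1 := congrArg Subtype.val this
      simpa using congrArg Units.val h2
    have hTc : T.card = Nat.card S := by
      rw [hT, Finset.card_image_of_injective _ Units.val_injective, Nat.card_eq_fintype_card,
        Fintype.card_subtype]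
    have hUc : U.card ≤ Nat.card S :=
      (Multiset.toFinset_card_le _).trans (Polynomial.card_nthRoots _ _)
    have hEq : T = U := Finset.eq_of_subset_of_card_le hTU (by omega)
    have hu : (u : F) ∈ U := by
      rw [hU, Multiset.mem_toFinset, Polynomial.mem_nthRoots hpos]
      simpa using congrArg Units.val h
    rw [← hEq, hT, Finset.mem_image] at hu
    obtain ⟨v, hv, hvu⟩ := hu
    rw [← Units.ext hvu]
    exact (Finset.mem_filter.1 hv).2

theorem exists_common_dil (hB : Rigid B) (h3 : 3 ≤ B.card) (h4 : 4 ≤ B.card) :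
    ∃ u : Fˣ, u ≠ 1 ∧ ∀ (x : F) (hx : x ∈ B), u ∈ dil hB h3 x hx := by
  have hc := card_dil_cases hB h3
  by_cases hex : ∃ (x : F) (hx : x ∈ B), B.card = 2 * Nat.card (dil hB h3 x hx) + 1
  · obtain ⟨x, hx, h⟩ := hex
    have h2 : 1 < Nat.card (dil hB h3 x hx) := by omega
    haveI := Finite.one_lt_card_iff_nontrivial.1 h2
    obtain ⟨⟨u, hu⟩, hne⟩ := exists_ne (1 : dil hB h3 x hx)
    refine ⟨u, fun h => hne (Subtype.ext h), fun y hy => ?_⟩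
    rw [subgroup_mem_iff] at hu ⊢
    rcases hc y hy with h' | h'
    · have : Nat.card (dil hB h3 y hy) = Nat.card (dil hB h3 x hx) * 2 := by omega
      rw [this, pow_mul, hu, one_pow]
    · have : Nat.card (dil hB h3 y hy) = Nat.card (dil hB h3 x hx) := by omega
      rw [this, hu]
  · push Not at hex
    obtain ⟨x, hx⟩ := Finset.card_pos.1 (by omega : 0 < B.card)
    have hcx := (hc x hx).resolve_right (hex x hx)
    have h2 : 1 < Nat.card (dil hB h3 x hx) := by omega
    haveI := Finite.one_lt_card_iff_nontrivial.1 h2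
    obtain ⟨⟨u, hu⟩, hne⟩ := exists_ne (1 : dil hB h3 x hx)
    refine ⟨u, fun h => hne (Subtype.ext h), fun y hy => ?_⟩
    rw [subgroup_mem_iff] at hu ⊢
    have hcy := (hc y hy).resolve_right (hex y hy)
    have : Nat.card (dil hB h3 y hy) = Nat.card (dil hB h3 x hx) := by omega
    rw [this, hu]

theorem rigid_add (hB : Rigid B) (h4 : 4 ≤ B.card) (h0 : (0 : F) ∈ B) :
    ∀ x ∈ B, ∀ y ∈ B, x + y ∈ B := by
  have h3 : 3 ≤ B.card := by omega
  obtain ⟨u, hu1, hu⟩ := exists_common_dil hB h3 h4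
  have hu' : ∀ x (hx : x ∈ B), u⁻¹ ∈ dil hB h3 x hx := fun x hx => inv_mem (hu x hx)
  have hu0 : (u : F) ≠ 0 := u.ne_zero
  -- translations
  have htr : ∀ x ∈ B, ∀ z ∈ B, z + ((u : F)⁻¹ - 1) * x ∈ B := by
    intro x hx z hz
    have h1 := ((mem_dil hB h3 x hx _).1 (hu x hx)).2 z hz
    have h2 := ((mem_dil hB h3 0 h0 _).1 (hu' 0 h0)).2 _ h1
    convert h2 using 1
    rw [Units.val_inv_eq_inv_val]; field_simp; ring
  set ρ : F := (u : F)⁻¹ - 1 with hρ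
  have hρ0 : ρ ≠ 0 := by
    intro h
    apply hu1
    rw [← inv_inj, inv_one]
    apply Units.ext
    rw [Units.val_inv_eq_inv_val, Units.val_one]
    exact sub_eq_zero.1 h
  have hsub : B.image (fun x => ρ * x) ⊆ B := by
    intro z hz
    obtain ⟨x, hx, rfl⟩ := Finset.mem_image.1 hz
    simpa using htr x hx 0 h0
  have heq : B.image (fun x => ρ * x) = B := by
    apply Finset.eq_of_subset_of_card_le hsub
    rw [Finset.card_image_of_injective _ (mul_right_injective₀ hρ0)]
  intro x hx y hy
  rw [← heq] at hy
  obtain ⟨w, hw, rfl⟩ := Finset.mem_image.1 hy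
  exact htr w hw x hx

theorem rigid_neg (hB : Rigid B) (h4 : 4 ≤ B.card) (h0 : (0 : F) ∈ B) :
    ∀ x ∈ B, -x ∈ B := by
  intro x hx
  have hn : ∀ n : ℕ, (n : F) * x ∈ B := by
    intro n
    induction n with
    | zero => simpa using h0
    | succ n ih =>
      have := rigid_add hB h4 h0 _ ih x hx
      convert this using 1
      push_cast; ring
  have := hn (Fintype.card F - 1)
  have h1 : 1 ≤ Fintype.card F := Fintype.card_pos
  rw [Nat.cast_sub h1, FiniteField.cast_card_eq_zero] at this
  simpa using this

/-- multipliers of `B` -/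
def multField (hB : Rigid B) (h4 : 4 ≤ B.card) (h0 : (0 : F) ∈ B) : Subfield F where
  carrier := {t | ∀ z ∈ B, t * z ∈ B}
  mul_mem' := by
    intro s t hs ht z hz
    rw [mul_assoc]; exact hs _ (ht _ hz)
  one_mem' := by intro z hz; rwa [one_mul]
  add_mem' := by
    intro s t hs ht z hz
    rw [add_mul]; exact rigid_add hB h4 h0 _ (hs _ hz) _ (ht _ hz)
  zero_mem' := by intro z hz; rwa [zero_mul]
  neg_mem' := by
    intro s hs z hz
    rw [neg_mul]; exact rigid_neg hB h4 h0 _ (hs _ hz)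
  inv_mem' := by
    intro s hs z hz
    by_cases hs0 : s = 0
    · subst hs0; simpa using h0
    have heq : B.image (fun x => s * x) = B := by
      apply Finset.eq_of_subset_of_card_le
      · intro w hw
        obtain ⟨x, hx, rfl⟩ := Finset.mem_image.1 hw
        exact hs x hx
      · rw [Finset.card_image_of_injective _ (mul_right_injective₀ hs0)]
    rw [← heq] at hz
    obtain ⟨w, hw, rfl⟩ := Finset.mem_image.1 hz
    simpa [hs0] using hw

theorem mem_multField (hB : Rigid B) (h4 : 4 ≤ B.card) (h0 : (0 : F) ∈ B) (t : F) :
    t ∈ multField hB h4 h0 ↔ ∀ z ∈ B, t * z ∈ B := Iff.rfl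

theorem rigid_span (hB : Rigid B) (h4 : 4 ≤ B.card) (h0 : (0 : F) ∈ B) (y : F) (hy : y ∈ B)
    (hy0 : y ≠ 0) (z : F) : z ∈ B ↔ ∃ t ∈ multField hB h4 h0, z = t * y := by
  have h3 : 3 ≤ B.card := by omega
  constructor
  swap
  · rintro ⟨t, ht, rfl⟩
    exact ht y hy
  intro hz
  by_contra hcon
  push Not at hcon
  set K := multField hB h4 h0
  set T : Finset F := univ.filter (fun t => t ∈ K) with hT
  have hTc : Nat.card (dil hB h3 0 h0) + 1 ≤ T.card := by
    have : insert (0 : F) ((univ.filter (fun v : Fˣ => v ∈ dil hB h3 0 h0)).image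
        (fun v : Fˣ => (v : F))) ⊆ T := by
      intro t ht
      rw [hT, Finset.mem_filter]
      refine ⟨Finset.mem_univ _, ?_⟩
      rcases Finset.mem_insert.1 ht with rfl | ht
      · exact K.zero_mem
      · obtain ⟨v, hv, rfl⟩ := Finset.mem_image.1 ht
        intro w hw
        have := ((mem_dil hB h3 0 h0 v).1 (Finset.mem_filter.1 hv).2).2 w hw
        simpa using this
    have hc := Finset.card_le_card this
    rw [Finset.card_insert_of_notMem, Finset.card_image_of_injective _ Units.val_injective] at hc
    · rw [Nat.card_eq_fintype_card, Fintype.card_subtype]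
      exact hc
    · intro h
      obtain ⟨v, _, hv⟩ := Finset.mem_image.1 h
      exact v.ne_zero hv
  have hdis : Disjoint (T.image (fun t => t * y)) (T.image (fun t => z + t * y)) := by
    rw [Finset.disjoint_left]
    intro w hw hw'
    obtain ⟨t, ht, rfl⟩ := Finset.mem_image.1 hw
    obtain ⟨s, hs, h⟩ := Finset.mem_image.1 hw'
    rw [hT, Finset.mem_filter] at ht hs
    exact hcon (t - s) (K.sub_mem ht.2 hs.2) (by linear_combination h)
  have hsub : (T.image (fun t => t * y)) ∪ (T.image (fun t => z + t * y)) ⊆ B := by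
    intro w hw
    rcases Finset.mem_union.1 hw with hw | hw
    · obtain ⟨t, ht, rfl⟩ := Finset.mem_image.1 hw
      rw [hT, Finset.mem_filter] at ht
      exact ht.2 y hy
    · obtain ⟨t, ht, rfl⟩ := Finset.mem_image.1 hw
      rw [hT, Finset.mem_filter] at ht
      exact rigid_add hB h4 h0 _ hz _ (ht.2 y hy)
  have hcard := Finset.card_le_card hsub
  rw [Finset.card_union_of_disjoint hdis,
    Finset.card_image_of_injective _ (mul_left_injective₀ hy0),
    Finset.card_image_of_injective _
      (fun s t h => mul_left_injective₀ hy0 (add_left_cancel h))] at hcard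
  rcases card_dil_cases hB h3 0 h0 with h | h <;> omega

theorem rigid_field (hB : Rigid B) (h4 : 4 ≤ B.card) (h0 : (0 : F) ∈ B) (t : F) :
    t ∈ multField hB h4 h0 ↔ t ^ B.card = t := by
  obtain ⟨y, hy, hy0⟩ := Finset.exists_mem_ne (by omega : 1 < B.card) 0
  set K := multField hB h4 h0
  have hc : Fintype.card K = B.card := by
    have : B = (univ.filter (fun t => t ∈ K)).image (fun t => t * y) := by
      ext z
      rw [rigid_span hB h4 h0 y hy hy0, Finset.mem_image]
      constructor
      · rintro ⟨t, ht, rfl⟩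
        exact ⟨t, by simpa using ht, rfl⟩
      · rintro ⟨t, ht, rfl⟩
        exact ⟨t, by simpa using ht, rfl⟩
    rw [this, Finset.card_image_of_injective _ (mul_left_injective₀ hy0), ← Fintype.card_subtype]
  have hfw : ∀ t ∈ K, t ^ B.card = t := by
    intro t ht
    have : (⟨t, ht⟩ : K) ^ Fintype.card K = ⟨t, ht⟩ := FiniteField.pow_card _
    rw [hc] at this
    simpa using congrArg Subtype.val this
  refine ⟨hfw t, fun h => ?_⟩
  set P : Polynomial F := Polynomial.X ^ B.card - Polynomial.X with hP
  have hPd : P.natDegree = B.card := FiniteField.X_pow_card_sub_X_natDegree_eq F (by omega)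
  have hP0 : P ≠ 0 := FiniteField.X_pow_card_sub_X_ne_zero F (by omega)
  have hsub : univ.filter (fun t => t ∈ K) ⊆ P.roots.toFinset := by
    intro s hs
    rw [Multiset.mem_toFinset, Polynomial.mem_roots hP0, Polynomial.IsRoot.def, hP]
    simp [hfw s (by simpa using hs)]
  have hle : P.roots.toFinset.card ≤ (univ.filter (fun t => t ∈ K)).card := by
    have h1 := (Multiset.toFinset_card_le P.roots).trans (Polynomial.card_roots' P)
    rw [hPd, ← hc, Fintype.card_subtype] at h1
    exact h1
  have heq := Finset.eq_of_subset_of_card_le hsub hle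
  have : t ∈ P.roots.toFinset := by
    rw [Multiset.mem_toFinset, Polynomial.mem_roots hP0, Polynomial.IsRoot.def, hP]
    simp [h]
  rw [← heq] at this
  simpa using this

end rigid

set_option linter.unusedSectionVars false
set_option linter.unusedVariables false

/-! ### Automorphisms, blocks, large blocks -/

/-- the automorphism group of the quadratic quasigroup -/
def AutQ (a b : F) : Subgroup (Equiv.Perm F) where
  carrier := {g | ∀ x y, qmul a b (g x) (g y) = g (qmul a b x y)}
  one_mem' := by intro x y; rfl
  mul_mem' := by
    intro g h hg hh x y
    simp only [Equiv.Perm.mul_apply]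
    rw [hg, hh]
  inv_mem' := by
    intro g hg x y
    apply g.injective
    rw [← hg]; simp

theorem mem_AutQ {a b : F} {g : Equiv.Perm F} :
    g ∈ AutQ a b ↔ ∀ x y, qmul a b (g x) (g y) = g (qmul a b x y) := Iff.rfl

/-- the permutation `x ↦ r x + c` -/
def affPerm (r c : F) (hr : r ≠ 0) : Equiv.Perm F := (Equiv.mulLeft₀ r hr).trans (Equiv.addRight c)

theorem affPerm_apply (r c : F) (hr : r ≠ 0) (x : F) : affPerm r c hr x = r * x + c := rfl

theorem ne_zero_of_eta {r : F} (hr : eta r = 1) : r ≠ 0 := by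
  rintro rfl; rw [eta_zero] at hr; omega

theorem affPerm_mem (a b : F) {r : F} (hr : eta r = 1) (c : F) :
    affPerm r c (ne_zero_of_eta hr) ∈ AutQ a b := by
  intro x y
  simp only [affPerm_apply]
  exact qmul_affine a b hr c x y

theorem affine_of_add (g : Equiv.Perm F) (h : ∀ x t, g (x + t) = g x + g t - g 0) :
    IsAffinePerm g := by
  refine ⟨{ toFun := fun x => g x - g 0, invFun := fun x => g.symm (x + g 0),
            left_inv := fun x => by simp, right_inv := fun x => by simp,
            map_add' := fun x y => by rw [h]; ring },
    g 0, fun x => by simp⟩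

/-- fixed points of the stabilizer of `x` and `y` -/
def blk (G : Subgroup (Equiv.Perm F)) (x y : F) : Finset F :=
  univ.filter (fun z => ∀ g ∈ G, g x = x → g y = y → g z = z)

section blocks
variable {G : Subgroup (Equiv.Perm F)}

theorem mem_blk {x y z : F} : z ∈ blk G x y ↔ ∀ g ∈ G, g x = x → g y = y → g z = z := by
  simp [blk]

theorem left_mem_blk (x y : F) : x ∈ blk G x y := mem_blk.2 (fun _ _ h _ => h)
theorem right_mem_blk (x y : F) : y ∈ blk G x y := mem_blk.2 (fun _ _ _ h => h)

theorem blk_map {g : Equiv.Perm F} (hg : g ∈ G) {x y z : F} (hz : z ∈ blk G x y) :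
    g z ∈ blk G (g x) (g y) := by
  rw [mem_blk] at hz ⊢
  intro h hh h1 h2
  have := hz (g⁻¹ * h * g) (G.mul_mem (G.mul_mem (G.inv_mem hg) hh) hg)
    (by simp [Equiv.Perm.mul_apply, h1]) (by simp [Equiv.Perm.mul_apply, h2])
  simp only [Equiv.Perm.mul_apply] at this
  have h3 := congrArg g this
  simpa using h3

theorem blk_card_map {g : Equiv.Perm F} (hg : g ∈ G) (x y : F) :
    (blk G (g x) (g y)).card = (blk G x y).card := by
  apply le_antisymm
  · apply Finset.card_le_card_of_injOn (fun z => g⁻¹ z)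
    · intro z hz
      have := blk_map (G.inv_mem hg) hz
      simpa using this
    · intro z _ w _ h; exact g⁻¹.injective h
  · apply Finset.card_le_card_of_injOn (fun z => g z)
    · intro z hz
      exact blk_map hg hz
    · intro z _ w _ h; exact g.injective h

theorem blk_card (h2 : TwoTransitive (G : Set (Equiv.Perm F))) {x y u v : F} (h : x ≠ y)
    (h' : u ≠ v) : (blk G x y).card = (blk G u v).card := by
  obtain ⟨g, hg, rfl, rfl⟩ := h2 x y u v h h'
  exact (blk_card_map hg x y).symm

theorem blk_eq (h2 : TwoTransitive (G : Set (Equiv.Perm F))) {x y u v : F} (h : x ≠ y)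
    (h' : u ≠ v) (hu : u ∈ blk G x y) (hv : v ∈ blk G x y) : blk G u v = blk G x y := by
  apply Finset.eq_of_subset_of_card_le
  · intro z hz
    rw [mem_blk] at hz hu hv ⊢
    intro g hg hx hy
    exact hz g hg (hu g hg hx hy) (hv g hg hx hy)
  · rw [blk_card h2 h h']

theorem blk_rigid (h2 : TwoTransitive (G : Set (Equiv.Perm F)))
    (hH : ∀ (r c : F) (hr : eta r = 1), affPerm r c (ne_zero_of_eta hr) ∈ G) {x y : F}
    (h : x ≠ y) : Rigid (blk G x y) := by
  intro r c hr u hu v hv huv hu' hv' z hz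
  have h1 : z ∈ blk G u v := by rw [blk_eq h2 h huv hu hv]; exact hz
  have h3 := blk_map (hH r c hr) h1
  simp only [affPerm_apply] at h3
  rw [blk_eq h2 h _ hu' hv'] at h3
  · exact h3
  · intro e
    exact huv (mul_left_cancel₀ (ne_zero_of_eta hr) (add_right_cancel e))

theorem translate_mem (hH : ∀ (r c : F) (hr : eta r = 1), affPerm r c (ne_zero_of_eta hr) ∈ G)
    (c : F) : Equiv.addRight c ∈ G := by
  have := hH 1 c eta_one
  convert this using 1
  ext x
  simp [affPerm_apply]

theorem blk_lines (h2 : TwoTransitive (G : Set (Equiv.Perm F)))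
    (hH : ∀ (r c : F) (hr : eta r = 1), affPerm r c (ne_zero_of_eta hr) ∈ G)
    (h4 : 4 ≤ (blk G (0 : F) 1).card) :
    ∃ K : Subfield F, (∃ μ ∈ K, μ ≠ 0 ∧ μ ≠ 1) ∧
      ∀ x y z : F, x ≠ y → (z ∈ blk G x y ↔ ∃ t ∈ K, z = x + t * (y - x)) := by
  have h01 : (0 : F) ≠ 1 := zero_ne_one
  have hB0 := blk_rigid h2 hH h01
  set K := multField hB0 h4 (left_mem_blk 0 1) with hK
  have hline0 : ∀ y z : F, y ≠ 0 → (z ∈ blk G 0 y ↔ ∃ t ∈ K, z = t * y) := by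
    intro y z hy
    have hc := blk_card h2 h01 hy.symm
    have h4' : 4 ≤ (blk G 0 y).card := by omega
    rw [rigid_span (blk_rigid h2 hH hy.symm) h4' (left_mem_blk 0 y) y (right_mem_blk 0 y) hy]
    have : ∀ t, t ∈ multField (blk_rigid h2 hH hy.symm) h4' (left_mem_blk 0 y) ↔ t ∈ K := by
      intro t
      rw [rigid_field, hK, rigid_field, hc]
    simp only [this]
  refine ⟨K, ?_, ?_⟩
  · have : 2 < (blk G (0 : F) 1).card := by omega
    obtain ⟨μ, hμ, hμ'⟩ := Finset.exists_mem_notMem_of_card_lt_card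
      (s := {(0 : F), 1}) (t := blk G (0 : F) 1) (by
        have := Finset.card_le_two (a := (0 : F)) (b := 1)
        omega)
    simp only [Finset.mem_insert, Finset.mem_singleton, not_or] at hμ'
    obtain ⟨t, ht, e⟩ := (hline0 1 μ one_ne_zero).1 hμ
    rw [mul_one] at e
    exact ⟨μ, e ▸ ht, hμ'⟩
  · intro x y z hxy
    have hyx : y - x ≠ 0 := sub_ne_zero.2 hxy.symm
    have : z ∈ blk G x y ↔ z - x ∈ blk G 0 (y - x) := by
      constructor
      · intro h
        have := blk_map (translate_mem hH (-x)) h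
        simpa [sub_eq_add_neg] using this
      · intro h
        have := blk_map (translate_mem hH x) h
        simpa using this
    rw [this, hline0 _ _ hyx]
    constructor
    · rintro ⟨t, ht, e⟩; exact ⟨t, ht, by linear_combination e⟩
    · rintro ⟨t, ht, e⟩; exact ⟨t, ht, by linear_combination e⟩

theorem sharp_affine (h2 : TwoTransitive (G : Set (Equiv.Perm F)))
    (hH : ∀ (r c : F) (hr : eta r = 1), affPerm r c (ne_zero_of_eta hr) ∈ G)
    (hs : ∀ g ∈ G, ∀ x y : F, x ≠ y → g x = x → g y = y → g = 1) :
    ∀ g ∈ G, IsAffinePerm g := by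
  have huniq : ∀ g ∈ G, ∀ h ∈ G, ∀ x y : F, x ≠ y → g x = h x → g y = h y → g = h := by
    intro g hg h hh x y hxy e1 e2
    have := hs (h⁻¹ * g) (G.mul_mem (G.inv_mem hh) hg) x y hxy
      (by simp [Equiv.Perm.mul_apply, e1]) (by simp [Equiv.Perm.mul_apply, e2])
    exact (inv_mul_eq_one.1 this).symm
  -- derangements are translations
  have hder : ∀ g ∈ G, (∀ x, g x ≠ x) → ∀ x, g x = x + g 0 := by
    intro g hg hgd
    set c := g 0 with hc
    have hc0 : c ≠ 0 := hgd 0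
    have hex : ∀ x : F, ∃ h ∈ G, x ≠ 0 → x ≠ c → h 0 = c ∧ h x = x := by
      intro x
      by_cases hx0 : x = 0
      · exact ⟨g, hg, fun h => absurd hx0 h⟩
      by_cases hxc : x = c
      · exact ⟨g, hg, fun _ h => absurd hxc h⟩
      obtain ⟨h, hh, e1, e2⟩ := h2 0 x c x (Ne.symm hx0) (Ne.symm hxc)
      exact ⟨h, hh, fun _ _ => ⟨e1, e2⟩⟩
    choose k hkG hk using hex
    by_contra hcon
    push Not at hcon
    obtain ⟨x0, hx0⟩ := hcon
    have h1 : g 1 ≠ 1 + c := by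
      intro e
      have := huniq g hg _ (translate_mem hH c) 0 1 zero_ne_one (by simp [hc]) (by simp [e])
      exact hx0 (by rw [this]; simp)
    have hg1c : g 1 ≠ c := fun h => one_ne_zero (g.injective (h.trans hc))
    have hmaps : ∀ x ∈ (univ.erase (0 : F)).erase c,
        k x 1 ∈ (((univ.erase c).erase (g 1)).erase (1 + c)) := by
      intro x hx
      simp only [Finset.mem_erase, Finset.mem_univ, and_true] at hx ⊢
      obtain ⟨e1, e2⟩ := hk x hx.2 hx.1
      refine ⟨?_, ?_, ?_⟩
      · intro e
        have := huniq _ (hkG x) _ (translate_mem hH c) 0 1 zero_ne_one (by simp [e1]) (by simp [e])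
        rw [this] at e2
        simp at e2; exact hc0 e2
      · intro e
        have := huniq _ (hkG x) g hg 0 1 zero_ne_one (by rw [e1]) e
        rw [this] at e2
        exact hgd x e2
      · intro e
        exact one_ne_zero ((k x).injective (e.trans e1.symm))
    have hinj : Set.InjOn (fun x => k x 1) ((univ.erase (0 : F)).erase c : Finset F) := by
      intro x hx y hy e
      simp only [Finset.coe_erase, Finset.coe_univ, Set.mem_diff, Set.mem_univ, true_and,
        Set.mem_singleton_iff] at hx hy
      by_contra hne
      obtain ⟨e1, e2⟩ := hk x hx.1 hx.2
      obtain ⟨e3, e4⟩ := hk y hy.1 hy.2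
      have := huniq _ (hkG x) _ (hkG y) 0 1 zero_ne_one (by rw [e1, e3]) e
      rw [← this] at e4
      have h5 := hs _ (hkG x) x y hne e2 e4
      rw [h5] at e1
      exact hc0 (by rw [← e1]; rfl)
    have hle := Finset.card_le_card_of_injOn _ hmaps hinj
    rw [Finset.card_erase_of_mem, Finset.card_erase_of_mem, Finset.card_erase_of_mem,
      Finset.card_erase_of_mem, Finset.card_erase_of_mem, Finset.card_univ] at hle
    · have : 3 ≤ Fintype.card F := by
        have : ({c, g 1, 1 + c} : Finset F).card = 3 := by
          rw [Finset.card_eq_three]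
          refine ⟨c, g 1, 1 + c, hg1c.symm, ?_, h1, rfl⟩
          intro h; exact one_ne_zero (by linear_combination -h)
        rw [← this]; exact Finset.card_le_univ _
      omega
    · simp
    · simp [hg1c]
    · simp only [Finset.mem_erase, Finset.mem_univ, and_true]
      refine ⟨Ne.symm h1, ?_⟩
      intro h; exact one_ne_zero (by linear_combination h)
    · simp
    · simp [hc0]
  intro g hg
  apply affine_of_add
  intro x t
  by_cases ht : t = 0
  · subst ht; simp
  have hd := hder (g * Equiv.addRight t * g⁻¹)
    (G.mul_mem (G.mul_mem hg (translate_mem hH t)) (G.inv_mem hg))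
    (by
      intro x e
      simp only [Equiv.Perm.mul_apply, Equiv.coe_addRight] at e
      have := g.injective (e.trans (by simp : x = g (g⁻¹ x)))
      exact ht (by linear_combination this))
  have h1 := hd (g x)
  have h0 := hd (g 0)
  simp [Equiv.Perm.mul_apply, Equiv.coe_addRight] at h1 h0
  rw [h1, h0]; ring

theorem large_affine (h2 : TwoTransitive (G : Set (Equiv.Perm F)))
    (hH : ∀ (r c : F) (hr : eta r = 1), affPerm r c (ne_zero_of_eta hr) ∈ G)
    (h4 : 4 ≤ (blk G (0 : F) 1).card) :
    ∀ g ∈ G, IsAffinePerm g := by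
  obtain ⟨K, hμ, hK⟩ := blk_lines h2 hH h4
  by_cases htop : K = ⊤
  · apply sharp_affine h2 hH
    intro g hg x y hxy hx hy
    ext z
    have : z ∈ blk G x y := by
      rw [hK x y z hxy]
      refine ⟨(z - x) / (y - x), by rw [htop]; trivial, ?_⟩
      rw [div_mul_cancel₀ _ (sub_ne_zero.2 hxy.symm)]; ring
    exact mem_blk.1 this g hg hx hy
  · have hp : ∀ g ∈ G, PresLines K g := by
      intro g hg x y t ht
      by_cases hxy : x = y
      · subst hxy; exact ⟨0, K.zero_mem, by simp⟩
      · have h1 := blk_map hg ((hK x y (x + t * (y - x)) hxy).2 ⟨t, ht, rfl⟩)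
        exact (hK _ _ _ (fun h => hxy (g.injective h))).1 h1
    intro g hg
    exact ftag K htop hμ g (hp g hg) (hp g⁻¹ (G.inv_mem hg))

end blocks

set_option linter.unusedSectionVars false
set_option linter.unusedVariables false

/-! ### Blocks of size three: the Netto systems -/

/-- the parameters of a Netto system -/
structure Netto (a b : F) : Prop where
  neg : eta (-1 : F) = -1
  hb : b = 1 - a
  ha : a ^ 2 - a + 1 = 0
  hea : eta a = -1
  three : (3 : F) ≠ 0
  steiner : ∀ x y : F, qmul a b x (qmul a b x y) = y

theorem netto_of_three (hodd : Odd (Fintype.card F)) {a b : F} (hv : ValidPair a b) (hab : a ≠ b)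
    (h2 : TwoTransitive (AutQ a b : Set (Equiv.Perm F)))
    (hk : (blk (AutQ a b) (0 : F) 1).card < 4) : Netto a b := by
  obtain ⟨ha0, hb0, ha1, hb1, heab, _⟩ := valid_facts hv
  have htwo := two_ne_zeroF hodd
  have hmem : ∀ x y : F, qmul a b x y ∈ blk (AutQ a b) x y := by
    intro x y
    rw [mem_blk]
    intro g hg hx hy
    rw [← mem_AutQ.1 hg, hx, hy]
  have hblk : ∀ x y : F, x ≠ y → blk (AutQ a b) x y = {x, y, qmul a b x y} := by
    intro x y hxy
    symm
    apply Finset.eq_of_subset_of_card_le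
    · intro z hz
      simp only [Finset.mem_insert, Finset.mem_singleton] at hz
      rcases hz with rfl | rfl | rfl
      · exact left_mem_blk _ _
      · exact right_mem_blk _ _
      · exact hmem _ _
    · have : ({x, y, qmul a b x y} : Finset F).card = 3 := by
        rw [Finset.card_eq_three]
        exact ⟨x, y, _, hxy, (qmul_ne hv hxy).1.symm, (qmul_ne hv hxy).2.symm, rfl⟩
      rw [this, blk_card h2 hxy (zero_ne_one : (0 : F) ≠ 1)]
      omega
  have hcomm : ∀ x y : F, qmul a b x y = qmul a b y x := by
    intro x y
    by_cases hxy : x = y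
    · subst hxy; rfl
    have h1 : qmul a b y x ∈ blk (AutQ a b) x y := by
      have := hmem y x
      rw [mem_blk] at this ⊢
      intro g hg h3 h4
      exact this g hg h4 h3
    rw [hblk x y hxy] at h1
    simp only [Finset.mem_insert, Finset.mem_singleton] at h1
    have hn := qmul_ne hv (Ne.symm hxy)
    rcases h1 with h | h | h
    · exact absurd h hn.2
    · exact absurd h hn.1
    · exact h.symm
  have hst : ∀ x y : F, qmul a b x (qmul a b x y) = y := by
    intro x y
    by_cases hxy : x = y
    · subst hxy; rw [qmul_self, qmul_self]
    have hn := qmul_ne hv hxy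
    have h1 : qmul a b x (qmul a b x y) ∈ blk (AutQ a b) x y := by
      rw [mem_blk]
      intro g hg h3 h4
      rw [← mem_AutQ.1 hg, ← mem_AutQ.1 hg, h3, h4]
    rw [hblk x y hxy] at h1
    simp only [Finset.mem_insert, Finset.mem_singleton] at h1
    have hn' := qmul_ne hv (Ne.symm hn.1)
    rcases h1 with h | h | h
    · exact absurd h hn'.1
    · exact h
    · exact absurd h hn'.2
  have e1 := hcomm 0 1
  rw [qmul_eq, qmul_eq, sub_zero, phi_eta_one a b eta_one, zero_sub] at e1
  have hm1 : (-1 : F) ≠ 0 := by simp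
  rcases eta_cases (-1 : F) hm1 with hneg | hneg
  · exfalso
    rw [phi_eta_one a b hneg] at e1
    obtain ⟨n, hn⟩ := eta_exists_neg hodd
    have e2 := hcomm 0 n
    rw [qmul_eq, qmul_eq, sub_zero, phi_eta_neg a b hn, zero_sub,
      phi_eta_neg a b (by rw [eta_neg, hneg, hn]; norm_num)] at e2
    have hn0 : n ≠ 0 := by rintro rfl; rw [eta_zero] at hn; omega
    apply hab
    have h3 : n * (2 * b - 1) = 0 := by linear_combination e2
    rcases mul_eq_zero.1 h3 with h | h
    · exact absurd h hn0
    · have h5 : 2 * (a - b) = 0 := by linear_combination e1 - h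
      rcases mul_eq_zero.1 h5 with h | h
      · exact absurd h htwo
      · exact sub_eq_zero.1 h
  · rw [phi_eta_neg a b hneg] at e1
    have hb : b = 1 - a := by linear_combination e1
    have e3 := hst 0 1
    rw [qmul_eq, qmul_eq] at e3
    simp only [sub_zero, zero_add, phi_eta_one a b eta_one, mul_one] at e3
    rcases eta_cases a ha0 with hea | hea
    · exfalso
      rw [phi_eta_one a b hea] at e3
      have h5 : (a - 1) * (a + 1) = 0 := by linear_combination e3
      rcases mul_eq_zero.1 h5 with h | h
      · exact ha1 (sub_eq_zero.1 h)
      · have : a = -1 := by linear_combination h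
        rw [this, hneg] at hea; omega
    · rw [phi_eta_neg a b hea, hb] at e3
      have ha : a ^ 2 - a + 1 = 0 := by linear_combination -e3
      refine ⟨hneg, hb, ha, hea, ?_, hst⟩
      intro h3
      have h5 : (a + 1) ^ 2 = 0 := by linear_combination ha + a * h3
      have h6 : a + 1 = 0 := by simpa using h5
      apply hab
      rw [hb]; linear_combination 2 * h6 - h3

/-- closed under the quasigroup operation -/
def Closed (a b : F) (X : Finset F) : Prop := ∀ x ∈ X, ∀ y ∈ X, qmul a b x y ∈ X

theorem Netto.sum_pow (hodd : Odd (Fintype.card F)) {a b : F} (hN : Netto a b) {X : Finset F}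
    (hX : Closed a b X) {x : F} (hx : x ∈ X) {m : ℕ} (hm : Odd m) :
    ∑ y ∈ X, (y - x) ^ (3 * m) = 0 := by
  have h1 : ∑ y ∈ X, (qmul a b x y - x) ^ (3 * m) = ∑ y ∈ X, (y - x) ^ (3 * m) := by
    apply Finset.sum_nbij' (fun y => qmul a b x y) (fun y => qmul a b x y)
    · intro y hy; exact hX x hx y hy
    · intro y hy; exact hX x hx y hy
    · intro y _; exact hN.steiner x y
    · intro y _; exact hN.steiner x y
    · intro y _; rfl
  have ha3 : a ^ 3 = -1 := by linear_combination (a + 1) * hN.ha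
  have hb3 : b ^ 3 = -1 := by rw [hN.hb]; linear_combination (-a + 2) * hN.ha
  have h2 : ∀ y, (qmul a b x y - x) ^ (3 * m) = - (y - x) ^ (3 * m) := by
    intro y
    rw [qmul_eq, add_sub_cancel_left]
    rcases phi_cases a b (y - x) with h | h <;> rw [h, mul_pow, pow_mul]
    · rw [ha3, hm.neg_one_pow]; ring
    · rw [hb3, hm.neg_one_pow]; ring
  rw [Finset.sum_congr rfl (fun y _ => h2 y), Finset.sum_neg_distrib] at h1
  have h3 : 2 * ∑ y ∈ X, (y - x) ^ (3 * m) = 0 := by linear_combination -h1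
  rcases mul_eq_zero.1 h3 with h | h
  · exact absurd h (two_ne_zeroF hodd)
  · exact h

theorem closed_translate {a b : F} {X : Finset F} (hX : Closed a b X) (t : F) :
    Closed a b (X.image (fun y => y - t)) := by
  intro x hx y hy
  obtain ⟨x', hx', rfl⟩ := Finset.mem_image.1 hx
  obtain ⟨y', hy', rfl⟩ := Finset.mem_image.1 hy
  refine Finset.mem_image.2 ⟨qmul a b x' y', hX x' hx' y' hy', ?_⟩
  rw [qmul_eq, qmul_eq]
  have : y' - t - (x' - t) = y' - x' := by ring
  rw [this]; ring

open Polynomial in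
/-- if `∑ (y - x)^n = 0` for more than `n` values of `x` then all the coefficients vanish -/
theorem sum_pow_coeff (X Z : Finset F) (n : ℕ) (hn : n < Z.card)
    (h : ∀ x ∈ Z, ∑ y ∈ X, (y - x) ^ n = 0) (i : ℕ) (hi : i ≤ n) :
    (n.choose i : F) * ∑ y ∈ X, y ^ i = 0 := by
  set P : F[X] := ∑ y ∈ X, (Polynomial.X + C (-y)) ^ n with hP
  have hdeg : P.natDegree ≤ n := by
    apply Polynomial.natDegree_sum_le_of_forall_le
    intro y _
    have := Polynomial.natDegree_pow_le (p := (Polynomial.X + C (-y))) (n := n)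
    rw [Polynomial.natDegree_X_add_C, mul_one] at this
    exact this
  have h0 : P = 0 := by
    apply Polynomial.eq_zero_of_natDegree_lt_card_of_eval_eq_zero' P Z
    · intro x hx
      have h1 := h x hx
      have : P.eval x = (-1) ^ n * ∑ y ∈ X, (y - x) ^ n := by
        rw [hP, Polynomial.eval_finsetSum, Finset.mul_sum]
        apply Finset.sum_congr rfl
        intro y _
        simp only [eval_pow, eval_add, eval_X, eval_C]
        rw [← mul_pow]; congr 1; ring
      rw [this, h1, mul_zero]
    · omega
  have h1 : P.coeff (n - i) = 0 := by rw [h0]; simp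
  rw [hP, Polynomial.finsetSum_coeff] at h1
  simp only [Polynomial.coeff_X_add_C_pow] at h1
  have hni : n - (n - i) = i := by omega
  rw [hni, Nat.choose_symm hi, ← Finset.sum_mul] at h1
  have h2 : ∑ y ∈ X, (-y) ^ i = (-1) ^ i * ∑ y ∈ X, y ^ i := by
    rw [Finset.mul_sum]
    apply Finset.sum_congr rfl
    intro y _
    rw [← mul_pow]; congr 1; ring
  rw [h2] at h1
  have h3 : ((-1 : F)) ^ i ≠ 0 := pow_ne_zero _ (by simp)
  apply mul_left_cancel₀ h3
  rw [mul_zero, ← h1]; ring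

theorem Netto.card_zero (hodd : Odd (Fintype.card F)) {a b : F} (hN : Netto a b) {X : Finset F}
    (hX : Closed a b X) (h3 : 3 < X.card) : (X.card : F) = 0 := by
  have := sum_pow_coeff X X 3 h3 (fun x hx => by
    have := hN.sum_pow hodd hX hx (m := 1) (by decide)
    simpa using this) 0 (by omega)
  simpa using this

theorem Netto.card_mod (hodd : Odd (Fintype.card F)) {a b : F} (hN : Netto a b) :
    Fintype.card F % 4 = 3 := by
  by_contra h
  have h1 : IsSquare (-1 : F) := FiniteField.isSquare_neg_one_iff.2 h
  have h2 : inR (-1 : F) := ⟨by simp, h1⟩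
  have := inR_eta h2
  rw [hN.neg] at this; omega

theorem Netto.char_mod (hodd : Odd (Fintype.card F)) {a b : F} (hN : Netto a b) (p : ℕ)
    [hp : Fact p.Prime] [CharP F p] : p % 6 = 1 := by
  have hpp := hp.out
  have h2 : p ≠ 2 := by
    rintro rfl
    exact two_ne_zeroF hodd (CharP.cast_eq_zero F 2)
  have h3 : p ≠ 3 := by
    rintro rfl
    exact hN.three (CharP.cast_eq_zero F 3)
  have hp2 : p % 2 ≠ 0 := by
    intro h
    exact h2 ((Nat.prime_dvd_prime_iff_eq Nat.prime_two hpp).1 (Nat.dvd_of_mod_eq_zero h)).symm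
  have hp3 : p % 3 ≠ 0 := by
    intro h
    exact h3 ((Nat.prime_dvd_prime_iff_eq Nat.prime_three hpp).1 (Nat.dvd_of_mod_eq_zero h)).symm
  by_contra h1
  have h5 : p % 6 = 5 := by omega
  obtain ⟨n, _, hn⟩ := FiniteField.card F p
  have hodd' : Odd (n : ℕ) := by
    by_contra he
    rw [Nat.not_odd_iff_even] at he
    obtain ⟨k, hk⟩ := he
    have h4 := hN.card_mod hodd
    rw [hn, hk, pow_add, Nat.mul_mod] at h4
    have : p ^ k % 4 < 4 := Nat.mod_lt _ (by norm_num)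
    interval_cases (p ^ k % 4) <;> omega
  have hq5 : Fintype.card F % 6 = 5 := by
    obtain ⟨k, hk⟩ := hodd'
    rw [hn, hk, Nat.pow_mod, h5, pow_succ, pow_mul, Nat.mul_mod, Nat.pow_mod]
    norm_num
  have hpow := FiniteField.pow_card a
  have ha6 : a ^ 6 = 1 := by linear_combination (a + 1) * (a ^ 3 - 1) * hN.ha
  rw [← Nat.div_add_mod (Fintype.card F) 6, hq5, pow_add, pow_mul, ha6, one_pow, one_mul] at hpow
  have : a ^ 2 = 1 := by linear_combination ha6 - a * hpow
  have hh : a = 2 := by linear_combination -hN.ha + this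
  apply hN.three
  have := hN.ha
  rw [hh] at this
  linear_combination this

theorem Netto.a_pow (hodd : Odd (Fintype.card F)) {a b : F} (hN : Netto a b) (p : ℕ)
    [hp : Fact p.Prime] [CharP F p] : a ^ p = a := by
  have h1 := hN.char_mod hodd p
  have ha6 : a ^ 6 = 1 := by linear_combination (a + 1) * (a ^ 3 - 1) * hN.ha
  rw [← Nat.div_add_mod p 6, h1, pow_add, pow_mul, ha6]; simp

set_option linter.unusedSectionVars false
set_option linter.unusedVariables false

/-! ### Subsystems of size `p` of Netto systems are lines over the prime field -/

theorem newton_finset (X : Finset F) (k : ℕ) :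
    (k : F) * X.val.esymm k = (-1) ^ (k + 1) *
      ∑ a ∈ antidiagonal k with a.1 < k, (-1) ^ a.1 * X.val.esymm a.1 * ∑ y ∈ X, y ^ a.2 := by
  have h := congrArg (MvPolynomial.aeval (R := F) (fun y : X => (y : F)))
    (MvPolynomial.mul_esymm_eq_sum X F k)
  have hX : (univ : Finset X).val.map (fun y : X => (y : F)) = X.val := by
    rw [Finset.univ_eq_attach, Finset.attach_val]
    exact Multiset.attach_map_val _
  have hp : ∀ m : ℕ, MvPolynomial.aeval (R := F) (fun y : X => (y : F)) (MvPolynomial.psum X F m)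
      = ∑ y ∈ X, y ^ m := by
    intro m
    rw [MvPolynomial.psum, map_sum]
    simp only [map_pow, MvPolynomial.aeval_X]
    rw [Finset.univ_eq_attach]
    exact Finset.sum_attach X (fun y => y ^ m)
  simp only [map_mul, map_natCast, map_pow, map_neg, map_one, map_sum,
    MvPolynomial.aeval_esymm_eq_multiset_esymm, hX, hp] at h
  exact h

theorem root_relation (X : Finset F) (y : F) (hy : y ∈ X) :
    ∑ j ∈ Finset.range (X.card + 1), (-1) ^ j * (X.val.esymm j * y ^ (X.card - j)) = 0 := by
  have h := congrArg (Polynomial.eval y) (Multiset.prod_X_sub_X_eq_sum_esymm X.val)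
  rw [Polynomial.eval_finsetSum] at h
  simp only [Polynomial.eval_mul, Polynomial.eval_pow, Polynomial.eval_C, Polynomial.eval_X,
    Polynomial.eval_neg, Polynomial.eval_one, Finset.card_val] at h
  rw [← h, Polynomial.eval_multiset_prod]
  apply Multiset.prod_eq_zero
  rw [Multiset.mem_map]
  exact ⟨Polynomial.X - Polynomial.C y, Multiset.mem_map.2 ⟨y, hy, rfl⟩, by simp⟩

section plane
variable (p n : ℕ) [hp : Fact p.Prime] [CharP F p]

theorem cast_ne_zero_of_lt {k : ℕ} (h0 : 0 < k) (hk : k < p) : (k : F) ≠ 0 := by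
  intro h
  have := (CharP.cast_eq_zero_iff F p k).1 h
  exact absurd (Nat.le_of_dvd h0 this) (by omega)

theorem subsystem_rel (hpn : p = n + 4) (hn : Odd n) (h3 : 3 ≤ n) (X : Finset F) (hc : X.card = p)
    (hs : ∀ i ≤ n, ∑ y ∈ X, y ^ i = 0) :
    ∃ c1 c0 : F, ∀ y ∈ X, 6 * y ^ p = -2 * (∑ y ∈ X, y ^ (n + 1)) * y ^ 3
      - 3 * (∑ y ∈ X, y ^ (n + 2)) * y ^ 2 + c1 * y + c0 := by
  have hpF : (n : F) + 4 = 0 := by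
    have := CharP.cast_eq_zero F p
    rw [hpn] at this
    exact_mod_cast this
  have hE0 : X.val.esymm 0 = 1 := by simp [Multiset.esymm]
  have hE : ∀ k, 1 ≤ k → k ≤ n → X.val.esymm k = 0 := by
    intro k hk1 hkn
    have h := newton_finset X k
    rw [Finset.sum_eq_zero, mul_zero] at h
    · rcases mul_eq_zero.1 h with h | h
      · exact absurd h (cast_ne_zero_of_lt p (by omega) (by omega))
      · exact h
    · intro x hx
      rw [Finset.mem_filter, Finset.HasAntidiagonal.mem_antidiagonal] at hx
      rw [hs x.2 (by omega), mul_zero]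
  have e1 : 3 * X.val.esymm (n + 1) = ∑ y ∈ X, y ^ (n + 1) := by
    have h := newton_finset X (n + 1)
    rw [Finset.sum_eq_single (0, n + 1)] at h
    · rw [hE0] at h
      have : ((-1 : F)) ^ (n + 1 + 1) = -1 := by
        rw [pow_succ, pow_succ, hn.neg_one_pow]; ring
      rw [this] at h
      push_cast at h
      linear_combination -h + X.val.esymm (n + 1) * hpF
    · intro x hx hne
      rw [Finset.mem_filter, Finset.HasAntidiagonal.mem_antidiagonal] at hx
      have : x.2 ≤ n := by
        by_contra h
        apply hne
        ext <;> simp <;> omega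
      rw [hs x.2 this, mul_zero]
    · intro h
      exfalso; apply h; simp
  have e2 : -2 * X.val.esymm (n + 2) = ∑ y ∈ X, y ^ (n + 2) := by
    have h := newton_finset X (n + 2)
    rw [Finset.sum_eq_single (0, n + 2)] at h
    · rw [hE0] at h
      have : ((-1 : F)) ^ (n + 2 + 1) = 1 := by
        rw [pow_succ, pow_add, hn.neg_one_pow]; ring
      rw [this] at h
      push_cast at h
      linear_combination h - X.val.esymm (n + 2) * hpF
    · intro x hx hne
      rw [Finset.mem_filter, Finset.HasAntidiagonal.mem_antidiagonal] at hx
      by_cases h1 : x.1 = 1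
      · rw [h1, hE 1 le_rfl (by omega)]; ring
      have : x.2 ≤ n := by
        by_contra h
        apply hne
        ext <;> simp <;> omega
      rw [hs x.2 this, mul_zero]
    · intro h
      exfalso; apply h; simp
  refine ⟨-6 * X.val.esymm (n + 3), 6 * X.val.esymm (n + 4), fun y hy => ?_⟩
  have h := root_relation X y hy
  rw [hc, hpn, Finset.sum_range_succ, Finset.sum_range_succ, Finset.sum_range_succ,
    Finset.sum_range_succ, Finset.sum_eq_single 0] at h
  · have s1 : ((-1 : F)) ^ (n + 1) = 1 := by rw [pow_succ, hn.neg_one_pow]; ring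
    have s2 : ((-1 : F)) ^ (n + 2) = -1 := by rw [pow_add, hn.neg_one_pow]; ring
    have s3 : ((-1 : F)) ^ (n + 3) = 1 := by rw [pow_add, hn.neg_one_pow]; ring
    have s4 : ((-1 : F)) ^ (n + 4) = -1 := by rw [pow_add, hn.neg_one_pow]; ring
    rw [s1, s2, s3, s4, hE0] at h
    have t1 : n + 4 - (n + 1) = 3 := by omega
    have t2 : n + 4 - (n + 2) = 2 := by omega
    have t3 : n + 4 - (n + 3) = 1 := by omega
    have t4 : n + 4 - (n + 4) = 0 := by omega
    rw [t1, t2, t3, t4, Nat.sub_zero] at h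
    rw [← e1, ← e2, hpn]
    linear_combination 6 * h
  · intro j hj hj0
    rw [Finset.mem_range] at hj
    rw [hE j (by omega) (by omega)]; ring
  · intro h
    exfalso; apply h; simp

theorem sum_shift (X : Finset F) (hs : ∀ i ≤ n, ∑ y ∈ X, y ^ i = 0) (t : F) :
    (∑ y ∈ X, (y - t) ^ (n + 1) = ∑ y ∈ X, y ^ (n + 1)) ∧
    (∑ y ∈ X, (y - t) ^ (n + 2) = ∑ y ∈ X, y ^ (n + 2) - (n + 2) * t * ∑ y ∈ X, y ^ (n + 1)) := by
  have hexp : ∀ k, ∑ y ∈ X, (y - t) ^ k =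
      ∑ m ∈ Finset.range (k + 1), (-t) ^ (k - m) * (k.choose m : F) * ∑ y ∈ X, y ^ m := by
    intro k
    have : ∀ y ∈ X, (y - t) ^ k =
        ∑ m ∈ Finset.range (k + 1), (-t) ^ (k - m) * (k.choose m : F) * y ^ m := by
      intro y _
      rw [sub_eq_add_neg, add_pow]
      apply Finset.sum_congr rfl
      intro m _; ring
    rw [Finset.sum_congr rfl this, Finset.sum_comm]
    apply Finset.sum_congr rfl
    intro m _
    rw [Finset.mul_sum]
  constructor
  · rw [hexp, Finset.sum_range_succ, Finset.sum_eq_zero]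
    · simp
    · intro m hm
      rw [Finset.mem_range] at hm
      rw [hs m (by omega), mul_zero]
  · rw [hexp, Finset.sum_range_succ, Finset.sum_range_succ, Finset.sum_eq_zero]
    · have t1 : n + 2 - (n + 1) = 1 := by omega
      have t2 : (n + 2).choose (n + 1) = n + 2 := Nat.choose_succ_self_right (n + 1)
      rw [t1, t2]
      simp
      ring
    · intro m hm
      rw [Finset.mem_range] at hm
      rw [hs m (by omega), mul_zero]

theorem netto_line (hodd : Odd (Fintype.card F)) {a b : F} (hN : Netto a b) (X : Finset F)
    (hX : Closed a b X) (h0 : (0 : F) ∈ X) (hc : X.card = p) :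
    ∃ e : F, ∀ y ∈ X, y ^ p = e * y := by
  have hmod := hN.char_mod hodd p
  have hp1 : 1 < p := hp.out.one_lt
  obtain ⟨m, hm, hpm⟩ : ∃ m, Odd m ∧ p = 3 * m + 4 := by
    refine ⟨(p - 4) / 3, ?_, ?_⟩
    · rw [Nat.odd_iff]; omega
    · omega
  set n := 3 * m with hn
  have hnodd : Odd n := by rw [hn]; exact Nat.odd_mul.2 ⟨by decide, hm⟩
  have hm1 : 1 ≤ m := hm.pos
  have h3 : 3 ≤ n := by omega
  -- vanishing power sums for every closed set of that size
  have hvan : ∀ Z : Finset F, Closed a b Z → Z.card = p → ∀ i ≤ n, ∑ y ∈ Z, y ^ i = 0 := by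
    intro Z hZ hZc i hi
    have h := sum_pow_coeff Z Z n (by omega) (fun x hx => hN.sum_pow hodd hZ hx hm) i hi
    rcases mul_eq_zero.1 h with h | h
    · exfalso
      have h1 := (CharP.cast_eq_zero_iff F p _).1 h
      have h2 : p ∣ n.factorial := by
        rw [← Nat.choose_mul_factorial_mul_factorial hi, mul_assoc]
        exact Dvd.dvd.mul_right h1 _
      have := (hp.out.dvd_factorial).1 h2
      omega
    · exact h
  have k2 : (2 : F) ≠ 0 := by
    have := cast_ne_zero_of_lt (F := F) p (k := 2) (by omega) (by omega); simpa using this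
  have k3 : (3 : F) ≠ 0 := by
    have := cast_ne_zero_of_lt (F := F) p (k := 3) (by omega) (by omega); simpa using this
  have k5 : (5 : F) ≠ 0 := by
    have := cast_ne_zero_of_lt (F := F) p (k := 5) (by omega) (by omega); simpa using this
  have k6 : (6 : F) ≠ 0 := by
    have := cast_ne_zero_of_lt (F := F) p (k := 6) (by omega) (by omega); simpa using this
  have hpF : (n : F) + 4 = 0 := by
    have := CharP.cast_eq_zero F p
    rw [hpm] at this
    exact_mod_cast this
  -- first relation
  have hrel : ∀ Z : Finset F, Closed a b Z → Z.card = p → (0 : F) ∈ Z →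
      (∑ y ∈ Z, y ^ (n + 1)) * (∑ y ∈ Z, y ^ (n + 2)) = 0 := by
    intro Z hZ hZc hZ0
    have hs := hvan Z hZ hZc
    obtain ⟨c1, c0, hr⟩ := subsystem_rel p n hpm hnodd h3 Z hZc hs
    have hc0 : c0 = 0 := by
      have := hr 0 hZ0
      rw [zero_pow hp.out.ne_zero] at this
      linear_combination -this
    have hj := hN.sum_pow hodd hZ hZ0 (m := 2 * m + 1) (by simp)
    have hj2 : ∑ y ∈ Z, 6 * (y - 0) ^ (3 * (2 * m + 1)) =
        -2 * (∑ y ∈ Z, y ^ (n + 1)) * (∑ y ∈ Z, y ^ (n + 2))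
        - 3 * (∑ y ∈ Z, y ^ (n + 2)) * (∑ y ∈ Z, y ^ (n + 1)) + c1 * ∑ y ∈ Z, y ^ n := by
      have hlin : ∀ A B C : F, A * (∑ y ∈ Z, y ^ (n + 2)) - B * (∑ y ∈ Z, y ^ (n + 1)) +
          C * ∑ y ∈ Z, y ^ n = ∑ y ∈ Z, (A * y ^ (n + 2) - B * y ^ (n + 1) + C * y ^ n) := by
        intro A B C
        simp only [Finset.mul_sum, Finset.sum_sub_distrib, Finset.sum_add_distrib]
      rw [hlin]
      apply Finset.sum_congr rfl
      intro y hy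
      have e1 : 3 * (2 * m + 1) = p + (n - 1) := by omega
      rw [sub_zero, e1, pow_add, ← mul_assoc, hr y hy, hc0]
      obtain ⟨k, hk⟩ : ∃ k, n = k + 1 := ⟨n - 1, by omega⟩
      rw [hk]
      simp only [Nat.add_sub_cancel]
      ring
    rw [← Finset.mul_sum, hj, hs n le_rfl] at hj2
    have : 5 * ((∑ y ∈ Z, y ^ (n + 1)) * (∑ y ∈ Z, y ^ (n + 2))) = 0 := by linear_combination hj2
    exact (mul_eq_zero.1 this).resolve_left k5
  have hs := hvan X hX hc
  -- the first coefficient vanishes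
  have hz : ∑ y ∈ X, y ^ (n + 1) = 0 := by
    obtain ⟨t, ht, ht0⟩ := Finset.exists_mem_ne (by omega : 1 < X.card) 0
    have hinj : Function.Injective (fun y : F => y - t) := fun x y h => sub_left_injective h
    have h1 := hrel X hX hc h0
    have h2 := hrel (X.image (fun y => y - t)) (closed_translate hX t)
      (by rw [Finset.card_image_of_injective _ hinj, hc])
      (Finset.mem_image.2 ⟨t, ht, sub_self t⟩)
    rw [Finset.sum_image (fun x _ y _ h => hinj h), Finset.sum_image (fun x _ y _ h => hinj h),
      (sum_shift n X hs t).1, (sum_shift n X hs t).2] at h2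
    have h4 : (2 * t) * (∑ y ∈ X, y ^ (n + 1)) ^ 2 = 0 := by
      linear_combination h2 - h1 + t * (∑ y ∈ X, y ^ (n + 1)) ^ 2 * hpF
    rcases mul_eq_zero.1 h4 with h | h
    · exact absurd h (mul_ne_zero k2 ht0)
    · simpa using h
  obtain ⟨c1, c0, hr⟩ := subsystem_rel p n hpm hnodd h3 X hc hs
  have hc0 : c0 = 0 := by
    have := hr 0 h0
    rw [zero_pow hp.out.ne_zero] at this
    linear_combination -this
  rw [hz, hc0] at hr
  set S := ∑ y ∈ X, y ^ (n + 2) with hS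
  have hj := hN.sum_pow hodd hX h0 (m := n + 2) (by
    rw [Nat.odd_iff] at hnodd ⊢; omega)
  have hj2 : ∑ y ∈ X, 36 * (y - 0) ^ (3 * (n + 2)) =
      9 * S ^ 2 * S - 6 * S * c1 * (∑ y ∈ X, y ^ (n + 1)) + c1 ^ 2 * ∑ y ∈ X, y ^ n := by
    have hlin : ∀ A B C : F, A * S - B * (∑ y ∈ X, y ^ (n + 1)) +
        C * ∑ y ∈ X, y ^ n = ∑ y ∈ X, (A * y ^ (n + 2) - B * y ^ (n + 1) + C * y ^ n) := by
      intro A B C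
      rw [hS]
      simp only [Finset.mul_sum, Finset.sum_sub_distrib, Finset.sum_add_distrib]
    rw [hlin]
    apply Finset.sum_congr rfl
    intro y hy
    have e1 : 3 * (n + 2) = p + p + (n - 2) := by omega
    have e2 : 36 * (y - 0) ^ (3 * (n + 2)) = (6 * y ^ p) ^ 2 * y ^ (n - 2) := by
      rw [sub_zero, e1, pow_add, pow_add]; ring
    rw [e2, hr y hy]
    obtain ⟨k, hk⟩ : ∃ k, n = k + 2 := ⟨n - 2, by omega⟩
    rw [hk]
    simp only [Nat.add_sub_cancel]
    ring
  rw [← Finset.mul_sum, hj, hz, hs n le_rfl] at hj2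
  have hS0 : S = 0 := by
    have : (3 * S) ^ 2 * S = 0 := by linear_combination -hj2
    rcases mul_eq_zero.1 this with h | h
    · have := pow_eq_zero_iff (two_ne_zero) |>.1 h
      exact (mul_eq_zero.1 this).resolve_left k3
    · exact h
  refine ⟨c1 / 6, fun y hy => ?_⟩
  have := hr y hy
  rw [hS0] at this
  field_simp
  linear_combination this

end plane

theorem netto_affine (hodd : Odd (Fintype.card F)) {a b : F} (hN : Netto a b) (p : ℕ)
    [hp : Fact p.Prime] [CharP F p] (hq : Fintype.card F ≠ p) :
    ∀ g ∈ AutQ a b, IsAffinePerm g := by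
  have hmod := hN.char_mod hodd p
  set K : Subfield F := ⊥ with hK
  have hmem : ∀ x : F, x ∈ K ↔ x ^ p = x := fun x => Subfield.mem_bot_iff_pow_eq_self F p
  have haK : a ∈ K := (hmem a).2 (hN.a_pow hodd p)
  have hbK : b ∈ K := by rw [hN.hb]; exact K.sub_mem K.one_mem haK
  have hcard : (univ.filter (fun t : F => t ∈ K)).card = p := by
    rw [← Fintype.card_subtype, ← Nat.card_eq_fintype_card]
    exact Subfield.card_bot F p
  have hphi : ∀ x, ∃ t ∈ K, phi a b x = t * x := by
    intro x
    rcases phi_cases a b x with h | h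
    · exact ⟨a, haK, h⟩
    · exact ⟨b, hbK, h⟩
  have hp' : ∀ g ∈ AutQ a b, PresLines K g := by
    intro g hg x y t ht
    by_cases hxy : x = y
    · subst hxy; exact ⟨0, K.zero_mem, by simp⟩
    have hyx : y - x ≠ 0 := sub_ne_zero.2 (Ne.symm hxy)
    set L : Finset F := (univ.filter (fun t : F => t ∈ K)).image (fun t => x + t * (y - x)) with hL
    have hLm : ∀ z, z ∈ L ↔ ∃ t ∈ K, z = x + t * (y - x) := by
      intro z
      rw [hL, Finset.mem_image]
      constructor
      · rintro ⟨t, ht, rfl⟩; exact ⟨t, by simpa using ht, rfl⟩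
      · rintro ⟨t, ht, rfl⟩; exact ⟨t, by simpa using ht, rfl⟩
    have hLc : L.card = p := by
      rw [hL, Finset.card_image_of_injective, hcard]
      intro s t h
      exact mul_right_cancel₀ hyx (add_left_cancel h)
    have hLcl : Closed a b L := by
      intro u hu v hv
      rw [hLm] at hu hv ⊢
      obtain ⟨s, hs, rfl⟩ := hu
      obtain ⟨r, hr, rfl⟩ := hv
      obtain ⟨k, hk, e⟩ := hphi (x + r * (y - x) - (x + s * (y - x)))
      refine ⟨s + k * (r - s), K.add_mem hs (K.mul_mem hk (K.sub_mem hr hs)), ?_⟩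
      rw [qmul_eq, e]; ring
    set Z := (L.image g).image (fun z => z - g x) with hZ
    have hMcl : Closed a b (L.image g) := by
      intro u hu v hv
      obtain ⟨u', hu', rfl⟩ := Finset.mem_image.1 hu
      obtain ⟨v', hv', rfl⟩ := Finset.mem_image.1 hv
      rw [mem_AutQ.1 hg]
      exact Finset.mem_image_of_mem _ (hLcl u' hu' v' hv')
    have hZm : ∀ z ∈ L, g z - g x ∈ Z := fun z hz =>
      Finset.mem_image_of_mem (fun z => z - g x) (Finset.mem_image_of_mem g hz)
    have hxL : x ∈ L := (hLm x).2 ⟨0, K.zero_mem, by ring⟩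
    have hyL : y ∈ L := (hLm y).2 ⟨1, K.one_mem, by ring⟩
    have htL : x + t * (y - x) ∈ L := (hLm _).2 ⟨t, ht, rfl⟩
    obtain ⟨e, he⟩ := netto_line p hodd hN Z (closed_translate hMcl _)
      (by have := hZm x hxL; simpa using this)
      (by
        rw [hZ, Finset.card_image_of_injective, Finset.card_image_of_injective _ g.injective, hLc]
        intro u v h; exact sub_left_injective h)
    have e1 := he _ (hZm y hyL)
    have e2 := he _ (hZm _ htL)
    have hv0 : g y - g x ≠ 0 := sub_ne_zero.2 (fun h => hxy (g.injective h).symm)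
    refine ⟨(g (x + t * (y - x)) - g x) / (g y - g x), ?_, ?_⟩
    · rw [hmem, div_pow, e1, e2]
      have he0 : e ≠ 0 := by
        rintro rfl
        rw [zero_mul] at e1
        exact hv0 (pow_eq_zero_iff hp.out.ne_zero |>.1 e1)
      field_simp
    · rw [div_mul_cancel₀ _ hv0]; ring
  intro g hg
  refine ftag K ?_ ⟨2, ?_, ?_, ?_⟩ g (hp' g hg) (hp' g⁻¹ (Subgroup.inv_mem _ hg))
  · intro htop
    apply hq
    rw [← hcard, htop]
    simp [Finset.filter_true_of_mem]
  · have := K.add_mem K.one_mem K.one_mem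
    rwa [one_add_one_eq_two] at this
  · exact two_ne_zeroF hodd
  · intro h
    exact one_ne_zero (α := F) (by linear_combination h)

set_option linter.unusedSectionVars false
set_option linter.unusedVariables false

/-! ### Netto systems of prime order are not two-transitive when the order exceeds 7 -/

theorem netto_fix (hodd : Odd (Fintype.card F)) {a b : F} (hN : Netto a b) (p : ℕ)
    [hp : Fact p.Prime] [CharP F p] (hq : Fintype.card F = p) (g : Equiv.Perm F)
    (hg : g ∈ AutQ a b) (h3 : 3 < (univ.filter (fun x : F => g x = x)).card) : g = 1 := by
  have hcl : Closed a b (univ.filter (fun x : F => g x = x)) := by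
    intro x hx y hy
    simp only [Finset.mem_filter, Finset.mem_univ, true_and] at hx hy ⊢
    rw [← mem_AutQ.1 hg, hx, hy]
  have h1 := (CharP.cast_eq_zero_iff F p _).1 (hN.card_zero hodd hcl h3)
  have h2 := Nat.le_of_dvd (by omega) h1
  have h4 : univ.filter (fun x : F => g x = x) = univ := by
    apply Finset.eq_univ_of_card
    apply le_antisymm (Finset.card_le_univ _)
    rw [hq]; exact h2
  ext x
  have : x ∈ univ.filter (fun x : F => g x = x) := by rw [h4]; exact Finset.mem_univ x
  simpa using this

theorem netto_stab_dvd (hodd : Odd (Fintype.card F)) {a b : F} (hN : Netto a b) (p : ℕ)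
    [hp : Fact p.Prime] [CharP F p] (hq : Fintype.card F = p) (hv : ValidPair a b) :
    Fintype.card (MulAction.stabilizer (AutQ a b) ((0 : F), (1 : F))) ∣ p - 3 := by
  obtain ⟨ha0, hb0, ha1, hb1, heab, _⟩ := valid_facts hv
  set S := MulAction.stabilizer (AutQ a b) ((0 : F), (1 : F)) with hS
  have hB := MulAction.sum_card_fixedBy_eq_card_orbits_mul_card_group S F
  have hfix : ∀ s : S, s ≠ 1 → Fintype.card (MulAction.fixedBy F s) = 3 := by
    intro s hs
    have hs0 : (s : AutQ a b) • ((0 : F), (1 : F)) = (0, 1) := s.2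
    have e0 : ((s : AutQ a b) : Equiv.Perm F) 0 = 0 := congrArg Prod.fst hs0
    have e1 : ((s : AutQ a b) : Equiv.Perm F) 1 = 1 := congrArg Prod.snd hs0
    have e2 : ((s : AutQ a b) : Equiv.Perm F) a = a := by
      have h := mem_AutQ.1 (s : AutQ a b).2 0 1
      rw [e0, e1, qmul_eq, sub_zero, zero_add, phi_eta_one a b eta_one, mul_one] at h
      exact h.symm
    have hc : Fintype.card (MulAction.fixedBy F s) =
        (univ.filter (fun x : F => ((s : AutQ a b) : Equiv.Perm F) x = x)).card := by
      rw [← Fintype.card_subtype]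
      exact Fintype.card_congr (Equiv.refl _)
    rw [hc]
    apply le_antisymm
    · by_contra hcon
      have := netto_fix hodd hN p hq _ (s : AutQ a b).2 (by omega)
      apply hs
      ext1; ext1; exact this
    · have : ({0, 1, a} : Finset F).card = 3 := by
        rw [Finset.card_eq_three]
        exact ⟨0, 1, a, zero_ne_one, ha0.symm, ha1.symm, rfl⟩
      rw [← this]
      apply Finset.card_le_card
      intro z hz
      simp only [Finset.mem_insert, Finset.mem_singleton] at hz
      rcases hz with rfl | rfl | rfl <;> simp [*]
  have h1 : Fintype.card (MulAction.fixedBy F (1 : S)) = p := by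
    rw [← hq]
    have : ∀ x, x ∈ MulAction.fixedBy F (1 : S) := fun x => one_smul S x
    exact Fintype.card_congr (Equiv.subtypeUnivEquiv this)
  rw [← Finset.add_sum_erase _ _ (Finset.mem_univ (1 : S)), h1,
    Finset.sum_congr rfl (fun s hs => hfix s (Finset.ne_of_mem_erase hs)),
    Finset.sum_const, Finset.card_erase_of_mem (Finset.mem_univ _), Finset.card_univ, smul_eq_mul] at hB
  have hpos : 0 < Fintype.card S := Fintype.card_pos
  have hk : Fintype.card S ∣ p + (Fintype.card S - 1) * 3 := Dvd.intro_left _ hB.symm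
  have hmod := hN.char_mod hodd p
  have h5 : p + (Fintype.card S - 1) * 3 = (p - 3) + Fintype.card S * 3 := by
    have := hp.out.one_lt
    omega
  rw [h5] at hk
  exact (Nat.dvd_add_left (Dvd.intro _ rfl)).1 hk

theorem netto_card_group {a b : F} 
    (h2 : TwoTransitive (AutQ a b : Set (Equiv.Perm F))) :
    Fintype.card F * (Fintype.card F - 1) *
      Fintype.card (MulAction.stabilizer (AutQ a b) ((0 : F), (1 : F))) = Fintype.card (AutQ a b) := by
  rw [← MulAction.card_orbit_mul_card_stabilizer_eq_card_group (AutQ a b) ((0 : F), (1 : F))]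
  congr 1
  have : MulAction.orbit (AutQ a b) ((0 : F), (1 : F)) = {z | z.1 ≠ z.2} := by
    ext z
    constructor
    · rintro ⟨g, rfl⟩
      intro h
      exact zero_ne_one ((g : Equiv.Perm F).injective h)
    · intro hz
      obtain ⟨g, hg, e1, e2⟩ := h2 0 1 z.1 z.2 zero_ne_one hz
      exact ⟨⟨g, hg⟩, Prod.ext e1 e2⟩
  rw [Fintype.card_congr (Equiv.setCongr this)]
  have h3 : Fintype.card {z : F × F | z.1 ≠ z.2} = (univ : Finset F).offDiag.card := by
    rw [← Set.toFinset_card]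
    congr 1
    ext z
    simp
  rw [h3, Finset.offDiag_card, Finset.card_univ, Nat.mul_sub, mul_one]

/-- the translation subgroup -/
def Tr (a b : F) : Subgroup (AutQ a b) where
  carrier := {g | ∃ c : F, (g : Equiv.Perm F) = Equiv.addRight c}
  one_mem' := ⟨0, by ext; simp⟩
  mul_mem' := by
    rintro g h ⟨c, hc⟩ ⟨d, hd⟩
    refine ⟨d + c, ?_⟩
    ext x
    simp [hc, hd, add_assoc]
  inv_mem' := by
    rintro g ⟨c, hc⟩
    refine ⟨-c, ?_⟩
    ext x
    simp [hc]

theorem card_Tr (a b : F) : Nat.card (Tr a b) = Fintype.card F := by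
  rw [← Nat.card_eq_fintype_card]
  symm
  apply Nat.card_congr
  refine Equiv.ofBijective (fun c => ⟨⟨Equiv.addRight c, translate_mem (fun r c hr => affPerm_mem a b hr c) c⟩, c, rfl⟩) ⟨?_, ?_⟩
  · intro c d h
    have h1 : (Equiv.addRight c : Equiv.Perm F) = Equiv.addRight d :=
      congrArg (fun z : Tr a b => ((z : AutQ a b) : Equiv.Perm F)) h
    have := congrArg (fun g : Equiv.Perm F => g 0) h1
    simpa using this
  · rintro ⟨⟨g, hg⟩, c, hc⟩
    refine ⟨c, ?_⟩
    ext1; ext1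
    exact hc.symm

theorem card_normTr (hodd : Odd (Fintype.card F)) {a b : F} (hab : a ≠ b) (p : ℕ)
    [hp : Fact p.Prime] [CharP F p] (hq : Fintype.card F = p) :
    2 * Nat.card (Subgroup.normalizer (Tr a b : Set (AutQ a b))) = p * (p - 1) := by
  have hlin : ∀ g ∈ AutQ a b, (∃ l, ∀ x, g (x + 1) = g x + l) →
      ∃ l, eta l = 1 ∧ ∀ x, g x = l * x + g 0 := by
    rintro g hg ⟨l, hl⟩
    have h1 : ∀ n : ℕ, g n = l * n + g 0 := by
      intro n
      induction n with
      | zero => simp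
      | succ n ih => push_cast; rw [hl, ih]; ring
    have hsurj : ∀ x : F, ∃ n : ℕ, (n : F) = x := by
      intro x
      have hbij : Function.Bijective (ZMod.castHom (dvd_refl p) F) := by
        rw [Fintype.bijective_iff_injective_and_card]
        exact ⟨(ZMod.castHom (dvd_refl p) F).injective, by rw [ZMod.card, hq]⟩
      obtain ⟨z, hz⟩ := hbij.2 x
      obtain ⟨n, rfl⟩ := ZMod.natCast_zmod_surjective z
      exact ⟨n, by rw [← hz]; simp⟩
    have h3 : ∀ x, g x = l * x + g 0 := by
      intro x
      obtain ⟨n, rfl⟩ := hsurj x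
      exact h1 n
    refine ⟨l, ?_, h3⟩
    have hl0 : l ≠ 0 := by
      rintro rfl
      have := h3 1
      rw [zero_mul, zero_add] at this
      exact one_ne_zero (g.injective this)
    rcases eta_cases l hl0 with h | h
    · exact h
    · exfalso
      have h4 := mem_AutQ.1 hg 0 1
      simp only [qmul_eq, sub_zero, zero_add, phi_eta_one a b eta_one, mul_one] at h4
      rw [h3 1, h3 a, mul_one, add_sub_cancel_right, phi_eta_neg a b h] at h4
      apply hab
      have : l * (a - b) = 0 := by linear_combination -h4
      exact sub_eq_zero.1 ((mul_eq_zero.1 this).resolve_left hl0)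
  have hmemN : ∀ g : AutQ a b, g ∈ Subgroup.normalizer (Tr a b : Set (AutQ a b)) ↔
      ∃ l, eta l = 1 ∧ ∀ x, (g : Equiv.Perm F) x = l * x + (g : Equiv.Perm F) 0 := by
    intro g
    constructor
    · intro hg
      apply hlin _ g.2
      have h1 : (⟨Equiv.addRight 1, translate_mem (fun r c hr => affPerm_mem a b hr c) 1⟩ : AutQ a b) ∈ Tr a b := ⟨1, rfl⟩
      obtain ⟨l, hl⟩ := (Subgroup.mem_normalizer_iff.1 hg _).1 h1
      refine ⟨l, fun x => ?_⟩
      have := congrArg (fun h : Equiv.Perm F => h ((g : Equiv.Perm F) x)) hl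
      simpa using this
    · rintro ⟨l, hl, h⟩
      have hl0 := ne_zero_of_eta hl
      have hginv : ∀ y, (g : Equiv.Perm F)⁻¹ y = l⁻¹ * (y - (g : Equiv.Perm F) 0) := by
        intro y
        apply (g : Equiv.Perm F).injective
        rw [h (l⁻¹ * _)]
        have e : (g : Equiv.Perm F) ((g : Equiv.Perm F)⁻¹ y) = y :=
          Equiv.apply_symm_apply (g : Equiv.Perm F) y
        rw [e]
        field_simp
        ring
      rw [Subgroup.mem_normalizer_iff]
      intro k
      constructor
      · rintro ⟨c, hc⟩
        refine ⟨l * c, ?_⟩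
        ext x
        simp only [Subgroup.coe_mul, Subgroup.coe_inv, hc, Equiv.Perm.mul_apply, hginv,
          Equiv.coe_addRight]
        rw [h]; field_simp; ring
      · rintro ⟨c, hc⟩
        refine ⟨l⁻¹ * c, ?_⟩
        ext x
        have := congrArg (fun h : Equiv.Perm F => h ((g : Equiv.Perm F) x)) hc
        simp only [Subgroup.coe_mul, Subgroup.coe_inv, Equiv.Perm.mul_apply, Equiv.coe_addRight] at this
        have e : (g : Equiv.Perm F)⁻¹ ((g : Equiv.Perm F) x) = x :=
          Equiv.symm_apply_apply (g : Equiv.Perm F) x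
        rw [e] at this
        rw [h, h x] at this
        simp only [Equiv.coe_addRight]
        field_simp
        linear_combination this
  have hcard : Nat.card (Subgroup.normalizer (Tr a b : Set (AutQ a b))) =
      Nat.card ({r : F // eta r = 1} × F) := by
    symm
    apply Nat.card_congr
    refine Equiv.ofBijective (fun z => ⟨⟨affPerm z.1.1 z.2 (ne_zero_of_eta z.1.2), affPerm_mem a b z.1.2 z.2⟩,
      (hmemN _).2 ⟨z.1.1, z.1.2, fun x => by simp [affPerm_apply]⟩⟩) ⟨?_, ?_⟩
    · rintro ⟨⟨r, hr⟩, c⟩ ⟨⟨s, hs⟩, d⟩ h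
      have h1 := congrArg (fun z : Subgroup.normalizer (Tr a b : Set (AutQ a b)) =>
        ((z : AutQ a b) : Equiv.Perm F)) h
      have e0 := congrArg (fun g : Equiv.Perm F => g 0) h1
      have e1 := congrArg (fun g : Equiv.Perm F => g 1) h1
      simp only [affPerm_apply, mul_zero, zero_add, mul_one] at e0 e1
      subst e0
      have := add_right_cancel e1
      subst this
      rfl
    · rintro ⟨⟨g, hg⟩, hgN⟩
      obtain ⟨l, hl, h⟩ := (hmemN _).1 hgN
      refine ⟨⟨⟨l, hl⟩, g 0⟩, ?_⟩
      ext1; ext1; ext x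
      exact (h x).symm
  rw [hcard, Nat.card_prod, Nat.card_eq_fintype_card, Nat.card_eq_fintype_card, hq,
    Fintype.card_subtype]
  have := card_R hodd (χ := 1) (by norm_num)
  rw [hq] at this
  have hp1 := hp.out.one_lt
  have e : 2 * (univ.filter (fun y : F => eta y = 1)).card = p - 1 := by omega
  rw [← mul_assoc, e, mul_comm]

theorem netto_prime (hodd : Odd (Fintype.card F)) {a b : F} (hv : ValidPair a b) (hab : a ≠ b)
    (h2 : TwoTransitive (AutQ a b : Set (Equiv.Perm F))) (hN : Netto a b) (p : ℕ)
    [hp : Fact p.Prime] [CharP F p] (hq : Fintype.card F = p) (hp7 : 7 < p) : False := by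
  have h1 := netto_stab_dvd hodd hN p hq hv
  have h3 := netto_card_group h2
  set s := Fintype.card (MulAction.stabilizer (AutQ a b) ((0 : F), (1 : F))) with hs
  have h4 := card_normTr hodd hab p hq
  have h5 := Sylow.card_normalizer_modEq_card (p := p) (n := 1) (H := Tr a b)
    (by rw [card_Tr, hq, pow_one])
  rw [Nat.card_eq_fintype_card (α := AutQ a b), ← h3, hq] at h5
  set N := Nat.card (Subgroup.normalizer (Tr a b : Set (AutQ a b))) with hN'
  have hsle := Nat.le_of_dvd (by omega) h1
  have h6 : p * (p - 1) ≡ p * (2 * ((p - 1) * s)) [MOD p * p] := by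
    rw [← h4]
    have := h5.mul_left 2
    rw [show 1 + 1 = 2 from rfl, pow_two] at this
    convert this using 1
    ring
  have h7 := Nat.ModEq.mul_left_cancel' hp.out.ne_zero h6
  have h8 : (p - 1) * 1 ≡ (p - 1) * (2 * s) [MOD p] := by
    convert h7 using 1 <;> ring
  have hcop : Nat.gcd p (p - 1) = 1 := by
    rw [← Nat.coprime_iff_gcd_eq_one]
    exact (Nat.coprime_self_sub_right hp.out.one_lt.le).2 (Nat.coprime_one_right p)
  have h9 := Nat.ModEq.cancel_left_of_coprime hcop h8
  have hspos : 0 < s := Fintype.card_pos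
  have h10 : p ∣ 2 * s - 1 := (Nat.modEq_iff_dvd' (by omega)).1 h9
  obtain ⟨k, hk⟩ := h10
  have hk2 : k < 2 := by
    by_contra hcon
    have : p * 2 ≤ p * k := Nat.mul_le_mul_left _ (by omega)
    omega
  have hk1 : k = 1 := by
    interval_cases k
    · omega
    · rfl
  subst hk1
  have h11 : s ∣ 4 := by
    have : s ∣ (p + 1) - (p - 3) := Nat.dvd_sub (Dvd.intro_left 2 (by omega)) h1
    rwa [show (p + 1) - (p - 3) = 4 by omega] at this
  have := Nat.le_of_dvd (by norm_num) h11
  omega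

theorem aut_affine (hodd : Odd (Fintype.card F)) (hq : 23 < Fintype.card F) {a b : F}
    (hv : ValidPair a b) (hab : a ≠ b)
    (h2 : TwoTransitive (AutQ a b : Set (Equiv.Perm F))) : ∀ g ∈ AutQ a b, IsAffinePerm g := by
  by_cases h4 : 4 ≤ (blk (AutQ a b) (0 : F) 1).card
  · exact large_affine h2 (fun r c hr => affPerm_mem a b hr c) h4
  have hN := netto_of_three hodd hv hab h2 (by omega)
  obtain ⟨p, hp⟩ := CharP.exists F
  have hpp : Fact p.Prime := ⟨CharP.char_is_prime F p⟩
  by_cases hqp : Fintype.card F = p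
  · exact (netto_prime hodd hv hab h2 hN p hqp (by omega)).elim
  · exact netto_affine hodd hN p hqp

set_option linter.unusedSectionVars false
set_option linter.unusedVariables false

/-! ### The autotopism group: orbits on cells -/

/-- the autotopism group -/
def AtpG (a b : F) : Subgroup (Equiv.Perm F × Equiv.Perm F × Equiv.Perm F) where
  carrier := {g | IsAutotopism a b g.1 g.2.1 g.2.2}
  one_mem' := by intro x y; rfl
  mul_mem' := by
    intro g h hg hh x y
    simp only [Prod.fst_mul, Prod.snd_mul, Equiv.Perm.mul_apply]
    rw [hg, hh]
  inv_mem' := by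
    intro g hg x y
    apply g.2.2.injective
    rw [← hg]; simp

theorem mem_AtpG {a b : F} {g : Equiv.Perm F × Equiv.Perm F × Equiv.Perm F} :
    g ∈ AtpG a b ↔ ∀ x y, qmul a b (g.1 x) (g.2.1 y) = g.2.2 (qmul a b x y) := Iff.rfl

theorem diag_mem {a b : F} {h : Equiv.Perm F} (hh : h ∈ AutQ a b) : (h, h, h) ∈ AtpG a b := hh

/-- the cell `(0, v)` lies in the orbit of `(0, 0)` -/
def Reach (a b v : F) : Prop := ∃ g ∈ AtpG a b, g.1 0 = 0 ∧ g.2.1 0 = v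

theorem reach_of {a b : F} {g : Equiv.Perm F × Equiv.Perm F × Equiv.Perm F} (hg : g ∈ AtpG a b)
    (x : F) : Reach a b (g.2.1 x - g.1 x) := by
  have h1 := diag_mem (affPerm_mem a b eta_one x)
  have h2 := diag_mem (affPerm_mem a b eta_one (-(g.1 x)))
  refine ⟨_, (AtpG a b).mul_mem h2 ((AtpG a b).mul_mem hg h1), ?_, ?_⟩
  · simp [affPerm_apply]
  · simp [affPerm_apply, sub_eq_add_neg]

theorem reach_iff {a b : F} {g : Equiv.Perm F × Equiv.Perm F × Equiv.Perm F} (hg : g ∈ AtpG a b)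
    (x y : F) : Reach a b (y - x) ↔ Reach a b (g.2.1 y - g.1 x) := by
  have key : ∀ (g : Equiv.Perm F × Equiv.Perm F × Equiv.Perm F) (hg : g ∈ AtpG a b) (x y : F),
      Reach a b (y - x) → Reach a b (g.2.1 y - g.1 x) := by
    rintro g hg x y ⟨h, hh, e1, e2⟩
    have h1 := diag_mem (affPerm_mem a b eta_one x)
    have := reach_of ((AtpG a b).mul_mem hg ((AtpG a b).mul_mem h1 hh)) 0
    simpa [affPerm_apply, e1, e2] using this
  constructor
  · exact key g hg x y
  · intro h
    have := key g⁻¹ ((AtpG a b).inv_mem hg) _ _ h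
    simpa using this

theorem reach_smul {a b v r : F} (hr : eta r = 1) (h : Reach a b v) : Reach a b (r * v) := by
  obtain ⟨g, hg, e1, e2⟩ := h
  refine ⟨_, (AtpG a b).mul_mem (diag_mem (affPerm_mem a b hr 0)) hg, ?_, ?_⟩
  · simp [affPerm_apply, e1]
  · simp [affPerm_apply, e2]

theorem reach_class {a b v w : F} (hv : v ≠ 0) (he : eta v = eta w) (h : Reach a b v) :
    Reach a b w := by
  have : Reach a b ((w / v) * v) := by
    apply reach_smul _ h
    rw [eta_div, he]
    apply eta_sq
    intro hw
    rw [hw, eta_zero, eta_eq_zero_iff] at he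
    exact hv he
  rwa [div_mul_cancel₀ _ hv] at this

theorem reach_zero (a b : F) : Reach a b 0 := ⟨1, (AtpG a b).one_mem, rfl, rfl⟩

theorem eta_le (x : F) : -1 ≤ eta x ∧ eta x ≤ 1 := by
  by_cases h : x = 0
  · rw [h, eta_zero]; omega
  · rcases eta_cases x h with h | h <;> omega

theorem sum_linear (hodd : Odd (Fintype.card F)) {k : F} (hk : k ≠ 0) :
    ∑ w : F, (1 + eta w) * eta (1 - k * w) = - eta (-k) := by
  have h1 : ∀ w : F, (1 + eta w) * eta (1 - k * w) =
      eta (1 - k * w) + eta (-k) * (eta w * eta (w + (-k⁻¹))) := by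
    intro w
    have : 1 - k * w = (-k) * (w + (-k⁻¹)) := by field_simp; ring
    have h2 : eta (1 - k * w) = eta (-k) * eta (w + (-k⁻¹)) := by rw [this, eta_mul]
    rw [h2]; ring
  rw [Finset.sum_congr rfl (fun w _ => h1 w), Finset.sum_add_distrib, ← Finset.mul_sum,
    eta_corr hodd (-k⁻¹) (neg_ne_zero.2 (inv_ne_zero hk))]
  have h3 : ∑ w : F, eta (1 - k * w) = ∑ w : F, eta w := by
    apply Fintype.sum_bijective (fun w => 1 - k * w)
    · constructor
      · intro x y h
        have : k * x = k * y := by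
          have h' : 1 - k * x = 1 - k * y := h
          linear_combination -h'
        exact mul_left_cancel₀ hk this
      · intro y
        exact ⟨(1 - y) / k, by field_simp; ring⟩
    · intro x; rfl
  rw [h3, eta_sum hodd]
  ring

theorem no_const (hodd : Odd (Fintype.card F)) (hq : 23 < Fintype.card F) {k : F} (hk : k ≠ 0)
    {ε : ℤ} (hε : ε * ε = 1)
    (h : ∀ w : F, eta w = 1 → w ≠ 1 → eta (1 - k * w) = 0 ∨ eta (1 - k * w) = ε) : False := by
  have hε' := chi_cases hε
  have hlow : ∀ w : F, (1 + eta w) - (if w = 1 then 4 else 0) - (if w = k⁻¹ then 2 else 0)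
      - (if w = 0 then 2 else 0) ≤ ε * ((1 + eta w) * eta (1 - k * w)) := by
    intro w
    by_cases hw0 : w = 0
    · subst hw0
      rw [eta_zero, mul_zero, sub_zero, eta_one]
      have h2 : (if (0 : F) = 0 then (2 : ℤ) else 0) = 2 := if_pos rfl
      rw [h2]
      split_ifs <;> rcases hε' with rfl | rfl <;> norm_num
    rcases eta_cases w hw0 with h1 | h1
    · rw [h1]
      by_cases hw1 : w = 1
      · have := eta_le (1 - k * w)
        rw [if_pos hw1, if_neg hw0]
        split_ifs <;> rcases hε' with rfl | rfl <;> omega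
      · rcases h w h1 hw1 with h2 | h2
        · have : w = k⁻¹ := by
            rw [eta_eq_zero_iff] at h2
            field_simp; linear_combination -h2
          rw [if_pos this, h2, if_neg hw1, if_neg hw0]; norm_num
        · rw [h2, if_neg hw1, if_neg hw0]
          have : ε * ((1 + 1) * ε) = 2 := by linear_combination 2 * hε
          rw [this]; split_ifs <;> norm_num
    · rw [h1, if_neg hw0]
      split_ifs <;> norm_num
  have hs := Finset.sum_le_sum (fun w (_ : w ∈ (univ : Finset F)) => hlow w)
  rw [← Finset.mul_sum, sum_linear hodd hk] at hs
  simp only [Finset.sum_sub_distrib, Finset.sum_add_distrib, eta_sum hodd, Finset.sum_ite_eq',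
    Finset.mem_univ, if_true, Finset.sum_const, Finset.card_univ] at hs
  have := eta_le (-k)
  simp at hs
  rcases hε' with rfl | rfl <;> omega

theorem case_two (hodd : Odd (Fintype.card F)) (hq : 23 < Fintype.card F) {a b : F}
    (hv : ValidPair a b) {v : F} (hv0 : v ≠ 0) (hr : Reach a b v)
    (hn : ∀ w : F, eta w = - eta v → ¬ Reach a b w) : False := by
  obtain ⟨ha0, hb0, ha1, hb1, heab, heab1⟩ := valid_facts hv
  set χ := eta v with hχ
  have hχ2 : χ * χ = 1 := eta_sq v hv0
  have hreach : ∀ y, y ≠ 0 → (Reach a b y ↔ eta y = χ) := by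
    intro y hy
    constructor
    · intro h
      rcases eta_cases y hy with h1 | h1 <;> rcases chi_cases hχ2 with h2 | h2
      · omega
      · exact absurd h (hn y (by omega))
      · exact absurd h (hn y (by omega))
      · omega
    · intro h
      exact reach_class hv0 (by rw [h]) hr
  obtain ⟨aχ, haχ, haχ1, hea1, hphi⟩ : ∃ aχ : F, aχ ≠ 0 ∧ aχ ≠ 1 ∧ eta (1 - aχ) = eta (1 - a) ∧
      ∀ u, eta u = χ → phi a b u = aχ * u := by
    rcases chi_cases hχ2 with h | h
    · exact ⟨a, ha0, ha1, rfl, fun u hu => phi_eta_one a b (by omega)⟩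
    · exact ⟨b, hb0, hb1, heab1.symm, fun u hu => phi_eta_neg a b (by omega)⟩
  obtain ⟨g, hg, e1, e2⟩ := hr
  -- surjectivity of phi
  have hsurj : Function.Surjective (phi a b) := Finite.surjective_of_injective (phi_inj hv)
  have hmain : ∃ ε : ℤ, ε * ε = 1 ∧ ∀ x : F, x ≠ 0 → eta (v - x) = χ →
      eta (qmul a b x v) = 0 ∨ eta (qmul a b x v) = ε := by
    -- base row
    have hbase : ∀ x : F, x ≠ 0 → eta (v - x) = χ → ∀ y, phi a b y = qmul a b x v →
        (Reach a b y ↔ eta (1 - a) * eta (-1 : F) = eta a) := by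
      intro x hx hvx y hy
      set x' := g.1.symm x with hx'
      have hgx' : g.1 x' = x := by simp [hx']
      have hx'0 : x' ≠ 0 := by
        intro h
        apply hx
        rw [← hgx', h, e1]
      set y' := g.2.1.symm y with hy'
      have hgy' : g.2.1 y' = y := by simp [hy']
      have hr1 : Reach a b (0 - x') := by
        rw [reach_iff hg, e2, hgx']
        have : v - x ≠ 0 := by
          intro h; rw [h, eta_zero] at hvx; rw [← hvx] at hχ2; omega
        rw [hreach _ this, hvx]
      have hr2 : eta (0 - x') = χ := (hreach _ (by simpa using hx'0)).1 hr1
      have hsym : qmul a b 0 y' = qmul a b x' 0 := by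
        apply g.2.2.injective
        rw [← mem_AtpG.1 hg, ← mem_AtpG.1 hg, e1, hgy', hgx', e2, ← hy, qmul_eq]
        simp
      rw [qmul_eq, qmul_eq, hphi _ hr2, sub_zero, zero_add] at hsym
      have hsym2 : phi a b y' = (1 - aχ) * (-1) * (0 - x') := by rw [hsym]; ring
      have hy'0 : y' ≠ 0 := by
        rintro h
        rw [h, phi_zero] at hsym2
        have : (1 - aχ) * x' = 0 := by linear_combination -hsym2
        rcases mul_eq_zero.1 this with h | h
        · exact haχ1 (by linear_combination -h)
        · exact hx'0 h
      have heta := congrArg eta hsym2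
      rw [eta_phi hv, eta_mul, eta_mul, hea1, hr2] at heta
      have hiff := reach_iff hg 0 y'
      rw [e1, sub_zero, sub_zero, hgy'] at hiff
      rw [← hiff, hreach _ hy'0]
      have k1 := eta_sq a ha0
      constructor
      · intro h
        rw [h] at heta
        linear_combination (-χ) * heta + (eta a - eta (1 - a) * eta (-1 : F)) * hχ2
      · intro h
        rw [h] at heta
        linear_combination eta a * heta + (χ - eta y') * k1
    by_cases hP : eta (1 - a) * eta (-1 : F) = eta a
    · refine ⟨eta a * χ, by linear_combination χ * χ * eta_sq a ha0 + hχ2, ?_⟩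
      intro x hx hvx
      obtain ⟨y, hy⟩ := hsurj (qmul a b x v)
      have h1 := (hbase x hx hvx y hy).2 hP
      rw [← hy, eta_phi hv]
      by_cases hy0 : y = 0
      · left; rw [hy0, eta_zero, mul_zero]
      · right; rw [(hreach y hy0).1 h1]
    · refine ⟨-(eta a * χ), by linear_combination χ * χ * eta_sq a ha0 + hχ2, ?_⟩
      intro x hx hvx
      obtain ⟨y, hy⟩ := hsurj (qmul a b x v)
      have h1 : ¬ Reach a b y := fun h => hP ((hbase x hx hvx y hy).1 h)
      rw [← hy, eta_phi hv]
      right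
      have hy0 : y ≠ 0 := by
        rintro rfl; exact h1 (reach_zero a b)
      rw [hreach y hy0] at h1
      have : eta y = -χ := by
        rcases eta_cases y hy0 with h3 | h3 <;> rcases chi_cases hχ2 with h4 | h4 <;> omega
      rw [this]; ring
  obtain ⟨ε, hε, hm⟩ := hmain
  apply no_const hodd hq (k := 1 - aχ) (sub_ne_zero.2 haχ1.symm) (ε := χ * ε)
    (by linear_combination ε * ε * hχ2 + hε)
  intro w hw hw1
  have hx : v - v * w ≠ 0 := by
    intro h
    have : v * (1 - w) = 0 := by linear_combination h
    rcases mul_eq_zero.1 this with h | h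
    · exact hv0 h
    · exact hw1 (by linear_combination -h)
  have hvx : eta (v - (v - v * w)) = χ := by
    rw [sub_sub_cancel, eta_mul, hw, mul_one]
  have := hm _ hx hvx
  rw [qmul_eq, hphi _ hvx, show v - v * w + aχ * (v - (v - v * w)) = v * (1 - (1 - aχ) * w) by ring,
    eta_mul] at this
  rcases this with h | h
  · left
    linear_combination χ * h - eta (1 - (1 - aχ) * w) * hχ2
  · right
    linear_combination χ * h - eta (1 - (1 - aχ) * w) * hχ2

/-- either all autotopisms are automorphisms, or the group is transitive on cells -/
theorem atp_dichotomy (hodd : Odd (Fintype.card F)) (hq : 23 < Fintype.card F) {a b : F}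
    (hv : ValidPair a b) (hnd : ¬ ∀ g ∈ AtpG a b, g.1 = g.2.1 ∧ g.1 = g.2.2) :
    ∀ x y : F, ∃ g ∈ AtpG a b, g.1 0 = x ∧ g.2.1 0 = y := by
  have hex : ∃ v : F, v ≠ 0 ∧ Reach a b v := by
    by_contra hcon
    apply hnd
    intro g hg
    have h1 : g.1 = g.2.1 := by
      ext x
      by_contra hx
      exact hcon ⟨_, sub_ne_zero.2 (Ne.symm hx), reach_of hg x⟩
    refine ⟨h1, ?_⟩
    ext x
    have := mem_AtpG.1 hg x x
    rw [← h1, qmul_self, qmul_self] at this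
    exact this
  obtain ⟨v, hv0, hr⟩ := hex
  have hall : ∀ y : F, Reach a b y := by
    have : ∃ w : F, eta w = - eta v ∧ Reach a b w := by
      by_contra hcon
      exact case_two hodd hq hv hv0 hr (fun w hw h => hcon ⟨w, hw, h⟩)
    obtain ⟨w, hw, hrw⟩ := this
    intro y
    by_cases hy : y = 0
    · rw [hy]; exact reach_zero a b
    have hw0 : w ≠ 0 := by
      intro h
      rw [h, eta_zero] at hw
      apply hv0
      rw [← eta_eq_zero_iff]; omega
    rcases eta_cases y hy with h1 | h1 <;> rcases eta_cases v hv0 with h2 | h2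
    · exact reach_class hv0 (by omega) hr
    · exact reach_class hw0 (by omega) hrw
    · exact reach_class hw0 (by omega) hrw
    · exact reach_class hv0 (by omega) hr
  intro x y
  obtain ⟨g, hg, e1, e2⟩ := hall (y - x)
  refine ⟨_, (AtpG a b).mul_mem (diag_mem (affPerm_mem a b eta_one x)) hg, ?_, ?_⟩
  · simp [affPerm_apply, e1]
  · simp [affPerm_apply, e2]

set_option linter.unusedSectionVars false
set_option linter.unusedVariables false

/-! ### A transitive autotopism group: Sylow subgroups and central translations -/

theorem sylow_trans {G X : Type*} [Group G] [Finite G] [MulAction G X] [Finite X]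
    (p k : ℕ) [hp : Fact p.Prime] (hX : Nat.card X = p ^ k) [MulAction.IsPretransitive G X]
    (P : Sylow p G) (x y : X) : ∃ g ∈ P, g • x = y := by
  have h1 : (MulAction.stabilizer G x).index = p ^ k := by
    rw [MulAction.index_stabilizer_of_transitive, hX]
  have h2 : (MulAction.stabilizer G x ⊓ (P : Subgroup G)).index =
      (MulAction.stabilizer G x).relIndex P * (P : Subgroup G).index := by
    rw [← Subgroup.relIndex_mul_index (inf_le_right : MulAction.stabilizer G x ⊓ (P : Subgroup G) ≤ P),
      Subgroup.inf_relIndex_right]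
  have h3 : p ^ k ∣ (MulAction.stabilizer G x).relIndex P * (P : Subgroup G).index := by
    rw [← h2, ← h1]
    exact Subgroup.index_dvd_of_le inf_le_left
  have h4 : Nat.Coprime (p ^ k) (P : Subgroup G).index :=
    Nat.Coprime.pow_left k ((hp.out.coprime_iff_not_dvd).2 P.not_dvd_index)
  have h5 := h4.dvd_of_dvd_mul_right h3
  have h6 : (MulAction.stabilizer G x).relIndex P = (MulAction.orbit P x).ncard := by
    rw [← MulAction.index_stabilizer]
    rfl
  rw [h6] at h5
  have h7 : (MulAction.orbit P x).ncard ≠ 0 :=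
    (Set.ncard_pos (Set.toFinite _)).2 ⟨x, MulAction.mem_orbit_self x⟩ |>.ne'
  have h8 := Nat.le_of_dvd (Nat.pos_of_ne_zero h7) h5
  have h9 : MulAction.orbit P x = Set.univ := by
    apply Set.eq_of_subset_of_ncard_le (Set.subset_univ _)
    rw [Set.ncard_univ, hX]; exact h8
  have : y ∈ MulAction.orbit P x := by rw [h9]; trivial
  obtain ⟨g, hg⟩ := this
  exact ⟨g, g.2, hg⟩

/-- the action on cells -/
@[reducible] def cellAct (a b : F) : MulAction (AtpG a b) (F × F) where
  smul g z := ((g : Equiv.Perm F × Equiv.Perm F × Equiv.Perm F).1 z.1,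
    (g : Equiv.Perm F × Equiv.Perm F × Equiv.Perm F).2.1 z.2)
  one_smul := fun z => rfl
  mul_smul := fun g h z => rfl

/-- the diagonal translations -/
def trHom (a b : F) : Multiplicative F →* AtpG a b where
  toFun c := ⟨(Equiv.addRight c.toAdd, Equiv.addRight c.toAdd, Equiv.addRight c.toAdd),
    diag_mem (translate_mem (fun r c hr => affPerm_mem a b hr c) _)⟩
  map_one' := by
    ext x <;> simp
  map_mul' := by
    intro c d
    ext x <;> simp [add_comm, add_left_comm]

theorem central_step (hodd : Odd (Fintype.card F)) (hq : 23 < Fintype.card F) {a b : F}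
    (hv : ValidPair a b) (hab : a ≠ b)
    (htr : ∀ x y : F, ∃ g ∈ AtpG a b, g.1 0 = x ∧ g.2.1 0 = y) :
    ∃ c : F, c ≠ 0 ∧ ∀ y : F, ∃ β γ : Equiv.Perm F, β 0 = y ∧
      (∀ u, phi a b (β u) = γ (phi a b u)) ∧ (∀ x, β (x + c) = β x + c) ∧
      (∀ x, γ (x + c) = γ x + c) := by
  obtain ⟨p, hpc⟩ := CharP.exists F
  have hp : Fact p.Prime := ⟨CharP.char_is_prime F p⟩
  obtain ⟨n, hprime, hn⟩ := FiniteField.card F p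
  letI := cellAct a b
  have hsm : ∀ (g : AtpG a b) (z : F × F), g • z =
    ((g : Equiv.Perm F × Equiv.Perm F × Equiv.Perm F).1 z.1,
    (g : Equiv.Perm F × Equiv.Perm F × Equiv.Perm F).2.1 z.2) := fun _ _ => rfl
  have hT : IsPGroup p (trHom a b).range := by
    have hM : IsPGroup p (Multiplicative F) := by
      intro c
      refine ⟨1, ?_⟩
      apply Multiplicative.toAdd.injective
      rw [pow_one, toAdd_pow, nsmul_eq_mul, CharP.cast_eq_zero, zero_mul]; rfl
    exact hM.of_surjective (trHom a b).rangeRestrict (trHom a b).rangeRestrict_surjective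
  obtain ⟨P, hTP⟩ := hT.exists_le_sylow
  have hpt : MulAction.IsPretransitive (AtpG a b) (F × F) := by
    rw [MulAction.isPretransitive_iff_base ((0 : F), (0 : F))]
    intro z
    obtain ⟨g, hg, e1, e2⟩ := htr z.1 z.2
    exact ⟨⟨g, hg⟩, Prod.ext e1 e2⟩
  have hPt := sylow_trans (X := F × F) p (n + n)
    (by rw [Nat.card_prod, Nat.card_eq_fintype_card, hn, pow_add]) P
  have hTmem : ∀ c : F, trHom a b (Multiplicative.ofAdd c) ∈ P := fun c => hTP ⟨_, rfl⟩
  have hPnt : Nontrivial P := by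
    obtain ⟨g, hg, e⟩ := hPt (0, 0) (0, 1)
    refine ⟨⟨⟨g, hg⟩, 1, ?_⟩⟩
    intro h
    have h1 : g = 1 := congrArg Subtype.val h
    rw [h1, one_smul] at e
    exact zero_ne_one (congrArg Prod.snd e)
  have hcn := IsPGroup.center_nontrivial P.isPGroup'
  obtain ⟨z, hz1⟩ := exists_ne (1 : Subgroup.center P)
  have hzc : ∀ g ∈ P, g * ((z : P) : AtpG a b) = ((z : P) : AtpG a b) * g := by
    intro g hg
    have := Subgroup.mem_center_iff.1 z.2 ⟨g, hg⟩
    exact congrArg Subtype.val this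
  set ζ : AtpG a b := ((z : P) : AtpG a b) with hζ
  have hζ1 : ζ ≠ 1 := by
    intro h
    apply hz1
    ext1; ext1; exact h
  obtain ⟨⟨α, β, γ⟩, hmem⟩ := ζ
  have hcomm : ∀ t : F, (∀ x, α (x + t) = α x + t) ∧ (∀ x, β (x + t) = β x + t) ∧
      (∀ x, γ (x + t) = γ x + t) := by
    intro t
    have := congrArg Subtype.val (hzc _ (hTmem t))
    refine ⟨fun x => ?_, fun x => ?_, fun x => ?_⟩
    · exact (congrArg (fun g : Equiv.Perm F × Equiv.Perm F × Equiv.Perm F => g.1 x) this).symm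
    · exact (congrArg (fun g : Equiv.Perm F × Equiv.Perm F × Equiv.Perm F => g.2.1 x) this).symm
    · exact (congrArg (fun g : Equiv.Perm F × Equiv.Perm F × Equiv.Perm F => g.2.2 x) this).symm
  have hα : ∀ x, α x = x + α 0 := fun x => by have := (hcomm x).1 0; rw [zero_add] at this; rw [this, add_comm]
  have hβ : ∀ x, β x = x + β 0 := fun x => by have := (hcomm x).2.1 0; rw [zero_add] at this; rw [this, add_comm]
  have hγ : ∀ x, γ x = x + γ 0 := fun x => by have := (hcomm x).2.2 0; rw [zero_add] at this; rw [this, add_comm]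
  have hphi : ∀ u, phi a b (u + (β 0 - α 0)) = phi a b u + (γ 0 - α 0) := by
    intro u
    have := mem_AtpG.1 hmem 0 u
    simp only [qmul_eq] at this
    rw [hβ u, hγ (0 + _), sub_zero, zero_add] at this
    rw [show u + (β 0 - α 0) = u + β 0 - α 0 by ring]
    linear_combination this
  have heq : β 0 - α 0 = 0 := by
    by_contra he
    obtain ⟨y1, hy1, hy1'⟩ := exists_S hodd hq (χ := 1) (by norm_num) _ he
    obtain ⟨y2, hy2, hy2'⟩ := exists_S hodd hq (χ := -1) (by norm_num) _ he
    have k1 := hphi y1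
    have k2 := hphi y2
    rw [phi_eta_one a b hy1, phi_eta_one a b hy1'] at k1
    rw [phi_eta_neg a b hy2, phi_eta_neg a b hy2'] at k2
    have : (a - b) * (β 0 - α 0) = 0 := by linear_combination k1 - k2
    rcases mul_eq_zero.1 this with h | h
    · exact hab (sub_eq_zero.1 h)
    · exact he h
  have hγα : γ 0 = α 0 := by
    have := hphi 0
    rw [heq, zero_add, phi_zero] at this
    linear_combination -this
  have hβα : β 0 = α 0 := sub_eq_zero.1 heq
  refine ⟨α 0, ?_, ?_⟩
  · intro h0
    apply hζ1
    ext x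
    · show α x = x
      rw [hα, h0, add_zero]
    · show β x = x
      rw [hβ, hβα, h0, add_zero]
    · show γ x = x
      rw [hγ, hγα, h0, add_zero]
  · intro y
    obtain ⟨g, hg, e⟩ := hPt (0, 0) (0, y)
    obtain ⟨⟨α', β', γ'⟩, hg'⟩ := g
    have e1 : α' 0 = 0 := congrArg Prod.fst e
    have e2 : β' 0 = y := congrArg Prod.snd e
    have hc := congrArg Subtype.val (hzc _ hg)
    refine ⟨β', γ', e2, ?_, ?_, ?_⟩
    · intro u
      have := mem_AtpG.1 hg' 0 u
      simp only [qmul_eq, e1, sub_zero, zero_add] at this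
      exact this
    · intro x
      have : β' (β x) = β (β' x) :=
        congrArg (fun g : Equiv.Perm F × Equiv.Perm F × Equiv.Perm F => g.2.1 x) hc
      rwa [hβ x, hβ (β' x), hβα] at this
    · intro x
      have : γ' (γ x) = γ (γ' x) :=
        congrArg (fun g : Equiv.Perm F × Equiv.Perm F × Equiv.Perm F => g.2.2 x) hc
      rwa [hγ x, hγ (γ' x), hγα] at this

set_option linter.unusedSectionVars false
set_option linter.unusedVariables false

/-! ### The two semiregular permutations -/

/-- permutations commuting with the central translation on both sides -/
def CenB (a b c : F) (β : Equiv.Perm F) : Prop :=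
  ∃ γ : Equiv.Perm F, (∀ u, phi a b (β u) = γ (phi a b u)) ∧ (∀ x, β (x + c) = β x + c) ∧
      (∀ x, γ (x + c) = γ x + c)

/-- the conclusion of `central_step` -/
def Cen (a b c : F) : Prop := ∀ y : F, ∃ β : Equiv.Perm F, CenB a b c β ∧ β 0 = y

/-- maps commuting with every `CenB` permutation -/
def Equivar (a b c : F) (f : F → F) : Prop := ∀ β, CenB a b c β → ∀ x, f (β x) = β (f x)

theorem Cen.rigid {a b c : F} (hC : Cen a b c) {f g : F → F} (hf : Equivar a b c f)
    (hg : Equivar a b c g) {x : F} (hx : f x = g x) (y : F) : f y = g y := by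
  obtain ⟨β, hβ, rfl⟩ := hC x
  obtain ⟨β', hβ', rfl⟩ := hC y
  rw [hf β hβ, hg β hβ] at hx
  rw [hf β' hβ', hg β' hβ', β.injective hx]

theorem Equivar.comp {a b c : F} {f g : F → F} (hf : Equivar a b c f) (hg : Equivar a b c g) :
    Equivar a b c (fun x => f (g x)) := by
  intro β hβ x
  show f (g (β x)) = β (f (g x))
  rw [hg β hβ, hf β hβ]

theorem equivar_id (a b c : F) : Equivar a b c (fun x => x) := fun _ _ _ => rfl

theorem equivar_nat (a b c : F) (k : ℕ) : Equivar a b c (fun x => x + k * c) := by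
  induction k with
  | zero => intro β hβ x; simp
  | succ k ih =>
    intro β hβ x
    have h1 := ih β hβ x
    obtain ⟨γ, _, h2, _⟩ := hβ
    simp only at h1 ⊢
    have h3 := h2 (x + k * c)
    rw [← h1] at h3
    push_cast
    rw [show x + (k + 1) * c = x + k * c + c by ring, h3]
    ring

theorem exists_M {a b : F} (hv : ValidPair a b) (c : F) :
    ∃ M : Equiv.Perm F, ∀ y, phi a b (M y) = phi a b y + c := by
  have hbij : Function.Bijective (phi a b) := Finite.injective_iff_bijective.1 (phi_inj hv)
  set e := Equiv.ofBijective (phi a b) hbij with he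
  refine ⟨(e.trans (Equiv.addRight c)).trans e.symm, fun y => ?_⟩
  show e (e.symm (e y + c)) = e y + c
  simp

theorem equivar_M {a b c : F} (hv : ValidPair a b) {M : Equiv.Perm F}
    (hM : ∀ y, phi a b (M y) = phi a b y + c) : Equivar a b c M := by
  rintro β ⟨γ, h1, h2, h3⟩ x
  apply phi_inj hv
  rw [hM, h1, h1, hM, h3]

theorem Equivar.inv {a b c : F} {f : Equiv.Perm F} (hf : Equivar a b c f) :
    Equivar a b c (f⁻¹ : Equiv.Perm F) := by
  intro β hβ x
  apply f.injective
  rw [hf β hβ]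
  simp

/-- the coefficient attached to a sign -/
def ac (a b : F) (χ : ℤ) : F := if χ = 1 then a else b

theorem ac_spec {a b : F} (hv : ValidPair a b) (hab : a ≠ b) {χ : ℤ} (hχ : χ * χ = 1) :
    ac a b χ ≠ 0 ∧ eta (ac a b χ) = eta a ∧ (∀ u, inX χ u ↔ phi a b u = ac a b χ * u) ∧
    ∀ u, ¬ inX χ u → phi a b u = ac a b (-χ) * u := by
  obtain ⟨ha0, hb0, ha1, hb1, heab, heab1⟩ := valid_facts hv
  have hne : ∀ u : F, u ≠ 0 → a * u ≠ b * u := fun u hu h => hab (mul_right_cancel₀ hu h)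
  have e1 : ac a b 1 = a := if_pos rfl
  have e2 : ac a b (-1) = b := if_neg (by norm_num)
  rcases chi_cases hχ with rfl | rfl
  · rw [e1, e2]
    refine ⟨ha0, rfl, ?_, ?_⟩
    · intro u
      by_cases hu : u = 0
      · subst hu; simp [inX, phi_zero]
      rcases eta_cases u hu with h | h
      · simp [inX, h, phi_eta_one a b h]
      · simp [inX, h, phi_eta_neg a b h, hu, hab.symm]
    · intro u hu
      simp only [inX, not_or] at hu
      rcases eta_cases u hu.1 with h | h
      · exact absurd h hu.2
      · exact phi_eta_neg a b h
  · rw [neg_neg, e1, e2]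
    refine ⟨hb0, heab.symm, ?_, ?_⟩
    · intro u
      by_cases hu : u = 0
      · subst hu; simp [inX, phi_zero]
      rcases eta_cases u hu with h | h
      · simp [inX, h, phi_eta_one a b h, hu, hab]
      · simp [inX, h, phi_eta_neg a b h]
    · intro u hu
      simp only [inX, not_or] at hu
      rcases eta_cases u hu.1 with h | h
      · exact phi_eta_one a b h
      · exact absurd h hu.2

theorem keyM {a b c : F} (hv : ValidPair a b) (hab : a ≠ b) {M : Equiv.Perm F} (hc : c ≠ 0)
    (hM : ∀ y, phi a b (M y) = phi a b y + c) {χ : ℤ} (hχ : χ * χ = 1) (y : F) :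
    M y = y + c / ac a b χ ↔ inX χ y ∧ inX χ (y + c / ac a b χ) := by
  obtain ⟨h0, _, h1, h2⟩ := ac_spec hv hab hχ
  set A := ac a b χ with hA
  set B := ac a b (-χ) with hB
  have hAB : A ≠ B := by
    rw [hA, hB]
    unfold ac
    rcases chi_cases hχ with rfl | rfl
    · simpa using hab
    · simpa using hab.symm
  have hcA : A * (c / A) = c := by field_simp
  constructor
  · intro h
    have h3 := hM y
    rw [h] at h3
    by_cases hy : inX χ y
    · refine ⟨hy, (h1 _).2 ?_⟩
      rw [h3, (h1 y).1 hy]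
      linear_combination -hcA
    · exfalso
      rw [h2 y hy] at h3
      by_cases hy' : inX χ (y + c / A)
      · rw [(h1 _).1 hy'] at h3
        have : (A - B) * y = 0 := by linear_combination h3 - hcA
        rcases mul_eq_zero.1 this with h | h
        · exact hAB (sub_eq_zero.1 h)
        · exact hy (Or.inl h)
      · rw [h2 _ hy'] at h3
        have : (A - B) * (c / A) = 0 := by linear_combination hcA - h3
        rcases mul_eq_zero.1 this with h | h
        · exact hAB (sub_eq_zero.1 h)
        · exact div_ne_zero hc h0 h
  · rintro ⟨hy, hy'⟩
    apply phi_inj hv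
    rw [hM, (h1 _).1 hy, (h1 _).1 hy']
    linear_combination -hcA

theorem inX_pos {χ : ℤ} (hχ : χ * χ = 1) {y z : F} (h1 : inX χ y) (h2 : inX χ z) :
    0 ≤ eta y * eta z := by
  rcases h1 with rfl | h1
  · simp [eta_zero]
  rcases h2 with rfl | h2
  · simp [eta_zero]
  rw [h1, h2, hχ]; norm_num

theorem exists_inX {y z : F} (h : 0 ≤ eta y * eta z) : ∃ χ : ℤ, χ * χ = 1 ∧ inX χ y ∧ inX χ z := by
  by_cases hy : y = 0
  · by_cases hz : z = 0
    · exact ⟨1, by norm_num, Or.inl hy, Or.inl hz⟩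
    · exact ⟨eta z, eta_sq z hz, Or.inl hy, Or.inr rfl⟩
  · refine ⟨eta y, eta_sq y hy, Or.inr rfl, ?_⟩
    by_cases hz : z = 0
    · exact Or.inl hz
    right
    rcases eta_cases y hy with h1 | h1 <;> rcases eta_cases z hz with h2 | h2 <;>
      first
        | (rw [h1, h2] at h; omega)
        | rw [h1, h2]

theorem no_abelian (hodd : Odd (Fintype.card F)) {a b c : F} (hv : ValidPair a b) (hab : a ≠ b)
    (hc : c ≠ 0) {M : Equiv.Perm F} (hM : ∀ y, phi a b (M y) = phi a b y + c)
    (hcomm : ∀ y, M (y + c) = M y + c) : False := by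
  obtain ⟨p, hpc⟩ := CharP.exists F
  have hp : Fact p.Prime := ⟨CharP.char_is_prime F p⟩
  obtain ⟨ha0, hb0, ha1, hb1, heab, heab1⟩ := valid_facts hv
  have hWcl : ∀ χ : ℤ, χ * χ = 1 → ∀ y, (inX χ y ∧ inX χ (y + c / ac a b χ)) →
      (inX χ (y + c) ∧ inX χ (y + c + c / ac a b χ)) := by
    intro χ hχ y hy
    rw [← keyM hv hab hc hM hχ] at hy ⊢
    rw [hcomm, hy]; ring
  have hsub : ∀ χ : ℤ, χ * χ = 1 →
      univ.filter (fun y : F => inX χ y ∧ inX χ (y + c / ac a b χ)) ⊆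
      univ.filter (fun y : F => inX χ y ∧ inX χ (y + c)) := by
    intro χ hχ y hy
    simp only [Finset.mem_filter, Finset.mem_univ, true_and] at hy ⊢
    exact ⟨hy.1, (hWcl χ hχ y hy).1⟩
  have hcW : ∀ χ : ℤ, χ * χ = 1 →
      4 * ((univ.filter (fun y : F => inX χ y ∧ inX χ (y + c / ac a b χ))).card : ℤ) =
      (Fintype.card F : ℤ) + 1 + χ * (eta c * eta a) + χ * (eta (-1 : F) * (eta c * eta a)) := by
    intro χ hχ
    obtain ⟨h0, h1, _⟩ := ac_spec hv hab hχ
    rw [count_X hodd hχ _ (div_ne_zero hc h0), eta_neg (c / _), eta_div, h1]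
  have hcY : ∀ χ : ℤ, χ * χ = 1 →
      4 * ((univ.filter (fun y : F => inX χ y ∧ inX χ (y + c))).card : ℤ) =
      (Fintype.card F : ℤ) + 1 + χ * eta c + χ * (eta (-1 : F) * eta c) := by
    intro χ hχ
    rw [count_X hodd hχ _ hc, eta_neg c]
  have hχ := eta_sq c hc
  have hm1 : (-1 : F) ≠ 0 := neg_ne_zero.2 one_ne_zero
  -- if W = Y then Y is closed
  have hYcl : ∀ χ : ℤ, χ * χ = 1 →
      (univ.filter (fun y : F => inX χ y ∧ inX χ (y + c))).card ≤
      (univ.filter (fun y : F => inX χ y ∧ inX χ (y + c / ac a b χ))).card →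
      ∀ y, inX χ y → inX χ (y + c) → ∀ k : ℕ, inX χ (y + k * c) := by
    intro χ hχ hle y hy hy' k
    have heq := Finset.eq_of_subset_of_card_le (hsub χ hχ) hle
    have hmem : y ∈ univ.filter (fun y : F => inX χ y ∧ inX χ (y + c / ac a b χ)) := by
      rw [heq]; simp [hy, hy']
    simp only [Finset.mem_filter, Finset.mem_univ, true_and] at hmem
    have : inX χ (y + k * c) ∧ inX χ (y + k * c + c / ac a b χ) := by
      induction k with
      | zero => simpa using hmem
      | succ k ih =>
        have := hWcl χ hχ _ ih
        push_cast
        rw [show y + ((k : F) + 1) * c = y + k * c + c by ring]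
        exact this
    exact this.1
  rcases eta_cases (-1 : F) hm1 with hneg | hneg
  · rcases eta_cases a ha0 with hea | hea
    · -- both colours closed
      have hcl : ∀ χ : ℤ, χ * χ = 1 → ∀ y, inX χ y → inX χ (y + c) → ∀ k : ℕ, inX χ (y + k * c) := by
        intro χ hχ
        apply hYcl χ hχ
        have h1 := hcW χ hχ
        have h2 := hcY χ hχ
        rw [hea, mul_one] at h1
        omega
      have hpos : ∀ y : F, 0 ≤ eta y * eta (y + c) := by
        intro y
        by_contra hneg'
        push Not at hneg'
        have hy0 : y ≠ 0 := by
          rintro rfl; rw [eta_zero, zero_mul] at hneg'; omega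
        have hk : ∃ k : ℕ, 0 ≤ eta (y + k * c) * eta (y + (k + 1 : ℕ) * c) := by
          by_contra hcon
          push Not at hcon
          have hstep : ∀ k : ℕ, eta (y + (k + 1 : ℕ) * c) = - eta (y + k * c) := by
            intro k
            have := hcon k
            have n1 : y + (k + 1 : ℕ) * c ≠ 0 := by
              intro h; rw [h, eta_zero, mul_zero] at this; omega
            have n2 : y + k * c ≠ 0 := by
              intro h; rw [h, eta_zero, zero_mul] at this; omega
            rcases eta_cases _ n1 with h1 | h1 <;> rcases eta_cases _ n2 with h2 | h2 <;>
              first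
                | (exfalso; rw [h1, h2] at this; omega)
                | (rw [h1, h2]; done)
                | (rw [h1, h2]; norm_num; done)
          have hpw : ∀ k : ℕ, eta (y + k * c) = (-1) ^ k * eta y := by
            intro k
            induction k with
            | zero => simp
            | succ k ih => rw [hstep, ih, pow_succ]; ring
          have h1 := hpw p
          have hpodd : Odd p := by
            rcases hp.out.eq_two_or_odd' with h | h
            · exfalso
              subst h
              exact two_ne_zeroF hodd (by have := CharP.cast_eq_zero F 2; simpa using this)
            · exact h
          rw [CharP.cast_eq_zero, zero_mul, add_zero, hpodd.neg_one_pow] at h1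
          have : eta y = 0 := by omega
          rw [eta_eq_zero_iff] at this
          exact hy0 this
        obtain ⟨k, hk⟩ := hk
        obtain ⟨χ, hχ', k1, k2⟩ := exists_inX hk
        have hcl' := hcl χ hχ' (y + k * c) k1 (by
          rw [show y + k * c + c = y + (k + 1 : ℕ) * c by push_cast; ring]; exact k2)
        have hp0 : (p : F) = 0 := CharP.cast_eq_zero F p
        have l1 := hcl' ((p - 1) * k)
        have l2 := hcl' ((p - 1) * k + 1)
        have hcast : (((p - 1) * k : ℕ) : F) = - k := by
          rw [Nat.cast_mul, Nat.cast_sub hp.out.one_lt.le, hp0]; simp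
        rw [hcast, show y + k * c + -(k : F) * c = y by ring] at l1
        rw [Nat.cast_add, hcast, Nat.cast_one, show y + k * c + (-(k : F) + 1) * c = y + c by ring] at l2
        have := inX_pos hχ' l1 l2
        omega
      have := Finset.sum_nonneg (fun y (_ : y ∈ (univ : Finset F)) => hpos y)
      rw [eta_corr hodd c hc] at this
      omega
    · have h1 := hcW _ hχ
      have h2 := hcY _ hχ
      rw [hea, hneg] at h1
      rw [hneg] at h2
      have h3 : (univ.filter (fun y : F => inX (eta c) y ∧ inX (eta c) (y + c))).card =
          (univ.filter (fun y : F => inX (eta c) y ∧ inX (eta c) (y + c / ac a b (eta c)))).card + 1 := by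
        have : eta c * (eta c * -1) = -1 := by linear_combination -hχ
        have h5 : eta c * (1 * (eta c * -1)) = -1 := by linear_combination -hχ
        have h6 : eta c * (1 * eta c) = 1 := by linear_combination hχ
        rw [this, h5] at h1
        rw [hχ, h6] at h2
        omega
      obtain ⟨h0, hac, _⟩ := ac_spec hv hab hχ
      have hn0 : ¬ inX (eta c) (c / ac a b (eta c)) := by
        rintro (h | h)
        · exact div_ne_zero hc h0 h
        · rw [eta_div, hac, hea] at h
          rcases eta_cases c hc with h4 | h4 <;> omega
      have hins : insert 0 (insert (-c)
          (univ.filter (fun y : F => inX (eta c) y ∧ inX (eta c) (y + c / ac a b (eta c))))) ⊆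
          univ.filter (fun y : F => inX (eta c) y ∧ inX (eta c) (y + c)) := by
        intro y hy
        rw [Finset.mem_insert, Finset.mem_insert] at hy
        rcases hy with rfl | rfl | hy
        · rw [Finset.mem_filter]
          exact ⟨mem_univ _, Or.inl rfl, Or.inr (by rw [zero_add])⟩
        · rw [Finset.mem_filter]
          exact ⟨mem_univ _, Or.inr (by rw [eta_neg c, hneg, one_mul]), Or.inl (neg_add_cancel c)⟩
        · exact hsub _ hχ hy
      have h4 := Finset.card_le_card hins
      rw [Finset.card_insert_of_notMem, Finset.card_insert_of_notMem] at h4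
      · omega
      · intro h
        simp only [Finset.mem_filter, Finset.mem_univ, true_and] at h
        have := (hWcl _ hχ _ h).2
        rw [neg_add_cancel, zero_add] at this
        exact hn0 this
      · intro h
        rw [Finset.mem_insert] at h
        rcases h with h | h
        · exact hc (neg_eq_zero.1 h.symm)
        · simp only [Finset.mem_filter, Finset.mem_univ, true_and, zero_add] at h
          exact hn0 h.2
  · have h1 := hcW _ hχ
    have h2 := hcY _ hχ
    rw [hneg] at h1 h2
    have hcl := hYcl _ hχ (by
      have e1 : eta c * (-1 * (eta c * eta a)) = - (eta c * (eta c * eta a)) := by ring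
      have e2 : eta c * (-1 * eta c) = - (eta c * eta c) := by ring
      rw [e1] at h1; rw [e2] at h2
      omega) 0 (Or.inl rfl) (Or.inr (by rw [zero_add])) (p - 1)
    have hcast : ((p - 1 : ℕ) : F) = -1 := by
      rw [Nat.cast_sub hp.out.one_lt.le, CharP.cast_eq_zero]; simp
    rw [hcast, zero_add, neg_one_mul] at hcl
    rcases hcl with h | h
    · exact hc (neg_eq_zero.1 h)
    · rw [eta_neg c, hneg] at h
      rcases eta_cases c hc with h4 | h4 <;> omega

set_option linter.unusedSectionVars false
set_option linter.unusedVariables false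

/-- the group of permutations equivariant together with their negation-conjugates -/
def EqG (a b c : F) : Subgroup (Equiv.Perm F) where
  carrier := {e | Equivar a b c e ∧ Equivar a b c (fun x => - e (-x))}
  one_mem' := by
    refine ⟨fun _ _ _ => rfl, ?_⟩
    intro β hβ x
    simp
  mul_mem' := by
    intro e f he hf
    refine ⟨fun β hβ x => ?_, fun β hβ x => ?_⟩
    · simp only [Equiv.Perm.mul_apply]
      rw [hf.1 β hβ, he.1 β hβ]
    · simp only [Equiv.Perm.mul_apply]
      have h1 := hf.2 β hβ x
      have h2 := he.2 β hβ (- f (-x))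
      simp only at h1 h2
      rw [← h1] at h2
      simp only [neg_neg] at h2
      exact h2
  inv_mem' := by
    intro e he
    refine ⟨he.1.inv, fun β hβ x => ?_⟩
    have h1 := he.2 β hβ (- (e⁻¹ : Equiv.Perm F) (-x))
    have hx : e ((e⁻¹ : Equiv.Perm F) (-x)) = -x := by simp
    simp only [neg_neg, hx] at h1
    rw [neg_eq_iff_eq_neg] at h1 ⊢
    rw [← h1]
    simp

theorem comm_of_one_mod_four (hodd : Odd (Fintype.card F)) {a b c : F} (hv : ValidPair a b)
    (hneg : eta (-1 : F) = 1) (hC : Cen a b c) {M : Equiv.Perm F}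
    (hM : ∀ y, phi a b (M y) = phi a b y + c) (y : F) : M (y + c) = M y + c := by
  have hphi : ∀ u : F, phi a b (-u) = - phi a b u := by
    intro u
    by_cases hu : u = 0
    · subst hu; simp [phi_zero]
    rcases eta_cases u hu with h | h
    · rw [phi_eta_one a b h, phi_eta_one a b (by rw [eta_neg u, hneg, h]; rfl)]; ring
    · rw [phi_eta_neg a b h, phi_eta_neg a b (by rw [eta_neg u, hneg, h]; rfl)]; ring
  have hMmem : M ∈ EqG a b c := by
    refine ⟨equivar_M hv hM, ?_⟩
    have : (fun x => - M (-x)) = (M⁻¹ : Equiv.Perm F) := by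
      funext x
      apply M.injective
      apply phi_inj hv
      rw [hM, hphi, hM, hphi]
      simp
    rw [this]
    exact (equivar_M hv hM).inv
  have hτe : Equivar a b c (Equiv.addRight c) := by
    have := equivar_nat a b c 1
    simpa using this
  have hTmem : (Equiv.addRight c : Equiv.Perm F) ∈ EqG a b c := by
    refine ⟨hτe, ?_⟩
    have : (fun x => - (Equiv.addRight c) (-x)) = ((Equiv.addRight c : Equiv.Perm F)⁻¹ : Equiv.Perm F) := by
      funext x
      rw [Equiv.Perm.eq_inv_iff_eq]
      simp
    rw [this]
    exact hτe.inv
  let σ : EqG a b c →* EqG a b c :=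
    { toFun := fun e => ⟨Equiv.neg F * e.1 * Equiv.neg F, by
        refine ⟨e.2.2, ?_⟩
        have := e.2.1
        simpa using this⟩
      map_one' := by
        apply Subtype.ext
        ext x
        simp
      map_mul' := by
        intro e f
        apply Subtype.ext
        ext x
        simp }
  have hσ : ∀ (e : EqG a b c) (x : F), (σ e : Equiv.Perm F) x = - (e : Equiv.Perm F) (-x) :=
    fun _ _ => rfl
  have hinv : Function.Involutive σ := by
    intro e
    apply Subtype.ext
    ext x
    rw [hσ, hσ]
    simp
  have hfix : MonoidHom.FixedPointFree σ := by
    intro e he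
    have h0 := hσ e 0
    rw [he, neg_zero] at h0
    have h1 : (e : Equiv.Perm F) 0 = 0 := by
      have : (2 : F) * (e : Equiv.Perm F) 0 = 0 := by linear_combination h0
      rcases mul_eq_zero.1 this with h | h
      · exact absurd h (two_ne_zeroF hodd)
      · exact h
    apply Subtype.ext
    ext x
    exact hC.rigid e.2.1 (equivar_id a b c) h1 x
  have hcom := hfix.commute_all_of_involutive hinv ⟨M, hMmem⟩ ⟨_, hTmem⟩
  have h2 := congrArg (fun e : EqG a b c => (e : Equiv.Perm F) y) hcom.eq
  simpa using h2

/-- the outcome of the analysis of the commuting permutations -/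
theorem char_three (hodd : Odd (Fintype.card F)) {a b c : F} (hv : ValidPair a b) (hab : a ≠ b)
    (hc : c ≠ 0) (hC : Cen a b c) :
    CharP F 3 ∧ eta (-1 : F) = -1 ∧ a ≠ -1 ∧
      ∀ y, ¬ (inX 1 y ∧ inX 1 (y + c) ∧ inX 1 (y + c / a) ∧ inX 1 (y + c + c / a)) := by
  obtain ⟨M, hM⟩ := exists_M hv c
  obtain ⟨ha0, hb0, ha1, hb1, heab, heab1⟩ := valid_facts hv
  have hm1 : (-1 : F) ≠ 0 := neg_ne_zero.2 one_ne_zero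
  have hnc0 : ¬ ∀ y, M (y + c) = M y + c := fun h => no_abelian hodd hv hab hc hM h
  have hneg : eta (-1 : F) = -1 := by
    rcases eta_cases (-1 : F) hm1 with h | h
    · exact absurd (comm_of_one_mod_four hodd hv h hC hM) hnc0
    · exact h
  obtain ⟨p, hpc⟩ := CharP.exists F
  have hp : Fact p.Prime := ⟨CharP.char_is_prime F p⟩
  have hME := equivar_M hv hM
  have hnc : ∀ m : ℕ, 0 < m → m < p → ∀ y, M (y + m * c) ≠ M y + m * c := by
    intro m hm0 hmp y hy
    have hall : ∀ z, M (z + m * c) = M z + m * c :=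
      fun z => hC.rigid (hME.comp (equivar_nat a b c m)) ((equivar_nat a b c m).comp hME) hy z
    have hall2 : ∀ (n : ℕ) z, M (z + n * (m * c)) = M z + n * (m * c) := by
      intro n
      induction n with
      | zero => intro z; simp
      | succ n ih =>
        intro z
        push_cast
        rw [show z + ((n : F) + 1) * (m * c) = z + n * (m * c) + m * c by ring, hall, ih]
        ring
    have hcop : Nat.Coprime m p :=
      ((Nat.Prime.coprime_iff_not_dvd hp.out).2 (Nat.not_dvd_of_pos_of_lt hm0 hmp)).symm
    obtain ⟨n, -, hn⟩ := Nat.exists_mul_mod_eq_one_of_coprime hcop hp.out.one_lt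
    have hnm : (n : F) * m = 1 := by
      have h1 : ((m * n : ℕ) : F) = ((m * n % p : ℕ) : F) := CharP.cast_eq_mod F p _
      rw [hn] at h1
      push_cast at h1
      rw [mul_comm]; exact h1
    apply hnc0
    intro z
    have := hall2 n z
    rw [← mul_assoc, hnm, one_mul] at this
    exact this
  have e1 : ac a b 1 = a := if_pos rfl
  have hkey := fun y => keyM hv hab hc hM (χ := 1) (by norm_num) y
  rw [e1] at hkey
  have hcW := count_X hodd (χ := 1) (by norm_num) (c / a) (div_ne_zero hc ha0)
  rw [eta_neg (c / a), hneg] at hcW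
  set W := univ.filter (fun y : F => inX 1 y ∧ inX 1 (y + c / a)) with hW
  have hmemW : ∀ y, y ∈ W ↔ M y = y + c / a := by
    intro y
    rw [hkey, hW]; simp
  have hp3 : p = 3 := by
    have hp2 : p ≠ 2 := by
      rintro rfl
      exact two_ne_zeroF hodd (by have := CharP.cast_eq_zero F 2; simpa using this)
    have hinj : Set.InjOn (fun z : ℕ × F => z.2 + z.1 * c) ((Finset.range p ×ˢ W : Finset (ℕ × F)) : Set (ℕ × F)) := by
      have hlt : ∀ k k' : ℕ, k < k' → k' < p → ∀ y ∈ W, ∀ y' ∈ W, y + k * c ≠ y' + k' * c := by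
        intro k k' hk hk' y hy y' hy' h
        obtain ⟨m, rfl⟩ := Nat.exists_eq_add_of_lt hk
        apply hnc (m + 1) (by omega) (by omega) y'
        have hyy : y = y' + ((m + 1 : ℕ) : F) * c := by
          push_cast at h ⊢
          linear_combination h
        rw [hmemW] at hy hy'
        rw [← hyy, hy, hy', hyy]; ring
      rintro ⟨k, y⟩ h ⟨k', y'⟩ h' heq
      simp only [Finset.coe_product, Set.mem_prod, Finset.mem_coe, Finset.mem_range] at h h'
      simp only at heq
      rcases lt_trichotomy k k' with hk | hk | hk
      · exact absurd heq (hlt k k' hk h'.1 y h.2 y' h'.2)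
      · subst hk
        rw [add_right_cancel heq]
      · exact absurd heq.symm (hlt k' k hk h.1 y' h'.2 y h.2)
    have hle := Finset.card_le_card_of_injOn (t := (univ : Finset F)) _ (fun _ _ => Finset.mem_univ _) hinj
    rw [Finset.card_product, Finset.card_range, Finset.card_univ] at hle
    have hW4 : 4 * W.card = Fintype.card F + 1 := by
      have : (4 : ℤ) * (W.card : ℤ) = (Fintype.card F : ℤ) + 1 := by linear_combination hcW
      omega
    have hp4 : p < 4 := by
      by_contra hcon
      push Not at hcon
      have := Nat.mul_le_mul_right W.card hcon
      omega
    have := hp.out.two_le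
    omega
  subst hp3
  have h30 : (3 : F) = 0 := by have := CharP.cast_eq_zero F 3; simpa using this
  refine ⟨hpc, hneg, ?_, ?_⟩
  · rintro rfl
    have hWne : W.Nonempty := by
      rw [← Finset.card_pos]
      have : (4 : ℤ) * (W.card : ℤ) = (Fintype.card F : ℤ) + 1 := by linear_combination hcW
      omega
    obtain ⟨y, hy⟩ := hWne
    rw [hmemW] at hy
    have h1 : M y + ((1 : ℕ) : F) * c = y := by
      rw [hy, div_neg, div_one]; push_cast; ring
    have hall : ∀ z, M z + ((1 : ℕ) : F) * c = z :=
      fun z => hC.rigid ((equivar_nat _ b c 1).comp hME) (equivar_id _ b c) h1 z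
    apply hnc0
    intro z
    have h2 := hall z
    have h3 := hall (z + c)
    push_cast at h2 h3
    linear_combination h3 - h2
  · rintro y ⟨h1, h2, h3, h4⟩
    have k1 := (hkey y).2 ⟨h1, h3⟩
    have k2 := (hkey (y + c)).2 ⟨h2, h4⟩
    apply hnc 1 (by norm_num) (by norm_num) y
    push_cast
    rw [one_mul, k2, k1]; ring

theorem inX_mul {χ : ℤ} {r y : F} (h : inX χ y) : inX (χ * eta r) (r * y) := by
  rcases h with rfl | h
  · left; simp
  · right; rw [eta_mul, h, mul_comm]

theorem no_rect {a c : F} (ha0 : a ≠ 0) (hc : c ≠ 0) (hneg : eta (-1 : F) = -1)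
    (h : ∀ y, ¬ (inX 1 y ∧ inX 1 (y + c) ∧ inX 1 (y + c / a) ∧ inX 1 (y + c + c / a)))
    {s : F} (hs : s ≠ 0) {χ : ℤ} (hχ : χ * χ = 1) (y : F) :
    ¬ (inX χ y ∧ inX χ (y + s) ∧ inX χ (y + s / a) ∧ inX χ (y + s + s / a)) := by
  rintro ⟨h1, h2, h3, h4⟩
  have hr : c / s ≠ 0 := div_ne_zero hc hs
  by_cases hχr : χ * eta (c / s) = 1
  · apply h (c / s * y)
    have g1 := inX_mul (r := c / s) h1
    have g2 := inX_mul (r := c / s) h2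
    have g3 := inX_mul (r := c / s) h3
    have g4 := inX_mul (r := c / s) h4
    rw [hχr] at g1 g2 g3 g4
    refine ⟨g1, ?_, ?_, ?_⟩
    · convert g2 using 1; field_simp
    · convert g3 using 1; field_simp
    · convert g4 using 1; field_simp
  · have hχr' : χ * eta (-(c / s)) = 1 := by
      rw [eta_neg (c / s), hneg]
      rcases chi_cases hχ with rfl | rfl <;> rcases eta_cases _ hr with h5 | h5 <;>
        rw [h5] at hχr ⊢ <;> omega
    apply h (-(c / s) * y - c - c / a)
    have g1 := inX_mul (r := -(c / s)) h1
    have g2 := inX_mul (r := -(c / s)) h2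
    have g3 := inX_mul (r := -(c / s)) h3
    have g4 := inX_mul (r := -(c / s)) h4
    rw [hχr'] at g1 g2 g3 g4
    refine ⟨?_, ?_, ?_, ?_⟩
    · convert g4 using 1; field_simp; ring
    · convert g3 using 1; field_simp; ring
    · convert g2 using 1; field_simp; ring
    · convert g1 using 1; field_simp; ring

set_option linter.unusedSectionVars false
set_option linter.unusedVariables false

/-! ### The characteristic three grid -/

theorem sum_sq_shift (hodd : Odd (Fintype.card F)) {ι : Type} [Fintype ι] (g : ι → F)
    (hg : Function.Injective g) :
    ∑ y : F, (∑ i, eta (y + g i)) * (∑ i, eta (y + g i)) =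
      (Fintype.card ι : ℤ) * Fintype.card F - (Fintype.card ι : ℤ) * (Fintype.card ι : ℤ) := by
  have h1 : ∀ y : F, (∑ i, eta (y + g i)) * (∑ i, eta (y + g i)) =
      ∑ i, ∑ j, eta (y + g i) * eta (y + g j) := by
    intro y
    rw [Finset.sum_mul_sum]
  rw [Finset.sum_congr rfl (fun y _ => h1 y), Finset.sum_comm]
  have h2 : ∀ i j : ι, ∑ y : F, eta (y + g i) * eta (y + g j) =
      (if i = j then (Fintype.card F : ℤ) else 0) - 1 := by
    intro i j
    by_cases h : i = j
    · subst h; rw [eta_sq_sum, if_pos rfl]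
    · rw [eta_corr2 hodd _ _ (fun h' => h (hg h')), if_neg h]; norm_num
  have h3 : ∀ i : ι, ∑ y : F, ∑ j, eta (y + g i) * eta (y + g j) =
      (Fintype.card F : ℤ) - Fintype.card ι := by
    intro i
    rw [Finset.sum_comm, Finset.sum_congr rfl (fun j _ => h2 i j), Finset.sum_sub_distrib]
    simp
  rw [Finset.sum_congr rfl (fun i _ => h3 i)]
  simp only [Finset.sum_const, Finset.card_univ, nsmul_eq_mul]
  ring

/-- sign of a boolean -/
def sg : Bool → ℤ
  | true => 1
  | false => -1

/-- the grid sum -/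
def sg9 (x00 x01 x02 x10 x11 x12 x20 x21 x22 : Bool) : ℤ :=
  (sg x00 + sg x01 + sg x02 + (sg x10 + sg x11 + sg x12) + (sg x20 + sg x21 + sg x22))

/-- four equal booleans -/
def rc (x y z w : Bool) : Bool := (x && y && z && w) || (!x && !y && !z && !w)

theorem rc_false {x y z w : Bool} (h : ∀ c : Bool, ¬ (x = c ∧ y = c ∧ z = c ∧ w = c)) :
    rc x y z w = false := by
  have h1 := h true
  have h2 := h false
  cases x <;> cases y <;> cases z <;> cases w <;> first | rfl | (exfalso; simp at h1 h2; done)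

/-- the boolean check of the grid statement -/
def gchk (x00 x01 x02 x10 x11 x12 x20 x21 x22 : Bool) : Bool :=
  rc x00 x01 x10 x11 ||
  rc x01 x02 x11 x12 ||
  rc x02 x00 x12 x10 ||
  rc x10 x11 x20 x21 ||
  rc x11 x12 x21 x22 ||
  rc x12 x10 x22 x20 ||
  rc x20 x21 x00 x01 ||
  rc x21 x22 x01 x02 ||
  rc x22 x20 x02 x00 ||
  Int.beq' (sg9 x00 x01 x02 x10 x11 x12 x20 x21 x22 * sg9 x00 x01 x02 x10 x11 x12 x20 x21 x22) 1 ||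
  (Int.beq' (sg9 x00 x01 x02 x10 x11 x12 x20 x21 x22 * sg9 x00 x01 x02 x10 x11 x12 x20 x21 x22) 9 &&
    Int.beq' ((sg x00 + sg x01 + sg x02) * (sg x00 + sg x01 + sg x02)) 1 &&
    Int.beq' ((sg x00 + sg x10 + sg x20) * (sg x00 + sg x10 + sg x20)) 1)

/-- conjunction over both booleans -/
def allB (f : Bool → Bool) : Bool := f true && f false

theorem allB_spec {f : Bool → Bool} (h : allB f = true) (x : Bool) : f x = true := by
  unfold allB at h
  rw [Bool.and_eq_true] at h
  cases x
  · exact h.2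
  · exact h.1

theorem gchk_all : (allB fun x00 => allB fun x01 => allB fun x02 => allB fun x10 => allB fun x11 =>
    allB fun x12 => allB fun x20 => allB fun x21 => allB fun x22 =>
    gchk x00 x01 x02 x10 x11 x12 x20 x21 x22) = true := by
  decide +kernel

theorem grid_decide (x00 x01 x02 x10 x11 x12 x20 x21 x22 : Bool) :
    (∀ c : Bool, ¬ (x00 = c ∧ x01 = c ∧ x10 = c ∧ x11 = c)) →
    (∀ c : Bool, ¬ (x01 = c ∧ x02 = c ∧ x11 = c ∧ x12 = c)) →
    (∀ c : Bool, ¬ (x02 = c ∧ x00 = c ∧ x12 = c ∧ x10 = c)) →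
    (∀ c : Bool, ¬ (x10 = c ∧ x11 = c ∧ x20 = c ∧ x21 = c)) →
    (∀ c : Bool, ¬ (x11 = c ∧ x12 = c ∧ x21 = c ∧ x22 = c)) →
    (∀ c : Bool, ¬ (x12 = c ∧ x10 = c ∧ x22 = c ∧ x20 = c)) →
    (∀ c : Bool, ¬ (x20 = c ∧ x21 = c ∧ x00 = c ∧ x01 = c)) →
    (∀ c : Bool, ¬ (x21 = c ∧ x22 = c ∧ x01 = c ∧ x02 = c)) →
    (∀ c : Bool, ¬ (x22 = c ∧ x20 = c ∧ x02 = c ∧ x00 = c)) →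
    sg9 x00 x01 x02 x10 x11 x12 x20 x21 x22 * sg9 x00 x01 x02 x10 x11 x12 x20 x21 x22 ≤ 9 ∧
    (sg9 x00 x01 x02 x10 x11 x12 x20 x21 x22 * sg9 x00 x01 x02 x10 x11 x12 x20 x21 x22 = 9 →
      (sg x00 + sg x01 + sg x02) * (sg x00 + sg x01 + sg x02) = 1 ∧
      (sg x00 + sg x10 + sg x20) * (sg x00 + sg x10 + sg x20) = 1) := by
  intro h0 h1 h2 h3 h4 h5 h6 h7 h8
  have h := allB_spec (allB_spec (allB_spec (allB_spec (allB_spec (allB_spec (allB_spec (allB_spec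
    (allB_spec gchk_all x00) x01) x02) x10) x11) x12) x20) x21) x22
  unfold gchk at h
  rw [rc_false h0, rc_false h1, rc_false h2, rc_false h3, rc_false h4, rc_false h5, rc_false h6, rc_false h7, rc_false h8] at h
  simp only [Bool.false_or, Bool.or_eq_true, Bool.and_eq_true, Int.beq'_eq] at h
  rcases h with h | ⟨⟨h, h'⟩, h''⟩
  · exact ⟨by rw [h]; norm_num, fun h3 => by rw [h] at h3; norm_num at h3⟩
  · exact ⟨h.le, fun _ => ⟨h', h''⟩⟩

theorem sum3 (f : ZMod 3 → ℤ) : ∑ i, f i = f 0 + f 1 + f (-1) := by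
  rw [show (univ : Finset (ZMod 3)) = {0, 1, -1} from by decide]
  rw [Finset.sum_insert (by decide), Finset.sum_insert (by decide), Finset.sum_singleton]
  ring

theorem sum3_prime (f : ZMod 3 → ℤ) : ∑ i, f i = f 0 + f 1 + f 2 := by
  rw [sum3, show (-1 : ZMod 3) = 2 from by decide]

theorem z3_facts : (1 : ZMod 3) = 0 + 1 ∧ (2 : ZMod 3) = 1 + 1 ∧ (0 : ZMod 3) = 2 + 1 := by decide

section grid
variable [CharP F 3]

/-- the prime field embedding -/
def v3 : ZMod 3 →+* F := ZMod.castHom (dvd_refl 3) F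

theorem v3_cases (i : ZMod 3) : (v3 i : F) = 0 ∨ (v3 i : F) = 1 ∨ (v3 i : F) = -1 := by
  have : i = 0 ∨ i = 1 ∨ i = -1 := by revert i; decide
  rcases this with rfl | rfl | rfl <;> simp

/-- the grid -/
def gr (t s : F) (z : ZMod 3 × ZMod 3) : F := t * v3 z.1 + s * v3 z.2

theorem gr_inj {t s : F} (ht : t ≠ 0) (hs : s ≠ 0) (h1 : s ≠ t) (h2 : s ≠ -t) :
    Function.Injective (gr t s) := by
  rintro ⟨i, j⟩ ⟨i', j'⟩ h
  simp only [gr] at h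
  have h3 : t * v3 (i - i') = s * v3 (j' - j) := by
    rw [map_sub, map_sub]; linear_combination h
  have hinj : Function.Injective (v3 : ZMod 3 →+* F) := (v3 : ZMod 3 →+* F).injective
  have hj : (v3 (j' - j) : F) = 0 := by
    rcases v3_cases (F := F) (i - i') with h4 | h4 | h4 <;>
      rcases v3_cases (F := F) (j' - j) with h5 | h5 | h5 <;> rw [h4, h5] at h3
    · exact h5
    · exact absurd (by linear_combination -h3) hs
    · exact absurd (by linear_combination h3) hs
    · exact h5
    · exact absurd (by linear_combination -h3) h1
    · exact absurd (by linear_combination h3) h2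
    · exact h5
    · exact absurd (by linear_combination -h3) h2
    · exact absurd (by linear_combination h3) h1
  rw [hj, mul_zero] at h3
  have hi : (v3 (i - i') : F) = 0 := (mul_eq_zero.1 h3).resolve_left ht
  have hj' := hinj (hj.trans (map_zero _).symm)
  have hi' := hinj (hi.trans (map_zero _).symm)
  rw [sub_eq_zero] at hi' hj'
  rw [hi', hj']

theorem sum_odd (hneg : eta (-1 : F) = -1) {ι : Type} [Fintype ι] [AddCommGroup ι] (g : ι →+ F) :
    ∑ i, eta (g i) = 0 := by
  have h := Equiv.sum_comp (Equiv.neg ι) (fun i => eta (g i))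
  simp only [Equiv.neg_apply, map_neg] at h
  rw [Finset.sum_congr rfl (fun i _ => eta_neg (g i)), ← Finset.mul_sum, hneg] at h
  omega

/-- the row homomorphism -/
def rowH (t : F) : ZMod 3 →+ F := (AddMonoidHom.mulLeft t).comp (v3 : ZMod 3 →+* F).toAddMonoidHom

theorem rowH_apply (t : F) (i : ZMod 3) : rowH t i = t * v3 i := rfl

/-- the grid homomorphism -/
def grH (t s : F) : ZMod 3 × ZMod 3 →+ F := (rowH t).coprod (rowH s)

theorem grH_apply (t s : F) (z : ZMod 3 × ZMod 3) : grH t s z = gr t s z := rfl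

theorem sum_shiftH {ι : Type} [Fintype ι] [AddCommGroup ι] (g : ι →+ F) (y : F) (k : ι) :
    ∑ i, eta (y + g k + g i) = ∑ i, eta (y + g i) := by
  rw [← Equiv.sum_comp (Equiv.addLeft k) (fun i => eta (y + g i))]
  apply Finset.sum_congr rfl
  intro i _
  simp [add_assoc]

theorem row_sum (t y : F) : ∑ i, eta (y + rowH t i) = eta y + eta (y + t) + eta (y - t) := by
  rw [show (univ : Finset (ZMod 3)) = {0, 1, -1} from by decide]
  rw [Finset.sum_insert (by decide), Finset.sum_insert (by decide), Finset.sum_singleton]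
  simp only [rowH_apply, map_zero, map_one, map_neg, mul_zero, add_zero, mul_one, mul_neg,
    ← sub_eq_add_neg]
  ring

theorem row_big (hodd : Odd (Fintype.card F)) (hq : 23 < Fintype.card F)
    (hneg : eta (-1 : F) = -1) {t s : F} (ht : t ≠ 0) (hs : s ≠ 0) (h1 : s ≠ t) (h2 : s ≠ -t)
    (hrow : ∀ y, y ∉ univ.image (gr t s) →
      (∑ i, eta (y + rowH t i)) * (∑ i, eta (y + rowH t i)) = 1) :
    eta s = eta (s + t) ∧ eta s = eta (s - t) := by
  have hinj := gr_inj ht hs h1 h2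
  have hinjr : Function.Injective (rowH t) := by
    intro i i' h
    have := @hinj (i, 0) (i', 0) (by simpa [gr, rowH_apply] using h)
    simpa using this
  have hS := sum_sq_shift hodd (rowH t) hinjr
  set V := univ.image (gr t s) with hV
  have hVc : V.card = 9 := by
    rw [hV, Finset.card_image_of_injective _ hinj]; rfl
  rw [← Finset.sum_add_sum_compl V] at hS
  have hcomp : ∑ y ∈ Vᶜ, (∑ i, eta (y + rowH t i)) * (∑ i, eta (y + rowH t i)) =
      (Fintype.card F : ℤ) - 9 := by
    rw [Finset.sum_congr rfl (fun y hy => hrow y (Finset.mem_compl.1 hy))]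
    simp only [Finset.sum_const, Finset.card_compl, hVc, nsmul_eq_mul, mul_one]
    rw [Nat.cast_sub (by omega)]; norm_num
  rw [hcomp] at hS
  have hsum0 : ∑ i, eta ((0 : F) + rowH t i) = 0 := by
    simp only [zero_add]; exact sum_odd hneg _
  have hsumV : ∑ y ∈ V, (∑ i, eta (y + rowH t i)) * (∑ i, eta (y + rowH t i)) =
      6 * ((∑ i, eta (s + rowH t i)) * (∑ i, eta (s + rowH t i))) := by
    rw [hV, Finset.sum_image (fun x _ y _ h => hinj h)]
    rw [Fintype.sum_prod_type]
    have h3 : ∀ k l : ZMod 3, ∑ i, eta (gr t s (k, l) + rowH t i) = ∑ i, eta (s * v3 l + rowH t i) := by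
      intro k l
      rw [← sum_shiftH (rowH t) (s * v3 l) k]
      apply Finset.sum_congr rfl
      intro i _
      exact congrArg eta (by simp only [gr, rowH_apply]; ring)
    simp only [h3]
    rw [Finset.sum_const, Finset.card_univ, ZMod.card]
    rw [sum3 (fun l => (∑ i, eta (s * v3 l + rowH t i)) * ∑ i, eta (s * v3 l + rowH t i))]
    have hm : ∑ i, eta (-s + rowH t i) = - ∑ i, eta (s + rowH t i) := by
      rw [← Equiv.sum_comp (Equiv.neg (ZMod 3)), ← Finset.sum_neg_distrib]
      apply Finset.sum_congr rfl
      intro i _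
      rw [Equiv.neg_apply, map_neg, ← neg_add, eta_neg (s + _), hneg]; ring
    simp only [map_zero, map_one, map_neg, mul_zero, mul_one, mul_neg]
    rw [hsum0, hm]
    ring
  rw [hsumV, ZMod.card, row_sum] at hS
  have hst : s + t ≠ 0 := fun h => h2 (by linear_combination h)
  have hst' : s - t ≠ 0 := sub_ne_zero.2 h1
  rcases eta_cases s hs with e1 | e1 <;> rcases eta_cases _ hst with e2 | e2 <;>
    rcases eta_cases _ hst' with e3 | e3 <;> rw [e1, e2, e3] at hS ⊢ <;>
    first
      | (exfalso; push_cast at hS; omega)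
      | exact ⟨rfl, rfl⟩

theorem grid_contra (hodd : Odd (Fintype.card F)) (hq : 23 < Fintype.card F)
    (hneg : eta (-1 : F) = -1) {a : F} (ha0 : a ≠ 0) (ha1 : a ≠ 1) (ham : a ≠ -1)
    (hnr : ∀ χ : ℤ, χ * χ = 1 → ∀ y : F,
      ¬ (inX χ y ∧ inX χ (y + a) ∧ inX χ (y + 1) ∧ inX χ (y + a + 1))) : False := by
  have hinj : Function.Injective (gr (1 : F) a) := gr_inj one_ne_zero ha0 ha1 ham
  set V := univ.image (gr (1 : F) a) with hV
  have hVc : V.card = 9 := by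
    rw [hV, Finset.card_image_of_injective _ hinj]; rfl
  have h30 : (3 : F) = 0 := by have := CharP.cast_eq_zero F 3; simpa using this
  -- the grid sums
  have hloc : ∀ y, y ∉ V →
      (∑ z, eta (y + gr 1 a z)) * (∑ z, eta (y + gr 1 a z)) ≤ 9 ∧
      ((∑ z, eta (y + gr 1 a z)) * (∑ z, eta (y + gr 1 a z)) = 9 →
        (∑ i, eta (y + rowH 1 i)) * (∑ i, eta (y + rowH 1 i)) = 1 ∧
        (∑ i, eta (y + rowH a i)) * (∑ i, eta (y + rowH a i)) = 1) := by
    intro y hy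
    have hne : ∀ z, y + gr 1 a z ≠ 0 := by
      intro z hz
      apply hy
      rw [hV, Finset.mem_image]
      refine ⟨-z, Finset.mem_univ _, ?_⟩
      rw [← grH_apply, map_neg, grH_apply]
      linear_combination -hz
    obtain ⟨x, hsg⟩ : ∃ x : ZMod 3 × ZMod 3 → Bool, ∀ z, eta (y + gr 1 a z) = sg (x z) := by
      refine ⟨fun z => decide (eta (y + gr 1 a z) = 1), fun z => ?_⟩
      rcases eta_cases _ (hne z) with h | h <;> simp [sg, h]
    have hrect : ∀ i i' j j' : ZMod 3, i' = i + 1 → j' = j + 1 → ∀ c : Bool,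
        ¬ (x (i, j) = c ∧ x (i, j') = c ∧ x (i', j) = c ∧ x (i', j') = c) := by
      rintro i _ j _ rfl rfl c ⟨k1, k2, k3, k4⟩
      have hc : sg c * sg c = 1 := by cases c <;> rfl
      apply hnr (sg c) hc (y + gr 1 a (i, j))
      refine ⟨Or.inr (by rw [hsg, k1]), Or.inr ?_, Or.inr ?_, Or.inr ?_⟩
      · rw [← k2, ← hsg]
        exact congrArg eta (by simp only [gr, map_add, map_one]; ring)
      · rw [← k3, ← hsg]
        exact congrArg eta (by simp only [gr, map_add, map_one]; ring)
      · rw [← k4, ← hsg]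
        exact congrArg eta (by simp only [gr, map_add, map_one]; ring)
    have hG := grid_decide (x (0, 0)) (x (0, 1)) (x (0, 2)) (x (1, 0)) (x (1, 1)) (x (1, 2))
      (x (2, 0)) (x (2, 1)) (x (2, 2))
      (hrect 0 1 0 1 z3_facts.1 z3_facts.1)
      (hrect 0 1 1 2 z3_facts.1 z3_facts.2.1)
      (hrect 0 1 2 0 z3_facts.1 z3_facts.2.2)
      (hrect 1 2 0 1 z3_facts.2.1 z3_facts.1)
      (hrect 1 2 1 2 z3_facts.2.1 z3_facts.2.1)
      (hrect 1 2 2 0 z3_facts.2.1 z3_facts.2.2)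
      (hrect 2 0 0 1 z3_facts.2.2 z3_facts.1)
      (hrect 2 0 1 2 z3_facts.2.2 z3_facts.2.1)
      (hrect 2 0 2 0 z3_facts.2.2 z3_facts.2.2)
    unfold sg9 at hG
    have hu := sum3_prime
    have e1 : ∑ z, eta (y + gr 1 a z) = sg (x (0, 0)) + sg (x (0, 1)) + sg (x (0, 2)) +
        (sg (x (1, 0)) + sg (x (1, 1)) + sg (x (1, 2))) +
        (sg (x (2, 0)) + sg (x (2, 1)) + sg (x (2, 2))) := by
      rw [Fintype.sum_prod_type]
      simp only [hu, hsg]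
    have e2 : ∑ i, eta (y + rowH 1 i) = sg (x (0, 0)) + sg (x (1, 0)) + sg (x (2, 0)) := by
      rw [← hsg, ← hsg, ← hsg, hu]
      simp [gr, rowH_apply]
    have e3 : ∑ i, eta (y + rowH a i) = sg (x (0, 0)) + sg (x (0, 1)) + sg (x (0, 2)) := by
      rw [← hsg, ← hsg, ← hsg, hu]
      simp [gr, rowH_apply]
    rw [e1, e2, e3]
    exact ⟨hG.1, fun h => ⟨(hG.2 h).2, (hG.2 h).1⟩⟩
  have hσV : ∀ y ∈ V, (∑ z, eta (y + gr 1 a z)) * (∑ z, eta (y + gr 1 a z)) = 0 := by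
    intro y hy
    rw [hV, Finset.mem_image] at hy
    obtain ⟨k, -, rfl⟩ := hy
    have h1 := sum_shiftH (grH (1 : F) a) 0 k
    have h0 := sum_odd hneg (grH (1 : F) a)
    simp only [zero_add, grH_apply] at h0 h1
    rw [h1, h0, zero_mul]
  have hS := sum_sq_shift hodd (gr (1 : F) a) hinj
  rw [← Finset.sum_add_sum_compl V, Finset.sum_eq_zero hσV, zero_add] at hS
  have hall : ∀ y, y ∉ V → (∑ z, eta (y + gr 1 a z)) * (∑ z, eta (y + gr 1 a z)) = 9 := by
    have hle : ∀ y ∈ Vᶜ, (∑ z, eta (y + gr 1 a z)) * (∑ z, eta (y + gr 1 a z)) ≤ 9 :=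
      fun y hy => (hloc y (Finset.mem_compl.1 hy)).1
    have := (Finset.sum_eq_sum_iff_of_le hle).1 (by
      rw [hS]
      simp only [Finset.sum_const, Finset.card_compl, hVc, nsmul_eq_mul]
      rw [Nat.cast_sub (by omega)]
      have : Fintype.card (ZMod 3 × ZMod 3) = 9 := rfl
      rw [this]; push_cast; ring)
    exact fun y hy => this y (Finset.mem_compl.2 hy)
  have hV2 : univ.image (gr a (1 : F)) = V := by
    rw [hV]
    ext y
    simp only [Finset.mem_image, Finset.mem_univ, true_and, gr]
    constructor
    · rintro ⟨⟨i, j⟩, rfl⟩; exact ⟨(j, i), by ring⟩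
    · rintro ⟨⟨i, j⟩, rfl⟩; exact ⟨(j, i), by ring⟩
  have r1 := row_big hodd hq hneg one_ne_zero ha0 ha1 ham
    (fun y hy => ((hloc y hy).2 (hall y hy)).1)
  have r2 := row_big hodd hq hneg ha0 one_ne_zero ha1.symm
    (fun h => ham (by rw [h, neg_neg])) (fun y hy => by
      rw [hV2] at hy
      exact ((hloc y hy).2 (hall y hy)).2)
  have h5 : eta (a - 1) = - eta (1 - a) := by
    rw [← neg_sub, eta_neg (1 - a), hneg]; ring
  have h6 : (1 : F) + a = a + 1 := by ring
  rw [h6] at r2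
  have h7 : eta (a - 1) = 0 := by
    have := r1.1; have := r1.2; have := r2.1; have := r2.2
    omega
  rw [eta_eq_zero_iff] at h7
  exact ha1 (sub_eq_zero.1 h7)

end grid

theorem cen_contra (hodd : Odd (Fintype.card F)) (hq : 23 < Fintype.card F) {a b c : F}
    (hv : ValidPair a b) (hab : a ≠ b) (hc : c ≠ 0) (hC : Cen a b c) : False := by
  obtain ⟨h3, hneg, ham, hnr⟩ := char_three hodd hv hab hc hC
  obtain ⟨ha0, hb0, ha1, hb1, heab, heab1⟩ := valid_facts hv
  refine grid_contra hodd hq hneg ha0 ?_ ham ?_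
  · first
      | exact ha1
      | exact fun h => ha1 (by rw [h]; simp)
  · intro χ hχ y
    have := no_rect ha0 hc hneg hnr ha0 hχ y
    rw [div_self ha0] at this
    exact this

theorem all_diag (hodd : Odd (Fintype.card F)) (hq : 23 < Fintype.card F) {a b : F}
    (hv : ValidPair a b) (hab : a ≠ b) : ∀ g ∈ AtpG a b, g.1 = g.2.1 ∧ g.1 = g.2.2 := by
  by_contra hnd
  obtain ⟨c, hc, h⟩ := central_step hodd hq hv hab (atp_dichotomy hodd hq hv hnd)
  refine cen_contra hodd hq hv hab hc (fun y => ?_)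
  obtain ⟨β, γ, h0, h1, h2, h3⟩ := h y
  exact ⟨β, ⟨γ, h1, h2, h3⟩, h0⟩

/-- Lemma 5.1: if `q > 23`, `(a,b)` is valid with `a ≠ b`, and `Atp_i(Q_{a,b})` is
2-transitive, then every element of `Atp_i(Q_{a,b})` is an affine permutation. -/
theorem atp_proj_affine_of_two_transitive
    (hodd : Odd (Fintype.card F)) (hq : 23 < Fintype.card F)
    (a b : F) (hv : ValidPair a b) (hab : a ≠ b) (i : Fin 3)
    (h : TwoTransitive (AtpProj a b i)) :
    ∀ g ∈ AtpProj a b i, IsAffinePerm g := by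
  have hd := all_diag hodd hq hv hab
  have hEq : AtpProj a b i = (AutQ a b : Set (Equiv.Perm F)) := by
    ext g
    constructor
    · rintro ⟨α, β, γ, hat, rfl⟩
      obtain ⟨h1, h2⟩ := hd (α, β, γ) hat
      simp only at h1 h2
      subst h1 h2
      have hm : α ∈ AutQ a b := hat
      fin_cases i <;> exact hm
    · intro hg
      refine ⟨g, g, g, hg, ?_⟩
      fin_cases i <;> rfl
  rw [hEq] at h ⊢
  exact aut_affine hodd hq hv hab h
end
end
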